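/- Let k be an algebraically closed field and Q a connected strongly locally finite quiver. Then there exists an indecomposable representation in rep(Q) which does not lie in rrep(Q) if and only if Q is not a star quiver. -/

import Mathlib

open CategoryTheory CategoryTheory.Limits

namespace Paper

variable (k : Type) [Field k]

section General

variable (A : Type) [Category.{0} A] [Preadditive A] [CategoryTheory.Linear k A]

/-- A spectroid over `k`: a (small) Hom-finite `k`-linear category in which every object
has a local endomorphism ring and distinct objects are not isomorphic. -/
class Spectroid : Prop where
  homFinite : ∀ a b : A, FiniteDimensional k (a ⟶ b)
  localEnd : ∀ a : A, IsLocalRing (End a)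
  skeletal : ∀ a b : A, (a ≅ b) → a = b

variable {A}

/-- `M` is a module over `A`, i.e. the functor `M : A ⥤ ModuleCat k` is additive and
`k`-linear on morphisms. -/
def IsMod (M : A ⥤ ModuleCat.{0} k) : Prop :=
  (∀ {a b : A} (f g : a ⟶ b), M.map (f + g) = M.map f + M.map g) ∧
  (∀ {a b : A} (r : k) (f : a ⟶ b), M.map (r • f) = r • M.map f)

/-- `M` is a locally finite dimensional module over `A`, i.e. an object of `mod A`. -/
def IsLfdMod (M : A ⥤ ModuleCat.{0} k) : Prop :=
  IsMod k M ∧ ∀ a : A, FiniteDimensional k (M.obj a)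

/-- The projective module `P_a = Hom_A(a, -)` at an object `a`. -/
noncomputable def ProjAt (a : A) : A ⥤ ModuleCat.{0} k :=
  (linearCoyoneda k A).obj (Opposite.op a)

/-- The injective module `I_a = D Hom_A(-, a)` at an object `a`. -/
noncomputable def InjAt (a : A) : A ⥤ ModuleCat.{0} k where
  obj b := ModuleCat.of k (Module.Dual k (b ⟶ a))
  map {b c} f := ModuleCat.ofHom (LinearMap.dualMap (Linear.leftComp k a f))
  map_id b := by
    have h : Linear.leftComp k a (𝟙 b) = LinearMap.id := by
      apply LinearMap.ext; intro g; simp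
    rw [h, LinearMap.dualMap_id]; rfl
  map_comp {b c d} f g := by
    have h : Linear.leftComp k a (f ≫ g) =
        (Linear.leftComp k a f).comp (Linear.leftComp k a g) := by
      apply LinearMap.ext; intro h; simp
    rw [h]; rfl

instance : HasFiniteBiproducts (A ⥤ ModuleCat.{0} k) :=
  CategoryTheory.Abelian.hasFiniteBiproducts

/-- `M` is finitely generated: there is an epimorphism `⊕_{i=1}^r P_{a_i} → M`. -/
def IsFG (M : A ⥤ ModuleCat.{0} k) : Prop :=
  ∃ (r : ℕ) (a : Fin r → A) (f : (⨁ fun i => ProjAt k (a i)) ⟶ M), Epi f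

/-- `M` is finitely presented: there is an epimorphism `⊕_{i=1}^r P_{a_i} → M` with
finitely generated kernel. -/
def IsFP (M : A ⥤ ModuleCat.{0} k) : Prop :=
  ∃ (r : ℕ) (a : Fin r → A) (f : (⨁ fun i => ProjAt k (a i)) ⟶ M),
    Epi f ∧ IsFG k (kernel f)

/-- `M` is finitely co-generated: there is a monomorphism `M → ⊕_{j=1}^s I_{b_j}`. -/
def IsFCG (M : A ⥤ ModuleCat.{0} k) : Prop :=
  ∃ (s : ℕ) (b : Fin s → A) (f : M ⟶ ⨁ fun j => InjAt k (b j)), Mono f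

/-- `M` is finitely co-presented: there is a monomorphism `M → ⊕_{j=1}^s I_{b_j}` with
finitely co-generated cokernel. -/
def IsFCP (M : A ⥤ ModuleCat.{0} k) : Prop :=
  ∃ (s : ℕ) (b : Fin s → A) (f : M ⟶ ⨁ fun j => InjAt k (b j)),
    Mono f ∧ IsFCG k (cokernel f)

/-- `f` is an irreducible morphism in `mod A`: it is neither a split mono nor a split epi,
and in any factorization `f = g ≫ h` through an object of `mod A`, `g` is a split mono
or `h` is a split epi. -/
def Irred {L M : A ⥤ ModuleCat.{0} k} (f : L ⟶ M) : Prop :=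
  ¬ IsSplitMono f ∧ ¬ IsSplitEpi f ∧
    ∀ ⦃X : A ⥤ ModuleCat.{0} k⦄, IsLfdMod k X →
      ∀ (g : L ⟶ X) (h : X ⟶ M), g ≫ h = f → IsSplitMono g ∨ IsSplitEpi h

/-- `M` is an indecomposable object of `mod A`: it is nonzero, and whenever `M ≅ X ⊞ Y`
with `X`, `Y` in `mod A`, one of `X`, `Y` is zero. -/
def Indec (M : A ⥤ ModuleCat.{0} k) : Prop :=
  ¬ IsZero M ∧ ∀ ⦃X Y : A ⥤ ModuleCat.{0} k⦄, IsLfdMod k X → IsLfdMod k Y →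
    (M ≅ X ⊞ Y) → IsZero X ∨ IsZero Y

/-- `0 → L →f M →g N → 0` is an almost split sequence in `mod A`. -/
structure AlmostSplitSeq {L M N : A ⥤ ModuleCat.{0} k} (f : L ⟶ M) (g : M ⟶ N) : Prop where
  mono : Mono f
  epi : Epi g
  zero : f ≫ g = 0
  exact : (ShortComplex.mk f g zero).Exact
  not_splitMono : ¬ IsSplitMono f
  not_splitEpi : ¬ IsSplitEpi g
  left_almost_split : ∀ ⦃X : A ⥤ ModuleCat.{0} k⦄, IsLfdMod k X →
    ∀ u : L ⟶ X, ¬ IsSplitMono u → ∃ v : M ⟶ X, f ≫ v = u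
  right_almost_split : ∀ ⦃X : A ⥤ ModuleCat.{0} k⦄, IsLfdMod k X →
    ∀ u : X ⟶ N, ¬ IsSplitEpi u → ∃ v : X ⟶ M, v ≫ g = u

/-- `M` is projective as an object of `mod A`. -/
def ProjInMod (M : A ⥤ ModuleCat.{0} k) : Prop :=
  ∀ ⦃X Y : A ⥤ ModuleCat.{0} k⦄, IsLfdMod k X → IsLfdMod k Y →
    ∀ (e : X ⟶ Y), Epi e → ∀ u : M ⟶ Y, ∃ t : M ⟶ X, t ≫ e = u

/-- `M` is injective as an object of `mod A`. -/
def InjInMod (M : A ⥤ ModuleCat.{0} k) : Prop :=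
  ∀ ⦃X Y : A ⥤ ModuleCat.{0} k⦄, IsLfdMod k X → IsLfdMod k Y →
    ∀ (m : X ⟶ Y), Mono m → ∀ u : X ⟶ M, ∃ t : Y ⟶ M, m ≫ t = u

/-- `h` is a (nonempty) composition of irreducible morphisms between indecomposable
objects of `mod A`. -/
inductive IrredChain : ∀ {X Y : A ⥤ ModuleCat.{0} k}, (X ⟶ Y) → Prop
  | single {X Y : A ⥤ ModuleCat.{0} k} (f : X ⟶ Y) :
      IsLfdMod k X → Indec k X → IsLfdMod k Y → Indec k Y → Irred k f → IrredChain f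
  | comp {X Y Z : A ⥤ ModuleCat.{0} k} (f : X ⟶ Y) (g : Y ⟶ Z) :
      IsLfdMod k X → Indec k X → Irred k f → IrredChain g → IrredChain (f ≫ g)

end General

section QuiverSection

variable (Q : Type) [Quiver.{0} Q]

/-- `Q` is locally finite: every vertex is the source of finitely many arrows and the
target of finitely many arrows. -/
def LocallyFinite : Prop :=
  ∀ x : Q, Finite (Σ y : Q, x ⟶ y) ∧ Finite (Σ y : Q, y ⟶ x)

/-- `Q` is interval finite: there are finitely many paths between any two vertices. -/
def IntervalFinite : Prop :=
  ∀ x y : Q, Finite (Quiver.Path x y)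

/-- `Q` is strongly locally finite: locally finite and interval finite. -/
def StronglyLocallyFinite : Prop :=
  LocallyFinite Q ∧ IntervalFinite Q

/-- `Q` is connected: nonempty, and any two vertices are joined by a walk. -/
def QuiverConnected : Prop :=
  Nonempty Q ∧ ∀ x y : Q,
    Nonempty (Quiver.Path (Quiver.Symmetrify.of.obj x) (Quiver.Symmetrify.of.obj y))

/-- The path category `kQ` of the quiver `Q`: the free `k`-linear category on the free
category on `Q`. -/
abbrev PathCat := CategoryTheory.Free k (Paths Q)

/-- A vertex of `Q`, seen as an object of the path category `kQ`. -/
noncomputable def vtx (x : Q) : PathCat k Q :=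
  (Free.embedding k (Paths Q)).obj ((Paths.of Q).obj x)

/-- An arrow of `Q`, seen as a morphism of the path category `kQ`. -/
noncomputable def arrHom {x y : Q} (α : x ⟶ y) : vtx k Q x ⟶ vtx k Q y :=
  (Free.embedding k (Paths Q)).map ((Paths.of Q).map α)

/-- The degree of a vertex of `Q`: the total number of arrows incident to it. -/
noncomputable def degree (x : Q) : ℕ :=
  Nat.card ((Σ y : Q, x ⟶ y) ⊕ (Σ y : Q, y ⟶ x))

/-- `M` belongs to `rrep(Q)`: it is the middle term of a short exact sequence
`0 → L → M → N → 0` with `L` finitely presented, `N` finitely co-presented, and only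
finitely many arrows `α` of `Q` satisfy `M(α) ≠ 0`, `L(α) = 0` and `N(α) = 0`. -/
def InRrep (M : PathCat k Q ⥤ ModuleCat.{0} k) : Prop :=
  ∃ (L N : PathCat k Q ⥤ ModuleCat.{0} k) (f : L ⟶ M) (g : M ⟶ N) (zero : f ≫ g = 0),
    Mono f ∧ Epi g ∧ (ShortComplex.mk f g zero).Exact ∧ IsFP k L ∧ IsFCP k N ∧
    Set.Finite {p : Σ (x : Q) (y : Q), x ⟶ y |
      M.map (arrHom k Q p.2.2) ≠ 0 ∧ L.map (arrHom k Q p.2.2) = 0 ∧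
      N.map (arrHom k Q p.2.2) = 0}

variable {Q}

/-- The vertices occurring in a path. -/
def InPath {x : Q} : ∀ {y : Q}, Quiver.Path x y → Q → Prop
  | _, Quiver.Path.nil, v => v = x
  | _, @Quiver.Path.cons _ _ _ _ c p _, v => v = c ∨ InPath p v

variable (Q)

/-- `Q` is a star quiver: it is obtained from a finite full convex subquiver `Γ` by
attaching finitely many rays and co-rays with no common vertices. -/
def IsStarQuiver : Prop :=
  ∃ (Γ S₁ S₂ : Set Q) (v : Q → ℕ → Q),
    Γ.Finite ∧ S₁ ⊆ Γ ∧ S₂ ⊆ Γ ∧ Disjoint S₁ S₂ ∧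
    (∀ x y : Q, x ∈ Γ → y ∈ Γ → ∀ p : Quiver.Path x y, ∀ z : Q, InPath p z → z ∈ Γ) ∧
    (∀ s ∈ S₁ ∪ S₂, ∀ i : ℕ, v s i ∉ Γ) ∧
    (∀ s ∈ S₁ ∪ S₂, ∀ t ∈ S₁ ∪ S₂, ∀ i j : ℕ, v s i = v t j → s = t ∧ i = j) ∧
    (∀ x : Q, x ∉ Γ → ∃ s ∈ S₁ ∪ S₂, ∃ i : ℕ, x = v s i) ∧
    (∀ s ∈ S₁, Nat.card (s ⟶ v s 0) = 1 ∧ ∀ i : ℕ, Nat.card (v s i ⟶ v s (i + 1)) = 1) ∧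
    (∀ s ∈ S₂, Nat.card (v s 0 ⟶ s) = 1 ∧ ∀ i : ℕ, Nat.card (v s (i + 1) ⟶ v s i) = 1) ∧
    (∀ x y : Q, (x ⟶ y) → ¬(x ∈ Γ ∧ y ∈ Γ) →
      (∃ s ∈ S₁, (x = s ∧ y = v s 0) ∨ ∃ i : ℕ, x = v s i ∧ y = v s (i + 1)) ∨
      (∃ s ∈ S₂, (x = v s 0 ∧ y = s) ∨ ∃ i : ℕ, x = v s (i + 1) ∧ y = v s i))

end QuiverSection

section PathCategory

variable {Q : Type} [Quiver.{0} Q]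

/-- A path of `Q`, seen as a morphism of the path category. -/
noncomputable def pathHom {x y : Q} (p : Quiver.Path x y) : vtx k Q x ⟶ vtx k Q y :=
  (Free.embedding k (Paths Q)).map (X := (Paths.of Q).obj x) (Y := (Paths.of Q).obj y) p

theorem exists_eq_vtx (a : PathCat k Q) : ∃ x : Q, a = vtx k Q x := ⟨a, rfl⟩

theorem pathHom_nil (x : Q) : pathHom k (Quiver.Path.nil : Quiver.Path x x) = 𝟙 _ :=
  (Free.embedding k (Paths Q)).map_id _

theorem pathHom_toPath {x y : Q} (α : x ⟶ y) : pathHom k α.toPath = arrHom k Q α := rfl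

theorem pathHom_comp {x y z : Q} (p : Quiver.Path x y) (q : Quiver.Path y z) :
    pathHom k (p.comp q) = pathHom k p ≫ pathHom k q :=
  (Free.embedding k (Paths Q)).map_comp (X := (Paths.of Q).obj x) (Y := (Paths.of Q).obj y)
    (Z := (Paths.of Q).obj z) p q

theorem pathHom_cons {x y z : Q} (p : Quiver.Path x y) (α : y ⟶ z) :
    pathHom k (p.cons α) = pathHom k p ≫ arrHom k Q α :=
  pathHom_comp k p α.toPath

/-- Morphisms between vertices of the path category are combinations of paths. -/
noncomputable def homEquiv (x y : Q) :
    (vtx k Q x ⟶ vtx k Q y) ≃ₗ[k] (Quiver.Path x y →₀ k) where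
  toFun f := f
  invFun f := f
  map_add' _ _ := rfl
  map_smul' _ _ := rfl
  left_inv _ := rfl
  right_inv _ := rfl

theorem homEquiv_pathHom {x y : Q} (p : Quiver.Path x y) :
    homEquiv k x y (pathHom k p) = Finsupp.single p 1 := rfl

theorem homEquiv_symm_single {x y : Q} (p : Quiver.Path x y) (r : k) :
    (homEquiv k x y).symm (Finsupp.single p r) = r • pathHom k p := by
  apply (homEquiv k x y).injective
  simp [homEquiv_pathHom]

theorem hom_induction {x y : Q} {P : (vtx k Q x ⟶ vtx k Q y) → Prop}
    (zero : P 0) (add : ∀ f g, P f → P g → P (f + g))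
    (path : ∀ (r : k) (p : Quiver.Path x y), P (r • pathHom k p)) (f) : P f := by
  obtain ⟨c, rfl⟩ := (homEquiv k x y).symm.surjective f
  induction c using Finsupp.induction_linear with
  | zero => simpa using zero
  | add c d hc hd => rw [map_add]; exact add _ _ hc hd
  | single p r => rw [homEquiv_symm_single]; exact path r p

theorem subsingleton_hom {x y : Q} (h : IsEmpty (Quiver.Path x y)) :
    Subsingleton (vtx k Q x ⟶ vtx k Q y) :=
  (homEquiv k x y).toEquiv.subsingleton

theorem finite_hom {x y : Q} (h : Finite (Quiver.Path x y)) :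
    FiniteDimensional k (vtx k Q x ⟶ vtx k Q y) :=
  Module.Finite.equiv (homEquiv k x y).symm

variable {k}

theorem IsMod.map_zero {A : Type} [Category.{0} A] [Preadditive A] [CategoryTheory.Linear k A]
    {M : A ⥤ ModuleCat.{0} k} (hM : IsMod k M) (a b : A) :
    M.map (0 : a ⟶ b) = 0 := by
  have := hM.2 (0 : k) (0 : a ⟶ b)
  simpa using this

theorem IsMod.map_sum {A : Type} [Category.{0} A] [Preadditive A] [CategoryTheory.Linear k A]
    {M : A ⥤ ModuleCat.{0} k} (hM : IsMod k M) {a b : A} {ι : Type} (s : Finset ι)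
    (f : ι → (a ⟶ b)) : M.map (∑ i ∈ s, f i) = ∑ i ∈ s, M.map (f i) := by
  classical
  induction s using Finset.induction_on with
  | empty => simpa using hM.map_zero a b
  | insert i s hi ih => rw [Finset.sum_insert hi, Finset.sum_insert hi, hM.1, ih]

/-- A property of linear maps compatible with arrows is compatible with all morphisms. -/
theorem IsMod.naturality {M N : PathCat k Q ⥤ ModuleCat.{0} k} (hM : IsMod k M)
    (hN : IsMod k N) (φ : ∀ x : Q, M.obj (vtx k Q x) ⟶ N.obj (vtx k Q x))
    (h : ∀ {x y : Q} (α : x ⟶ y), M.map (arrHom k Q α) ≫ φ y = φ x ≫ N.map (arrHom k Q α))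
    {x y : Q} (f : vtx k Q x ⟶ vtx k Q y) : M.map f ≫ φ y = φ x ≫ N.map f := by
  induction f using hom_induction with
  | zero => rw [hM.map_zero, hN.map_zero, zero_comp, comp_zero]
  | add f g hf hg => rw [hM.1, hN.1, Preadditive.add_comp, Preadditive.comp_add, hf, hg]
  | path r p =>
    rw [hM.2, hN.2, Linear.smul_comp, Linear.comp_smul]
    congr 1
    induction p with
    | nil => rw [pathHom_nil]; simp
    | cons p α ih =>
      rw [pathHom_cons, M.map_comp, N.map_comp, Category.assoc, h, ← Category.assoc, ih,
        Category.assoc]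

/-- A morphism of representations from its components at the vertices. -/
noncomputable def repHom {M N : PathCat k Q ⥤ ModuleCat.{0} k} (hM : IsMod k M)
    (hN : IsMod k N) (φ : ∀ x : Q, M.obj (vtx k Q x) ⟶ N.obj (vtx k Q x))
    (h : ∀ {x y : Q} (α : x ⟶ y), M.map (arrHom k Q α) ≫ φ y = φ x ≫ N.map (arrHom k Q α)) :
    M ⟶ N where
  app a := φ a
  naturality a b f := hM.naturality hN φ h (x := a) (y := b) f

/-- The action of a path on a representation. -/
noncomputable def pathMap (V : Q → ModuleCat.{0} k) (φ : ∀ {x y : Q}, (x ⟶ y) → (V x ⟶ V y))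
    {x : Q} : ∀ {y : Q}, Quiver.Path x y → (V x ⟶ V y)
  | _, Quiver.Path.nil => 𝟙 (V x)
  | _, Quiver.Path.cons p α => pathMap V φ p ≫ φ α

theorem pathMap_comp (V : Q → ModuleCat.{0} k) (φ : ∀ {x y : Q}, (x ⟶ y) → (V x ⟶ V y))
    {x y z : Q} (p : Quiver.Path x y) (q : Quiver.Path y z) :
    pathMap V φ (p.comp q) = pathMap V φ p ≫ pathMap V φ q := by
  induction q with
  | nil => simp [pathMap]
  | cons q α ih => rw [Quiver.Path.comp_cons, pathMap, ih, pathMap, Category.assoc]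

/-- The linear extension of the action of paths. -/
noncomputable def repMap (V : Q → ModuleCat.{0} k) (φ : ∀ {x y : Q}, (x ⟶ y) → (V x ⟶ V y))
    (x y : Q) : (vtx k Q x ⟶ vtx k Q y) →ₗ[k] (V x ⟶ V y) :=
  (Finsupp.linearCombination k fun p : Quiver.Path x y => pathMap V φ p).comp
    (homEquiv k x y).toLinearMap

theorem repMap_pathHom (V : Q → ModuleCat.{0} k) (φ : ∀ {x y : Q}, (x ⟶ y) → (V x ⟶ V y))
    {x y : Q} (p : Quiver.Path x y) : repMap V φ x y (pathHom k p) = pathMap V φ p := by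
  rw [repMap, LinearMap.comp_apply, LinearEquiv.coe_coe, homEquiv_pathHom,
    Finsupp.linearCombination_single, one_smul]

theorem repMap_comp (V : Q → ModuleCat.{0} k) (φ : ∀ {x y : Q}, (x ⟶ y) → (V x ⟶ V y))
    {x y z : Q} (f : vtx k Q x ⟶ vtx k Q y) (g : vtx k Q y ⟶ vtx k Q z) :
    repMap V φ x z (f ≫ g) = repMap V φ x y f ≫ repMap V φ y z g := by
  induction f using hom_induction with
  | zero => simp
  | add f f' hf hf' => simp [hf, hf']
  | path r p =>
    induction g using hom_induction with
    | zero => simp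
    | add g g' hg hg' =>
      rw [Preadditive.comp_add, map_add, map_add, hg, hg', Preadditive.comp_add]
    | path s q =>
      simp only [Linear.smul_comp, Linear.comp_smul, map_smul, ← pathHom_comp, repMap_pathHom,
        pathMap_comp]

/-- The functor on the path category given by a representation of the quiver. -/
noncomputable def repOf (V : Q → ModuleCat.{0} k) (φ : ∀ {x y : Q}, (x ⟶ y) → (V x ⟶ V y)) :
    PathCat k Q ⥤ ModuleCat.{0} k where
  obj a := V a
  map {a b} f := repMap V φ a b f
  map_id a := by
    refine (congrArg _ (pathHom_nil k (Q := Q) a).symm).trans ?_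
    exact repMap_pathHom V φ (Quiver.Path.nil : Quiver.Path (V := Q) a a)
  map_comp {a b c} f g := repMap_comp V φ (x := a) (y := b) (z := c) f g

theorem repOf_map_arrHom (V : Q → ModuleCat.{0} k) (φ : ∀ {x y : Q}, (x ⟶ y) → (V x ⟶ V y))
    {x y : Q} (α : x ⟶ y) : (repOf V φ).map (arrHom k Q α) = φ α :=
  (repMap_pathHom V φ α.toPath).trans (Category.id_comp _)

theorem isMod_repOf (V : Q → ModuleCat.{0} k) (φ : ∀ {x y : Q}, (x ⟶ y) → (V x ⟶ V y)) :
    IsMod k (repOf V φ) :=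
  ⟨fun {a b} f g => (repMap V φ a b).map_add f g, fun {a b} r f => (repMap V φ a b).map_smul r f⟩

end PathCategory

section Pointwise

variable {k} {A : Type} [Category.{0} A]

theorem app_injective_of_mono {M N : A ⥤ ModuleCat.{0} k} (f : M ⟶ N) [Mono f] (a : A) :
    Function.Injective (f.app a).hom :=
  (ModuleCat.mono_iff_injective _).1 inferInstance

theorem app_surjective_of_epi {M N : A ⥤ ModuleCat.{0} k} (f : M ⟶ N) [Epi f] (a : A) :
    Function.Surjective (f.app a).hom :=
  (ModuleCat.epi_iff_surjective _).1 inferInstance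

theorem app_naturality {M N : A ⥤ ModuleCat.{0} k} (f : M ⟶ N) {a b : A} (c : a ⟶ b)
    (m : M.obj a) : (f.app b).hom ((M.map c).hom m) = (N.map c).hom ((f.app a).hom m) := by
  have := f.naturality c
  exact congr($(this).hom m)

theorem map_comp_hom (M : A ⥤ ModuleCat.{0} k) {a b c : A} (f : a ⟶ b) (g : b ⟶ c)
    (m : M.obj a) : (M.map (f ≫ g)).hom m = (M.map g).hom ((M.map f).hom m) := by
  simp

theorem app_exact {L M N : A ⥤ ModuleCat.{0} k} {f : L ⟶ M} {g : M ⟶ N} {w : f ≫ g = 0}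
    (h : (ShortComplex.mk f g w).Exact) (a : A) (m : M.obj a) (hm : (g.app a).hom m = 0) :
    ∃ l, (f.app a).hom l = m := by
  have h' := h.map ((evaluation A (ModuleCat.{0} k)).obj a)
  rw [ShortComplex.moduleCat_exact_iff] at h'
  exact h' m hm

theorem app_comp_zero {L M N : A ⥤ ModuleCat.{0} k} {f : L ⟶ M} {g : M ⟶ N} (w : f ≫ g = 0)
    (a : A) (l : L.obj a) : (g.app a).hom ((f.app a).hom l) = 0 := by
  have := congr(($w).app a)
  exact congr($(this).hom l)

variable [Preadditive A] [CategoryTheory.Linear k A]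

theorem IsMod.of_mono {L M : A ⥤ ModuleCat.{0} k} (f : L ⟶ M) [Mono f] (hM : IsMod k M) :
    IsMod k L := by
  constructor
  · intro a b c d
    rw [← cancel_mono (f.app b), Preadditive.add_comp, f.naturality, f.naturality, f.naturality,
      hM.1, Preadditive.comp_add]
  · intro a b r c
    rw [← cancel_mono (f.app b), Linear.smul_comp, f.naturality, f.naturality, hM.2,
      Linear.comp_smul]

theorem IsMod.of_epi {M N : A ⥤ ModuleCat.{0} k} (f : M ⟶ N) [Epi f] (hM : IsMod k M) :
    IsMod k N := by
  constructor
  · intro a b c d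
    rw [← cancel_epi (f.app a), Preadditive.comp_add, ← f.naturality, ← f.naturality,
      ← f.naturality, hM.1, Preadditive.add_comp]
  · intro a b r c
    rw [← cancel_epi (f.app a), Linear.comp_smul, ← f.naturality, ← f.naturality, hM.2,
      Linear.smul_comp]

theorem IsLfdMod.of_mono {L M : A ⥤ ModuleCat.{0} k} (f : L ⟶ M) [Mono f] (hM : IsLfdMod k M) :
    IsLfdMod k L :=
  ⟨hM.1.of_mono f, fun a => have := hM.2 a
    Module.Finite.of_injective (f.app a).hom (app_injective_of_mono f a)⟩

theorem IsLfdMod.of_epi {M N : A ⥤ ModuleCat.{0} k} (f : M ⟶ N) [Epi f] (hM : IsLfdMod k M) :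
    IsLfdMod k N :=
  ⟨hM.1.of_epi f, fun a => have := hM.2 a
    Module.Finite.of_surjective (f.app a).hom (app_surjective_of_epi f a)⟩

end Pointwise

section Generation

variable {k} {A : Type} [Category.{0} A]

theorem biproduct_element {r : ℕ} (P : Fin r → (A ⥤ ModuleCat.{0} k)) (y : A)
    (p : (⨁ P).obj y) :
    p = ∑ i, ((biproduct.ι P i).app y).hom (((biproduct.π P i).app y).hom p) := by
  have h := biproduct.total (f := P)
  have h' := congr((($h).app y).hom p)
  rw [NatTrans.app_sum, ModuleCat.hom_sum, LinearMap.sum_apply] at h'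
  exact h'.symm

variable [Preadditive A] [CategoryTheory.Linear k A]

/-- Elements of a projective module are morphisms. -/
noncomputable def projEquiv (a y : A) : (a ⟶ y) ≃ₗ[k] (ProjAt k a).obj y where
  toFun c := c
  invFun c := c
  map_add' _ _ := rfl
  map_smul' _ _ := rfl
  left_inv _ := rfl
  right_inv _ := rfl

/-- Elements of an injective module are functionals. -/
noncomputable def injEquiv (a y : A) : Module.Dual k (y ⟶ a) ≃ₗ[k] (InjAt k a).obj y where
  toFun c := c
  invFun c := c
  map_add' _ _ := rfl
  map_smul' _ _ := rfl
  left_inv _ := rfl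
  right_inv _ := rfl

theorem projAt_map {a x y : A} (f : x ⟶ y) (c : a ⟶ x) :
    ((ProjAt k a).map f).hom (projEquiv a x c) = projEquiv a y (c ≫ f) := rfl

theorem injAt_map {a x y : A} (f : x ⟶ y) (l : (InjAt k a).obj x) (d : y ⟶ a) :
    (injEquiv a y).symm (((InjAt k a).map f).hom l) d = (injEquiv a x).symm l (f ≫ d) := rfl

theorem projHom_apply {M : A ⥤ ModuleCat.{0} k} {a : A} (f : ProjAt k a ⟶ M) {y : A}
    (c : a ⟶ y) : (f.app y).hom (projEquiv a y c) =
      (M.map c).hom ((f.app a).hom (projEquiv a a (𝟙 a))) := by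
  rw [← app_naturality, projAt_map, Category.id_comp]

theorem injHom_apply {M : A ⥤ ModuleCat.{0} k} {b : A} (f : M ⟶ InjAt k b) {y : A}
    (m : M.obj y) (d : y ⟶ b) :
    (injEquiv b y).symm ((f.app y).hom m) d =
      (injEquiv b b).symm ((f.app b).hom ((M.map d).hom m)) (𝟙 b) := by
  rw [app_naturality, injAt_map, Category.comp_id]

/-- The morphism from a projective module given by an element. -/
noncomputable def projHom {M : A ⥤ ModuleCat.{0} k} (hM : IsMod k M) {a : A} (m : M.obj a) :
    ProjAt k a ⟶ M where
  app y := ModuleCat.ofHom (X := (a ⟶ y)) (Y := M.obj y)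
    { toFun := fun c => (M.map c).hom m
      map_add' := fun c d => by rw [hM.1]; rfl
      map_smul' := fun r c => by rw [hM.2]; rfl }
  naturality x y f := by
    ext c
    exact map_comp_hom M c f m

/-- The morphism to an injective module given by a functional. -/
noncomputable def injHom {M : A ⥤ ModuleCat.{0} k} (hM : IsMod k M) {b : A}
    (l : M.obj b →ₗ[k] k) : M ⟶ InjAt k b where
  app y := ModuleCat.ofHom (X := M.obj y) (Y := Module.Dual k (y ⟶ b))
    { toFun := fun m =>
        { toFun := fun d => l ((M.map d).hom m)
          map_add' := fun c d => by rw [hM.1]; exact l.map_add _ _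
          map_smul' := fun r c => by rw [hM.2]; exact l.map_smul _ _ }
      map_add' := fun m n => by ext d; simp
      map_smul' := fun r c => by ext d; simp }
  naturality x y f := by
    refine ModuleCat.hom_ext (LinearMap.ext fun m => LinearMap.ext fun d => ?_)
    exact congrArg l (map_comp_hom M f d m).symm

/-- Finite generation, in terms of elements. -/
theorem isFG_iff {M : A ⥤ ModuleCat.{0} k} (hM : IsMod k M) : IsFG k M ↔
    ∃ (r : ℕ) (a : Fin r → A) (g : ∀ i, M.obj (a i)), ∀ (y : A) (m : M.obj y),
      ∃ c : ∀ i, a i ⟶ y, m = ∑ i, (M.map (c i)).hom (g i) := by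
  constructor
  · rintro ⟨r, a, f, hf⟩
    refine ⟨r, a, fun i =>
      ((biproduct.ι (fun i => ProjAt k (a i)) i ≫ f).app (a i)).hom (projEquiv _ _ (𝟙 (a i))), fun y m => ?_⟩
    obtain ⟨p, rfl⟩ := app_surjective_of_epi f y m
    refine ⟨fun i => (projEquiv _ _).symm
      (((biproduct.π (fun i => ProjAt k (a i)) i).app y).hom p), ?_⟩
    conv_lhs => rw [biproduct_element _ y p, map_sum]
    refine Finset.sum_congr rfl fun i _ => ?_
    exact projHom_apply (biproduct.ι (fun i => ProjAt k (a i)) i ≫ f) _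
  · rintro ⟨r, a, g, h⟩
    refine ⟨r, a, biproduct.desc fun i => projHom hM (g i), ?_⟩
    have : ∀ y, Epi ((biproduct.desc fun i => projHom hM (g i)).app y) := by
      intro y
      rw [ModuleCat.epi_iff_surjective]
      intro m
      obtain ⟨c, rfl⟩ := h y m
      refine ⟨∑ i, ((biproduct.ι (fun i => ProjAt k (a i)) i).app y).hom (c i), ?_⟩
      refine (map_sum ((biproduct.desc fun i => projHom hM (g i)).app y).hom _ _).trans ?_
      refine Finset.sum_congr rfl fun i _ => ?_
      have := biproduct.ι_desc (fun i => projHom hM (g i)) i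
      exact congr((($this).app y).hom (c i))
    exact NatTrans.epi_of_epi_app _

/-- Finite co-generation, in terms of elements. -/
theorem isFCG_iff {M : A ⥤ ModuleCat.{0} k} (hM : IsMod k M) : IsFCG k M ↔
    ∃ (s : ℕ) (b : Fin s → A) (l : ∀ j, M.obj (b j) →ₗ[k] k), ∀ (y : A) (m : M.obj y),
      (∀ j (d : y ⟶ b j), l j ((M.map d).hom m) = 0) → m = 0 := by
  constructor
  · rintro ⟨s, b, f, hf⟩
    refine ⟨s, b, fun j =>
      { toFun := fun m => (injEquiv (b j) (b j)).symm (
          ((f ≫ biproduct.π (fun j => InjAt k (b j)) j).app (b j)).hom m) (𝟙 (b j))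
        map_add' := fun m n => by simp
        map_smul' := fun r m => by simp }, fun y m h => ?_⟩
    apply app_injective_of_mono f y
    rw [map_zero, biproduct_element _ y ((f.app y).hom m)]
    refine Finset.sum_eq_zero fun j _ => ?_
    have : ((biproduct.π (fun j => InjAt k (b j)) j).app y).hom ((f.app y).hom m) = 0 := by
      refine LinearMap.ext fun d => ?_
      exact (injHom_apply (f ≫ biproduct.π (fun j => InjAt k (b j)) j) m d).trans (h j d)
    rw [this, map_zero]
  · rintro ⟨s, b, l, h⟩
    refine ⟨s, b, biproduct.lift fun j => injHom hM (l j), ?_⟩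
    have : ∀ y, Mono ((biproduct.lift fun j => injHom hM (l j)).app y) := by
      intro y
      rw [ModuleCat.mono_iff_injective]
      refine (injective_iff_map_eq_zero ((biproduct.lift fun j => injHom hM (l j)).app y).hom).2
        fun m hm => h y m fun j d => ?_
      have h1 := biproduct.lift_π (fun j => injHom hM (l j)) j
      have h2 : ((injHom hM (l j)).app y).hom m = 0 := by
        rw [← h1]
        refine (congrArg ((biproduct.π (fun j => InjAt k (b j)) j).app y).hom hm).trans ?_
        exact map_zero _
      exact congr((injEquiv (b j) y).symm $h2 d)
    exact NatTrans.mono_of_mono_app _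

theorem isMod_projAt (a : A) : IsMod k (ProjAt k a) :=
  ⟨fun f g => ModuleCat.hom_ext (LinearMap.ext fun c => Preadditive.comp_add _ _ _ c f g),
    fun r f => ModuleCat.hom_ext (LinearMap.ext fun c => Linear.comp_smul _ _ _ c r f)⟩

theorem isMod_injAt (a : A) : IsMod k (InjAt k a) := by
  refine ⟨fun {b c} f g => ModuleCat.hom_ext (LinearMap.ext fun l => LinearMap.ext fun d => ?_),
    fun {b c} r f => ModuleCat.hom_ext (LinearMap.ext fun l => LinearMap.ext fun d => ?_)⟩
  · exact (congrArg ((injEquiv a b).symm l) (Preadditive.add_comp _ _ _ f g d)).trans (map_add ((injEquiv a b).symm l) _ _)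
  · exact (congrArg ((injEquiv a b).symm l) (Linear.smul_comp _ _ _ r f d)).trans (map_smul ((injEquiv a b).symm l) _ _)

theorem isMod_biproduct {r : ℕ} {P : Fin r → (A ⥤ ModuleCat.{0} k)}
    (hP : ∀ i, IsMod k (P i)) : IsMod k (⨁ P) := by
  constructor
  · intro a b f g
    refine ModuleCat.hom_ext (LinearMap.ext fun p => ?_)
    rw [biproduct_element P a p]
    simp only [map_sum]
    refine Finset.sum_congr rfl fun i _ => ?_
    rw [← app_naturality, (hP i).1]
    simp only [ModuleCat.hom_add, LinearMap.add_apply, map_add]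
    rw [app_naturality, app_naturality]
  · intro a b r f
    refine ModuleCat.hom_ext (LinearMap.ext fun p => ?_)
    rw [biproduct_element P a p]
    simp only [map_sum]
    refine Finset.sum_congr rfl fun i _ => ?_
    rw [← app_naturality, (hP i).2]
    simp only [ModuleCat.hom_smul, LinearMap.smul_apply, map_smul]
    rw [app_naturality]

end Generation

section Finiteness

variable {k} {Q : Type} [Quiver.{0} Q]

/-- The combinations of paths ending with the arrow `α`, with this last arrow removed. -/
noncomputable def dropLast {x y : Q} (α : x ⟶ y) (b : Q) :
    (vtx k Q b ⟶ vtx k Q y) →ₗ[k] (vtx k Q b ⟶ vtx k Q x) :=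
  (homEquiv k b x).symm.toLinearMap ∘ₗ
    Finsupp.lcomapDomain (fun p : Quiver.Path b x => p.cons α)
      (fun _ _ h => by simpa using h) ∘ₗ (homEquiv k b y).toLinearMap

theorem dropLast_pathHom_cons {x y b : Q} (α : x ⟶ y) (p : Quiver.Path b x) :
    dropLast (k := k) α b (pathHom k (p.cons α)) = pathHom k p := by
  apply (homEquiv k b x).injective
  ext q
  simp only [dropLast, LinearMap.comp_apply, LinearEquiv.coe_coe, homEquiv_pathHom,
    LinearEquiv.apply_symm_apply]
  classical
  simp [Finsupp.lcomapDomain, Finsupp.single_apply]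

theorem dropLast_pathHom_cons_of_ne {x y b w : Q} (α : x ⟶ y) (p : Quiver.Path b w) (β : w ⟶ y)
    (h : (⟨w, β⟩ : Σ w, w ⟶ y) ≠ ⟨x, α⟩) :
    dropLast (k := k) α b (pathHom k (p.cons β)) = 0 := by
  apply (homEquiv k b x).injective
  ext q
  simp only [dropLast, LinearMap.comp_apply, LinearEquiv.coe_coe, homEquiv_pathHom,
    LinearEquiv.apply_symm_apply, map_zero]
  classical
  simp only [Finsupp.lcomapDomain, LinearMap.coe_mk, AddHom.coe_mk, Finsupp.comapDomain_apply,
    Finsupp.single_apply, Finsupp.coe_zero, Pi.zero_apply, ite_eq_right_iff, one_ne_zero, imp_false]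
  intro hpq
  apply h
  injection hpq with h1 h2 h3 h4
  subst h1
  rw [eq_of_heq h4]

theorem dropLast_comp_arrHom {x y b : Q} (α : x ⟶ y) (c : vtx k Q b ⟶ vtx k Q x) :
    dropLast α b (c ≫ arrHom k Q α) = c := by
  induction c using hom_induction with
  | zero => simp
  | add f g hf hg => rw [Preadditive.add_comp, map_add, hf, hg]
  | path r p => rw [Linear.smul_comp, map_smul, ← pathHom_cons, dropLast_pathHom_cons]

theorem dropLast_comp {x y a b : Q} (α : x ⟶ y) (c : vtx k Q a ⟶ vtx k Q b)
    (d : vtx k Q b ⟶ vtx k Q y) (hb : b ≠ y) :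
    dropLast α a (c ≫ d) = c ≫ dropLast α b d := by
  induction c using hom_induction with
  | zero => simp
  | add f g hf hg => rw [Preadditive.add_comp, map_add, hf, hg, Preadditive.add_comp]
  | path r p =>
    rw [Linear.smul_comp, map_smul, Linear.smul_comp]
    congr 1
    induction d using hom_induction with
    | zero => simp
    | add f g hf hg => rw [Preadditive.comp_add, map_add, hf, hg, map_add, Preadditive.comp_add]
    | path s q =>
      rw [Linear.comp_smul, map_smul, map_smul, Linear.comp_smul]
      congr 1
      cases q with
      | nil => exact absurd rfl hb
      | @cons w _ q β =>
        rw [← pathHom_comp, Quiver.Path.comp_cons]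
        by_cases h : (⟨w, β⟩ : Σ w, w ⟶ y) = ⟨x, α⟩
        · cases h
          rw [dropLast_pathHom_cons, dropLast_pathHom_cons, pathHom_comp]
        · rw [dropLast_pathHom_cons_of_ne _ _ _ h, dropLast_pathHom_cons_of_ne _ _ _ h, comp_zero]

theorem toPath_comp_injective {x y : Q} (α : x ⟶ y) (b : Q) :
    Function.Injective (fun p : Quiver.Path y b => α.toPath.comp p) :=
  fun _ _ h => Quiver.Path.comp_injective_right _ h

/-- The combinations of paths starting with the arrow `α`, with this first arrow removed. -/
noncomputable def dropFirst {x y : Q} (α : x ⟶ y) (b : Q) :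
    (vtx k Q x ⟶ vtx k Q b) →ₗ[k] (vtx k Q y ⟶ vtx k Q b) :=
  (homEquiv k y b).symm.toLinearMap ∘ₗ
    Finsupp.lcomapDomain (fun p : Quiver.Path y b => α.toPath.comp p)
      (toPath_comp_injective α b) ∘ₗ (homEquiv k x b).toLinearMap

theorem dropFirst_pathHom_comp {x y b : Q} (α : x ⟶ y) (p : Quiver.Path y b) :
    dropFirst (k := k) α b (pathHom k (α.toPath.comp p)) = pathHom k p := by
  apply (homEquiv k y b).injective
  ext q
  simp only [dropFirst, LinearMap.comp_apply, LinearEquiv.coe_coe, homEquiv_pathHom,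
    LinearEquiv.apply_symm_apply]
  classical
  simp only [Finsupp.lcomapDomain, LinearMap.coe_mk, AddHom.coe_mk, Finsupp.comapDomain_apply,
    Finsupp.single_apply, (toPath_comp_injective α b).eq_iff]

theorem toPath_comp_eq {x y w b : Q} (α : x ⟶ y) (β : x ⟶ w) (p : Quiver.Path y b)
    (q : Quiver.Path w b) (h : α.toPath.comp p = β.toPath.comp q) :
    (⟨y, α⟩ : Σ w, x ⟶ w) = ⟨w, β⟩ := by
  induction p with
  | nil =>
    cases q with
    | nil =>
      simp only [Quiver.Path.comp_nil] at h
      injection h with h1 h2 h3 h4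
      rw [h4]
    | cons q γ =>
      have := congrArg Quiver.Path.length h
      simp at this
  | cons p γ ih =>
    cases q with
    | nil =>
      have := congrArg Quiver.Path.length h
      simp at this
    | cons q δ =>
      simp only [Quiver.Path.comp_cons] at h
      injection h with h1 h2 h3 h4
      subst h1
      exact ih q (eq_of_heq h3)

theorem dropFirst_pathHom_comp_of_ne {x y b w : Q} (α : x ⟶ y) (β : x ⟶ w)
    (p : Quiver.Path w b) (h : (⟨w, β⟩ : Σ w, x ⟶ w) ≠ ⟨y, α⟩) :
    dropFirst (k := k) α b (pathHom k (β.toPath.comp p)) = 0 := by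
  apply (homEquiv k y b).injective
  ext q
  simp only [dropFirst, LinearMap.comp_apply, LinearEquiv.coe_coe, homEquiv_pathHom,
    LinearEquiv.apply_symm_apply, map_zero]
  classical
  simp only [Finsupp.lcomapDomain, LinearMap.coe_mk, AddHom.coe_mk, Finsupp.comapDomain_apply,
    Finsupp.single_apply, Finsupp.coe_zero, Pi.zero_apply, ite_eq_right_iff, one_ne_zero, imp_false]
  intro hpq
  exact h (toPath_comp_eq _ _ _ _ hpq)

theorem dropFirst_arrHom_comp {x y b : Q} (α : x ⟶ y) (c : vtx k Q y ⟶ vtx k Q b) :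
    dropFirst α b (arrHom k Q α ≫ c) = c := by
  induction c using hom_induction with
  | zero => simp
  | add f g hf hg => rw [Preadditive.comp_add, map_add, hf, hg]
  | path r p =>
    rw [Linear.comp_smul, map_smul, ← pathHom_toPath, ← pathHom_comp, dropFirst_pathHom_comp]

theorem dropFirst_comp {x y a b : Q} (α : x ⟶ y) (d : vtx k Q x ⟶ vtx k Q b)
    (c : vtx k Q b ⟶ vtx k Q a) (hb : x ≠ b) :
    dropFirst α a (d ≫ c) = dropFirst α b d ≫ c := by
  induction c using hom_induction with
  | zero => simp
  | add f g hf hg => rw [Preadditive.comp_add, map_add, hf, hg, Preadditive.comp_add]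
  | path r p =>
    rw [Linear.comp_smul, map_smul, Linear.comp_smul]
    congr 1
    induction d using hom_induction with
    | zero => simp
    | add f g hf hg => rw [Preadditive.add_comp, map_add, hf, hg, map_add, Preadditive.add_comp]
    | path s q =>
      rw [Linear.smul_comp, map_smul, map_smul, Linear.smul_comp]
      congr 1
      have hq : q.length ≠ 0 := fun h => hb (q.eq_of_length_zero h)
      obtain ⟨n, hn⟩ := Nat.exists_eq_succ_of_ne_zero hq
      obtain ⟨w, β, q', -, rfl⟩ := q.eq_toPath_comp_of_length_eq_succ hn
      rw [← pathHom_comp, Quiver.Path.comp_assoc]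
      by_cases h : (⟨w, β⟩ : Σ w, x ⟶ w) = ⟨y, α⟩
      · cases h
        rw [dropFirst_pathHom_comp, dropFirst_pathHom_comp, pathHom_comp]
      · rw [dropFirst_pathHom_comp_of_ne _ _ _ h, dropFirst_pathHom_comp_of_ne _ _ _ h, zero_comp]

theorem isFG_iff_vtx {M : PathCat k Q ⥤ ModuleCat.{0} k} (hM : IsMod k M) : IsFG k M ↔
    ∃ (r : ℕ) (a : Fin r → Q) (g : ∀ i, M.obj (vtx k Q (a i))),
      ∀ (y : Q) (m : M.obj (vtx k Q y)),
        ∃ c : ∀ i, vtx k Q (a i) ⟶ vtx k Q y, m = ∑ i, (M.map (c i)).hom (g i) :=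
  isFG_iff hM

theorem isFCG_iff_vtx {M : PathCat k Q ⥤ ModuleCat.{0} k} (hM : IsMod k M) : IsFCG k M ↔
    ∃ (s : ℕ) (b : Fin s → Q) (l : ∀ j, M.obj (vtx k Q (b j)) →ₗ[k] k),
      ∀ (y : Q) (m : M.obj (vtx k Q y)),
        (∀ j (d : vtx k Q y ⟶ vtx k Q (b j)), l j ((M.map d).hom m) = 0) → m = 0 :=
  isFCG_iff hM

/-- A finitely generated representation vanishes where no path arrives from some finite set. -/
theorem IsFG.eq_zero_of_isEmpty {M : PathCat k Q ⥤ ModuleCat.{0} k} (hM : IsMod k M)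
    (h : IsFG k M) : ∃ B : Set Q, B.Finite ∧ ∀ y : Q, (∀ b ∈ B, IsEmpty (Quiver.Path b y)) →
      ∀ m : M.obj (vtx k Q y), m = 0 := by
  obtain ⟨r, a, g, h⟩ := (isFG_iff_vtx hM).1 h
  refine ⟨Set.range a, Set.finite_range _, fun y hy m => ?_⟩
  obtain ⟨c, rfl⟩ := h _ m
  refine Finset.sum_eq_zero fun i _ => ?_
  have := subsingleton_hom k (hy (a i) ⟨i, rfl⟩)
  rw [show c i = 0 from Subsingleton.elim (α := (vtx k Q (a i) ⟶ vtx k Q y)) _ _, hM.map_zero]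
  rfl

theorem IsFCG.eq_zero_of_isEmpty {M : PathCat k Q ⥤ ModuleCat.{0} k} (hM : IsMod k M)
    (h : IsFCG k M) : ∃ B : Set Q, B.Finite ∧ ∀ y : Q, (∀ b ∈ B, IsEmpty (Quiver.Path y b)) →
      ∀ m : M.obj (vtx k Q y), m = 0 := by
  obtain ⟨r, a, l, h⟩ := (isFCG_iff_vtx hM).1 h
  refine ⟨Set.range a, Set.finite_range _, fun y hy m => ?_⟩
  refine h _ m fun i d => ?_
  have := subsingleton_hom k (hy (a i) ⟨i, rfl⟩)
  rw [show d = 0 from Subsingleton.elim (α := (vtx k Q y ⟶ vtx k Q (a i))) _ _, hM.map_zero]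
  exact map_zero _

/-- A finitely generated representation has a finite top. -/
theorem IsFG.exists_arrow_ne_zero {M : PathCat k Q ⥤ ModuleCat.{0} k} (hM : IsMod k M)
    (h : IsFG k M) : ∃ B : Set Q, B.Finite ∧ ∀ y ∉ B, ∀ m : M.obj (vtx k Q y), m ≠ 0 →
      ∃ (x : Q) (α : x ⟶ y), M.map (arrHom k Q α) ≠ 0 := by
  obtain ⟨r, a, g, h⟩ := (isFG_iff_vtx hM).1 h
  refine ⟨Set.range a, Set.finite_range _, fun y hy m hm => ?_⟩
  by_contra! hα
  apply hm
  obtain ⟨c, rfl⟩ := h _ m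
  refine Finset.sum_eq_zero fun i _ => ?_
  suffices ∀ (b : Q) (d : vtx k Q b ⟶ vtx k Q y), b ≠ y → M.map d = 0 by
    rw [this (a i) (c i) fun h => hy ⟨i, h⟩]
    rfl
  intro b d hb
  induction d using hom_induction with
  | zero => exact hM.map_zero _ _
  | add f g hf hg => rw [hM.1, hf, hg, add_zero]
  | path r p =>
    cases p with
    | nil => exact absurd rfl hb
    | cons p β => rw [hM.2, pathHom_cons, M.map_comp, hα, comp_zero, smul_zero]

/-- A finitely co-generated representation has a finite socle. -/
theorem IsFCG.exists_arrow_ne_zero {M : PathCat k Q ⥤ ModuleCat.{0} k} (hM : IsMod k M)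
    (h : IsFCG k M) : ∃ B : Set Q, B.Finite ∧ ∀ y ∉ B, ∀ m : M.obj (vtx k Q y), m ≠ 0 →
      ∃ (z : Q) (α : y ⟶ z), M.map (arrHom k Q α) ≠ 0 := by
  obtain ⟨r, a, l, h⟩ := (isFCG_iff_vtx hM).1 h
  refine ⟨Set.range a, Set.finite_range _, fun y hy m hm => ?_⟩
  by_contra! hα
  apply hm
  refine h _ m fun i d => ?_
  suffices ∀ (b : Q) (d : vtx k Q y ⟶ vtx k Q b), b ≠ y → M.map d = 0 by
    rw [this (a i) d fun h => hy ⟨i, h⟩]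
    exact map_zero _
  intro b d hb
  induction d using hom_induction with
  | zero => exact hM.map_zero _ _
  | add f g hf hg => rw [hM.1, hf, hg, add_zero]
  | path r p =>
    have hq : p.length ≠ 0 := fun h => hb (p.eq_of_length_zero h).symm
    obtain ⟨n, hn⟩ := Nat.exists_eq_succ_of_ne_zero hq
    obtain ⟨w, β, q', -, rfl⟩ := p.eq_toPath_comp_of_length_eq_succ hn
    rw [hM.2, pathHom_comp, M.map_comp, pathHom_toPath, hα, zero_comp, smul_zero]

end Finiteness

section Presentation

variable {k} {A : Type} [Category.{0} A]

theorem biproduct_ext {r : ℕ} {P : Fin r → (A ⥤ ModuleCat.{0} k)} {y : A}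
    {p q : (⨁ P).obj y}
    (h : ∀ i, ((biproduct.π P i).app y).hom p = ((biproduct.π P i).app y).hom q) : p = q := by
  rw [biproduct_element P y p, biproduct_element P y q]
  exact Finset.sum_congr rfl fun i _ => by rw [h i]

theorem biproduct_π_sum {r : ℕ} {P : Fin r → (A ⥤ ModuleCat.{0} k)} {y : A}
    (e : ∀ i, (P i).obj y) (j : Fin r) :
    ((biproduct.π P j).app y).hom (∑ i, ((biproduct.ι P i).app y).hom (e i)) = e j := by
  rw [map_sum, Finset.sum_eq_single j]
  · have := biproduct.ι_π_self P j
    exact congr((($this).app y).hom (e j))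
  · intro i _ hij
    have := biproduct.ι_π_ne P hij
    exact congr((($this).app y).hom (e i))
  · simp

theorem mem_kernel {M N : A ⥤ ModuleCat.{0} k} (f : M ⟶ N) {y : A} (m : M.obj y)
    (hm : (f.app y).hom m = 0) : ∃ q, ((kernel.ι f).app y).hom q = m :=
  app_exact (ShortComplex.exact_kernel f) y m hm

theorem mem_range_of_cokernel {M N : A ⥤ ModuleCat.{0} k} (f : M ⟶ N) {y : A} (n : N.obj y)
    (hn : ((cokernel.π f).app y).hom n = 0) : ∃ m, (f.app y).hom m = n :=
  app_exact (ShortComplex.exact_cokernel f) y n hn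

theorem projEquiv_symm_naturality [Preadditive A] [CategoryTheory.Linear k A]
    {K : A ⥤ ModuleCat.{0} k} {a b y : A} (θ : K ⟶ ProjAt k a)
    (d : b ⟶ y) (q : K.obj b) : (projEquiv a y).symm ((θ.app y).hom ((K.map d).hom q)) =
      (projEquiv a b).symm ((θ.app b).hom q) ≫ d := by
  rw [app_naturality]
  rfl

end Presentation

section QuiverPresentation

variable {k} {Q : Type} [Quiver.{0} Q]

/-- Almost all arrows act injectively on a finitely presented representation. -/
theorem IsFP.injective_map_arrHom {L : PathCat k Q ⥤ ModuleCat.{0} k} (h : IsFP k L) :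
    ∃ B : Set Q, B.Finite ∧ ∀ y ∉ B, ∀ (x : Q) (α : x ⟶ y),
      Function.Injective (L.map (arrHom k Q α)).hom := by
  obtain ⟨r, a, f, hf, hK⟩ : ∃ (r : ℕ) (a : Fin r → Q)
      (f : (⨁ fun i => ProjAt k (vtx k Q (a i))) ⟶ L), Epi f ∧ IsFG k (kernel f) := h
  have hP : IsMod k (⨁ fun i => ProjAt k (vtx k Q (a i))) := isMod_biproduct fun i => isMod_projAt _
  obtain ⟨s, b, κ, hκ⟩ := (isFG_iff_vtx (hP.of_mono (kernel.ι f))).1 hK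
  refine ⟨Set.range b, Set.finite_range b, fun y hy x α => ?_⟩
  refine (injective_iff_map_eq_zero _).2 fun l hl => ?_
  obtain ⟨p, rfl⟩ := app_surjective_of_epi f _ l
  rw [← app_naturality] at hl
  obtain ⟨q, hq⟩ := mem_kernel f _ hl
  obtain ⟨d, rfl⟩ := hκ y q
  suffices hp : ((kernel.ι f).app _).hom
      (∑ j, ((kernel f).map (dropLast α (b j) (d j))).hom (κ j)) = p by
    rw [← hp]
    exact app_comp_zero (kernel.condition f) _ _
  refine biproduct_ext fun i => ?_
  set θ := kernel.ι f ≫ biproduct.π (fun i => ProjAt k (vtx k Q (a i))) i with hθ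
  have h1 := congrArg (fun m => (projEquiv (vtx k Q (a i)) (vtx k Q y)).symm
    (((biproduct.π (fun i => ProjAt k (vtx k Q (a i))) i).app _).hom m)) hq
  have h2 : (projEquiv (vtx k Q (a i)) (vtx k Q y)).symm ((θ.app _).hom
      (∑ j, ((kernel f).map (d j)).hom (κ j))) = (projEquiv (vtx k Q (a i)) (vtx k Q x)).symm
      (((biproduct.π (fun i => ProjAt k (vtx k Q (a i))) i).app _).hom p) ≫ arrHom k Q α := by
    rw [← projEquiv_symm_naturality]
    exact h1
  apply (projEquiv (vtx k Q (a i)) (vtx k Q x)).symm.injective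
  change (projEquiv (vtx k Q (a i)) (vtx k Q x)).symm ((θ.app _).hom
      (∑ j, ((kernel f).map (dropLast α (b j) (d j))).hom (κ j))) = _
  have h3 := congrArg (dropLast α (a i)) h2
  refine Eq.trans ?_ (h3.trans (dropLast_comp_arrHom α _))
  simp only [map_sum]
  refine Finset.sum_congr rfl fun j _ => ?_
  rw [projEquiv_symm_naturality, projEquiv_symm_naturality]
  exact (dropLast_comp α _ _ fun h => hy ⟨j, h⟩).symm

/-- Almost all arrows act surjectively on a finitely co-presented representation. -/
theorem IsFCP.surjective_map_arrHom {N : PathCat k Q ⥤ ModuleCat.{0} k} (h : IsFCP k N) :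
    ∃ B : Set Q, B.Finite ∧ ∀ y ∉ B, ∀ (z : Q) (α : y ⟶ z),
      Function.Surjective (N.map (arrHom k Q α)).hom := by
  obtain ⟨r, b, f, hf, hC⟩ : ∃ (r : ℕ) (b : Fin r → Q)
      (f : N ⟶ ⨁ fun i => InjAt k (vtx k Q (b i))), Mono f ∧ IsFCG k (cokernel f) := h
  have hI : IsMod k (⨁ fun i => InjAt k (vtx k Q (b i))) := isMod_biproduct fun i => isMod_injAt _
  obtain ⟨s, c, l, hl⟩ := (isFCG_iff_vtx (hI.of_epi (cokernel.π f))).1 hC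
  refine ⟨Set.range c, Set.finite_range c, fun y hy z α n => ?_⟩
  let I := fun i => InjAt k (vtx k Q (b i))
  let φ : ∀ i, Module.Dual k (vtx k Q z ⟶ vtx k Q (b i)) := fun i =>
    (injEquiv (vtx k Q (b i)) (vtx k Q z)).symm (((biproduct.π I i).app _).hom ((f.app _).hom n))
  let ψ : (⨁ I).obj (vtx k Q y) := ∑ i, ((biproduct.ι I i).app _).hom
    (injEquiv (vtx k Q (b i)) (vtx k Q y) ((φ i).comp (dropFirst α (b i))))
  have hψ : ∀ (x : Q) (d : vtx k Q y ⟶ vtx k Q x) (d' : vtx k Q z ⟶ vtx k Q x),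
      (∀ i (e : vtx k Q x ⟶ vtx k Q (b i)), dropFirst α (b i) (d ≫ e) = d' ≫ e) →
      ((⨁ I).map d).hom ψ = ((⨁ I).map d').hom ((f.app _).hom n) := by
    intro x d d' hdd
    refine biproduct_ext fun i => ?_
    rw [app_naturality, app_naturality, biproduct_π_sum]
    refine (injEquiv (vtx k Q (b i)) (vtx k Q x)).symm.injective (LinearMap.ext fun e => ?_)
    rw [injAt_map, injAt_map]
    exact congrArg (φ i) (hdd i e)
  obtain ⟨m, hm⟩ : ∃ m, (f.app _).hom m = ψ := by
    apply mem_range_of_cokernel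
    refine hl _ _ fun j d => ?_
    rw [← app_naturality, hψ (c j) d (dropFirst α (c j) d) fun i e => ?_]
    · rw [app_naturality]
      have h0 := app_comp_zero (cokernel.condition f) (vtx k Q z) n
      refine (congrArg (fun t => l j (((cokernel f).map (dropFirst α (c j) d)).hom t)) h0).trans ?_
      simp
    · exact dropFirst_comp (a := b i) α d e fun h => hy ⟨j, h.symm⟩
  refine ⟨m, app_injective_of_mono f _ ?_⟩
  rw [app_naturality, hm]
  refine (hψ z (arrHom k Q α) (𝟙 _) fun i e => ?_).trans ?_
  · rw [Category.id_comp]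
    exact dropFirst_arrHom_comp (b := b i) α e
  · rw [(⨁ I).map_id]
    rfl

end QuiverPresentation

section Indecomposable

variable {k} {A : Type} [Category.{0} A] [Preadditive A] [CategoryTheory.Linear k A]

theorem indec_of_idempotent {M : A ⥤ ModuleCat.{0} k} (h0 : ¬ IsZero M)
    (h : ∀ e : M ⟶ M, e ≫ e = e → e = 0 ∨ e = 𝟙 M) : Indec k M := by
  refine ⟨h0, fun X Y _ _ φ => ?_⟩
  rcases h (φ.hom ≫ biprod.fst ≫ biprod.inl ≫ φ.inv) (by simp) with h | h
  · left
    rw [IsZero.iff_id_eq_zero]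
    calc 𝟙 X = biprod.inl ≫ φ.inv ≫ (φ.hom ≫ biprod.fst ≫ biprod.inl ≫ φ.inv) ≫ φ.hom ≫
          biprod.fst := by simp
      _ = 0 := by rw [h]; simp
  · right
    rw [IsZero.iff_id_eq_zero]
    calc 𝟙 Y = biprod.inr ≫ φ.inv ≫ 𝟙 M ≫ φ.hom ≫ biprod.snd := by simp
      _ = 0 := by rw [← h]; simp

theorem Indec.eq_zero_or_eq_id {M : A ⥤ ModuleCat.{0} k} (h : Indec k M) (hM : IsLfdMod k M)
    (e : M ⟶ M) (he : e ≫ e = e) : e = 0 ∨ e = 𝟙 M := by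
  have h1 : (𝟙 M - e) ≫ e = 0 := by simp [he]
  have h2 : e ≫ (𝟙 M - e) = 0 := by simp [he]
  let φ : M ≅ kernel e ⊞ kernel (𝟙 M - e) :=
    { hom := biprod.lift (kernel.lift e _ h1) (kernel.lift _ e h2)
      inv := biprod.desc (kernel.ι e) (kernel.ι (𝟙 M - e))
      hom_inv_id := by simp
      inv_hom_id := by
        have h3 : kernel.ι (𝟙 M - e) ≫ e = kernel.ι (𝟙 M - e) := by
          have := kernel.condition (𝟙 M - e)
          rw [Preadditive.comp_sub, Category.comp_id, sub_eq_zero] at this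
          exact this.symm
        apply biprod.hom_ext' <;> apply biprod.hom_ext
        · simp [← cancel_mono (kernel.ι e)]
        · simp [← cancel_mono (kernel.ι (𝟙 M - e))]
        · simp [← cancel_mono (kernel.ι e), h3]
        · simp [← cancel_mono (kernel.ι (𝟙 M - e)), h3] }
  rcases h.2 (hM.of_mono (kernel.ι e)) (hM.of_mono (kernel.ι (𝟙 M - e))) φ with h | h
  · right
    have : kernel.lift e _ h1 ≫ kernel.ι e = 𝟙 M - e := kernel.lift_ι _ _ _
    rw [h.eq_of_src (kernel.ι e) 0, comp_zero] at this
    exact (sub_eq_zero.1 this.symm).symm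
  · left
    have : kernel.lift _ e h2 ≫ kernel.ι _ = e := kernel.lift_ι _ _ _
    rw [h.eq_of_src (kernel.ι _) 0, comp_zero] at this
    exact this.symm

end Indecomposable

section Thin

variable {Q : Type} [Quiver.{0} Q]

variable {k} in
theorem rep_hom_ext {M N : PathCat k Q ⥤ ModuleCat.{0} k} {f g : M ⟶ N}
    (h : ∀ (x : Q) (m : M.obj (vtx k Q x)), (f.app _).hom m = (g.app _).hom m) : f = g := by
  ext a m
  exact h a m

open scoped Classical in
/-- The representation which is `k` on the vertices in `V`, the identity on the arrows in `E`,
and zero elsewhere. -/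
noncomputable def thin (V : Set Q) (E : ∀ x y : Q, (x ⟶ y) → Prop) :
    PathCat k Q ⥤ ModuleCat.{0} k :=
  repOf (fun x => ModuleCat.of k (PLift (x ∈ V) → k)) fun {x _} α =>
    ModuleCat.ofHom (LinearMap.pi fun _ =>
      if h : E _ _ α ∧ x ∈ V then LinearMap.proj (PLift.up h.2) else 0)

variable {k}

theorem isLfdMod_thin (V : Set Q) (E : ∀ x y : Q, (x ⟶ y) → Prop) :
    IsLfdMod k (thin k V E) :=
  ⟨isMod_repOf _ _, fun a => inferInstanceAs (FiniteDimensional k (PLift ((show Q from a) ∈ V) → k))⟩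

/-- The coordinate of an element of a thin representation. -/
noncomputable def thinEquiv (V : Set Q) (E : ∀ x y : Q, (x ⟶ y) → Prop) {x : Q} (hx : x ∈ V) :
    (thin k V E).obj (vtx k Q x) ≃ₗ[k] k where
  toFun m := m (PLift.up hx)
  invFun r := fun _ => r
  map_add' _ _ := rfl
  map_smul' _ _ := rfl
  left_inv _ := rfl
  right_inv _ := rfl

variable {V : Set Q} {E : ∀ x y : Q, (x ⟶ y) → Prop}

theorem thin_subsingleton {x : Q} (hx : x ∉ V) :
    Subsingleton ((thin k V E).obj (vtx k Q x)) :=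
  have : IsEmpty (PLift (x ∈ V)) := ⟨fun h => hx h.down⟩
  inferInstanceAs (Subsingleton (PLift (x ∈ V) → k))

theorem thin_map_of_mem {x y : Q} (α : x ⟶ y) (h : E _ _ α) (hx : x ∈ V) (hy : y ∈ V)
    (m : (thin k V E).obj (vtx k Q x)) :
    thinEquiv V E hy (((thin k V E).map (arrHom k Q α)).hom m) = thinEquiv V E hx m := by
  classical
  have h1 : (thin k V E).map (arrHom k Q α) = _ := repOf_map_arrHom _ _ α
  refine (congr($(h1).hom m (PLift.up hy))).trans ?_
  change (if h : E _ _ α ∧ x ∈ V then LinearMap.proj (PLift.up h.2) else 0 :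
    (PLift (x ∈ V) → k) →ₗ[k] k) m = _
  rw [dif_pos ⟨h, hx⟩]
  rfl

theorem thin_map_of_notMem {x y : Q} (α : x ⟶ y) (h : ¬ E _ _ α) :
    (thin k V E).map (arrHom k Q α) = 0 := by
  classical
  have h1 : (thin k V E).map (arrHom k Q α) = _ := repOf_map_arrHom _ _ α
  rw [h1]
  refine ModuleCat.hom_ext (LinearMap.ext fun m => funext fun i => ?_)
  change (if h : E _ _ α ∧ x ∈ V then LinearMap.proj (PLift.up h.2) else 0 :
    (PLift (x ∈ V) → k) →ₗ[k] k) m = _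
  rw [dif_neg fun h' => h h'.1]
  rfl

theorem thin_map_ne_zero {x y : Q} (α : x ⟶ y) (h : E _ _ α) (hx : x ∈ V) (hy : y ∈ V) :
    (thin k V E).map (arrHom k Q α) ≠ 0 := by
  intro h0
  have := thin_map_of_mem (k := k) α h hx hy ((thinEquiv V E hx).symm 1)
  rw [h0, LinearEquiv.apply_symm_apply] at this
  exact zero_ne_one ((map_zero (thinEquiv V E hy)).symm.trans this)

/-- A thin representation with connected support is indecomposable. -/
theorem indec_thin (hV : V.Nonempty)
    (hE : ∀ (x y : Q) (α : x ⟶ y), E _ _ α → x ∈ V ∧ y ∈ V)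
    (hc : ∀ f : Q → k, (∀ (x y : Q) (α : x ⟶ y), E _ _ α → f x = f y) →
      ∀ x ∈ V, ∀ y ∈ V, f x = f y) : Indec k (thin k V E) := by
  classical
  obtain ⟨v, hv⟩ := hV
  have hne : ∀ m : (thin k V E).obj (vtx k Q v), m = (thinEquiv V E hv).symm 1 → m ≠ 0 := by
    rintro _ rfl
    simp
  refine indec_of_idempotent (fun h => ?_) fun e he => ?_
  · have h1 : 𝟙 (thin k V E) = 0 := h.eq_of_src _ _
    have h2 := congr((($h1).app (vtx k Q v)).hom ((thinEquiv V E hv).symm 1))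
    exact hne _ rfl h2
  · let c : Q → k := fun x => if hx : x ∈ V then
      thinEquiv V E hx ((e.app (vtx k Q x)).hom ((thinEquiv V E hx).symm 1)) else 0
    have hce : ∀ x (m : (thin k V E).obj (vtx k Q x)), (e.app _).hom m = c x • m := by
      intro x m
      by_cases hx : x ∈ V
      · obtain ⟨r, rfl⟩ := (thinEquiv V E hx).symm.surjective m
        apply (thinEquiv V E hx).injective
        have : (thinEquiv V E hx).symm r = r • (thinEquiv V E hx).symm (1 : k) := by
          rw [← map_smul, smul_eq_mul, mul_one]
        rw [this]
        simp only [c, dif_pos hx, map_smul, LinearEquiv.apply_symm_apply, smul_eq_mul]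
        ring
      · have := thin_subsingleton (k := k) (E := E) hx
        exact Subsingleton.elim _ _
    have hconst : ∀ x ∈ V, c x = c v := by
      intro x hx
      refine hc c (fun x y α hα => ?_) x hx v hv
      obtain ⟨hx, hy⟩ := hE _ _ α hα
      have h1 := app_naturality e (arrHom k Q α) ((thinEquiv V E hx).symm 1)
      have h2 := congrArg (thinEquiv V E hy) h1
      rw [thin_map_of_mem α hα hx hy, hce, hce, map_smul, map_smul,
        thin_map_of_mem α hα hx hy] at h2
      simpa using h2.symm
    have hce' : ∀ x (m : (thin k V E).obj (vtx k Q x)), (e.app _).hom m = c v • m := by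
      intro x m
      by_cases hx : x ∈ V
      · rw [hce, hconst x hx]
      · have := thin_subsingleton (k := k) (E := E) hx
        exact Subsingleton.elim _ _
    have hidem : c v * c v = c v := by
      have h1 := congr((($he).app (vtx k Q v)).hom ((thinEquiv V E hv).symm 1))
      have h2 : (e.app (vtx k Q v)).hom ((e.app (vtx k Q v)).hom ((thinEquiv V E hv).symm 1)) =
        (e.app (vtx k Q v)).hom ((thinEquiv V E hv).symm 1) := h1
      rw [hce', hce'] at h2
      have h3 := congrArg (thinEquiv V E hv) h2
      simpa using h3
    rcases IsIdempotentElem.iff_eq_zero_or_one.1 hidem with h | h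
    · left
      refine rep_hom_ext fun x m => ?_
      rw [hce', h, zero_smul]
      rfl
    · right
      refine rep_hom_ext fun x m => ?_
      rw [hce', h, one_smul]
      rfl

end Thin

section Rrep

open Filter

variable {k}

section

variable {A : Type} [Category.{0} A] {L M N : A ⥤ ModuleCat.{0} k}

theorem map_ne_zero_of_mono (f : L ⟶ M) [Mono f] {a b : A} {c : a ⟶ b} (h : L.map c ≠ 0) :
    M.map c ≠ 0 := by
  intro h0
  apply h
  rw [← cancel_mono (f.app b), f.naturality, h0, comp_zero, zero_comp]

theorem map_ne_zero_of_epi (g : M ⟶ N) [Epi g] {a b : A} {c : a ⟶ b} (h : N.map c ≠ 0) :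
    M.map c ≠ 0 := by
  intro h0
  apply h
  rw [← cancel_epi (g.app a), ← g.naturality, h0, comp_zero, zero_comp]

theorem map_eq_zero_of_source {a b : A} (c : a ⟶ b) (h : Subsingleton (M.obj a)) :
    M.map c = 0 :=
  ModuleCat.hom_ext (LinearMap.ext fun m => by rw [Subsingleton.elim m 0, map_zero, map_zero])

theorem map_eq_zero_of_target {a b : A} (c : a ⟶ b) (h : Subsingleton (M.obj b)) :
    M.map c = 0 :=
  ModuleCat.hom_ext (LinearMap.ext fun _ => Subsingleton.elim _ _)

end

theorem IsFP.isFG {A : Type} [Category.{0} A] [Preadditive A] [CategoryTheory.Linear k A]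
    {M : A ⥤ ModuleCat.{0} k} (h : IsFP k M) : IsFG k M := by
  obtain ⟨r, a, f, hf, -⟩ := h
  exact ⟨r, a, f, hf⟩

theorem IsFCP.isFCG {A : Type} [Category.{0} A] [Preadditive A] [CategoryTheory.Linear k A]
    {M : A ⥤ ModuleCat.{0} k} (h : IsFCP k M) : IsFCG k M := by
  obtain ⟨r, a, f, hf, -⟩ := h
  exact ⟨r, a, f, hf⟩

variable {Q : Type} [Quiver.{0} Q]

theorem LocallyFinite.finite_sources (hQ : LocallyFinite Q) {B : Set Q} (hB : B.Finite) :
    {y : Q | ∃ b ∈ B, Nonempty (y ⟶ b)}.Finite := by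
  refine (hB.biUnion fun b _ => ?_ : (⋃ b ∈ B, {y : Q | Nonempty (y ⟶ b)}).Finite).subset ?_
  · have := (hQ b).2
    refine (Set.finite_range fun p : Σ y : Q, y ⟶ b => p.1).subset ?_
    rintro y ⟨α⟩
    exact ⟨⟨y, α⟩, rfl⟩
  · rintro y ⟨b, hb, h⟩
    exact Set.mem_biUnion hb h

theorem LocallyFinite.finite_targets (hQ : LocallyFinite Q) {B : Set Q} (hB : B.Finite) :
    {y : Q | ∃ b ∈ B, Nonempty (b ⟶ y)}.Finite := by
  refine (hB.biUnion fun b _ => ?_ : (⋃ b ∈ B, {y : Q | Nonempty (b ⟶ y)}).Finite).subset ?_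
  · have := (hQ b).1
    refine (Set.finite_range fun p : Σ y : Q, b ⟶ y => p.1).subset ?_
    rintro y ⟨α⟩
    exact ⟨⟨y, α⟩, rfl⟩
  · rintro y ⟨b, hb, h⟩
    exact Set.mem_biUnion hb h

theorem eventually_notMem {X : Type} {x : ℕ → X} (hx : Function.Injective x) {B : Set X}
    (hB : B.Finite) :
    ∀ᶠ i in atTop, x i ∉ B := by
  rw [← Nat.cofinite_eq_atTop]
  exact (hB.preimage hx.injOn).eventually_cofinite_notMem

/-- Along a forward ray there are eventually no paths to a finite set of vertices. -/
theorem IntervalFinite.eventually_isEmpty_path_to (hQ : IntervalFinite Q) {x : ℕ → Q}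
    (a : ∀ i, x i ⟶ x (i + 1)) {B : Set Q} (hB : B.Finite) :
    ∀ᶠ i in atTop, ∀ b ∈ B, IsEmpty (Quiver.Path (x i) b) := by
  rw [Filter.eventually_all_finite hB]
  intro b _
  have := hQ (x 0) b
  obtain ⟨n, hn⟩ := (Set.finite_range fun p : Quiver.Path (x 0) b => p.length).bddAbove
  have hp : ∀ i, ∃ p : Quiver.Path (x 0) (x i), p.length = i := by
    intro i
    induction i with
    | zero => exact ⟨Quiver.Path.nil, rfl⟩
    | succ i ih =>
      obtain ⟨p, hp⟩ := ih
      exact ⟨p.cons (a i), by rw [Quiver.Path.length_cons, hp]⟩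
  filter_upwards [eventually_gt_atTop n] with i hi
  refine ⟨fun q => ?_⟩
  obtain ⟨p, hp⟩ := hp i
  have := hn ⟨p.comp q, rfl⟩
  simp only [Quiver.Path.length_comp] at this
  omega

/-- Along a backward ray there are eventually no paths from a finite set of vertices. -/
theorem IntervalFinite.eventually_isEmpty_path_from (hQ : IntervalFinite Q) {x : ℕ → Q}
    (a : ∀ i, x (i + 1) ⟶ x i) {B : Set Q} (hB : B.Finite) :
    ∀ᶠ i in atTop, ∀ b ∈ B, IsEmpty (Quiver.Path b (x i)) := by
  rw [Filter.eventually_all_finite hB]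
  intro b _
  have := hQ b (x 0)
  obtain ⟨n, hn⟩ := (Set.finite_range fun p : Quiver.Path b (x 0) => p.length).bddAbove
  have hp : ∀ i, ∃ p : Quiver.Path (x i) (x 0), p.length = i := by
    intro i
    induction i with
    | zero => exact ⟨Quiver.Path.nil, rfl⟩
    | succ i ih =>
      obtain ⟨p, hp⟩ := ih
      exact ⟨(a i).toPath.comp p, by rw [Quiver.Path.length_comp, hp, Quiver.Path.length_toPath, add_comm]⟩
  filter_upwards [eventually_gt_atTop n] with i hi
  refine ⟨fun q => ?_⟩
  obtain ⟨p, hp⟩ := hp i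
  have := hn ⟨q.comp p, rfl⟩
  simp only [Quiver.Path.length_comp] at this
  omega

theorem eventually_not_of_alternating {P : ℕ → Prop} {o : ℕ → Prop} {n : ℕ}
    (h : ∀ i, n < i → P i → (∃ j, j + 1 = i ∧ o j ∧ P j) ∨ (¬ o i ∧ P (i + 1)))
    (h1 : ∀ m, ∃ i ≥ m, o i) (h2 : ∀ m, ∃ i ≥ m, ¬ o i) : ∀ᶠ i in atTop, ¬ P i := by
  obtain ⟨p, hp, hop⟩ := h2 n
  have key : ∀ i, p < i → P i → ¬ o i := by
    intro i hi hPi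
    induction i with
    | zero => omega
    | succ i ih =>
      rcases h _ (by omega) hPi with ⟨j, hj, hoj, hPj⟩ | h
      · obtain rfl : j = i := by omega
        have : p < j := by
          rcases eq_or_ne p j with rfl | hne
          · exact absurd hoj hop
          · omega
        exact absurd hoj (ih this hPj)
      · exact h.1
  filter_upwards [eventually_gt_atTop p] with i hi hPi
  have : ∀ j, P (i + j) := by
    intro j
    induction j with
    | zero => exact hPi
    | succ j ih =>
      rcases h _ (by omega) ih with ⟨l, hl, hol, hPl⟩ | h
      · rcases eq_or_ne p l with rfl | hne
        · exact absurd hol hop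
        · exact absurd hol (key l (by omega) hPl)
      · exact h.2
  obtain ⟨q, hq, hoq⟩ := h1 i
  obtain ⟨j, rfl⟩ := Nat.exists_eq_add_of_le hq
  exact key _ (by omega) (this j) hoq

/-- A vertex with exactly one incoming and exactly one outgoing arrow. -/
def IsLinear (y : Q) : Prop :=
  Nonempty (Unique (Σ z : Q, z ⟶ y)) ∧ Nonempty (Unique (Σ z : Q, y ⟶ z))

/-- The thin representation supported on a walk whose orientation changes infinitely often. -/
theorem exists_not_inRrep_of_alternating {x : ℕ → Q} (hx : Function.Injective x)
    (A : ℕ → Σ (x : Q) (y : Q), x ⟶ y) (o : ℕ → Prop)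
    (hA : ∀ i, o i → (A i).1 = x i ∧ (A i).2.1 = x (i + 1))
    (hA' : ∀ i, ¬ o i → (A i).1 = x (i + 1) ∧ (A i).2.1 = x i)
    (h1 : ∀ m, ∃ i ≥ m, o i) (h2 : ∀ m, ∃ i ≥ m, ¬ o i) :
    ∃ M : PathCat k Q ⥤ ModuleCat.{0} k, IsLfdMod k M ∧ Indec k M ∧ ¬ InRrep k Q M := by
  let E : ∀ y z : Q, (y ⟶ z) → Prop := fun y z α => ∃ i, A i = ⟨y, z, α⟩
  have hmem : ∀ i, (A i).1 ∈ Set.range x ∧ (A i).2.1 ∈ Set.range x := by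
    intro i
    by_cases h : o i
    · exact ⟨⟨_, (hA i h).1.symm⟩, ⟨_, (hA i h).2.symm⟩⟩
    · exact ⟨⟨_, (hA' i h).1.symm⟩, ⟨_, (hA' i h).2.symm⟩⟩
  have hE : ∀ (y z : Q) (α : y ⟶ z), E y z α → y ∈ Set.range x ∧ z ∈ Set.range x := by
    rintro y z α ⟨i, hi⟩
    have := hmem i
    rwa [hi] at this
  have hAinj : Function.Injective A := by
    intro i j hij
    by_cases hi : o i <;> by_cases hj : o j
    · exact hx ((hA i hi).1.symm.trans ((congrArg _ hij).trans (hA j hj).1))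
    · have e1 := hx ((hA i hi).1.symm.trans ((congrArg (fun p => p.1) hij).trans (hA' j hj).1))
      have e2 := hx ((hA i hi).2.symm.trans ((congrArg (fun p => p.2.1) hij).trans (hA' j hj).2))
      omega
    · have e1 := hx ((hA' i hi).1.symm.trans ((congrArg (fun p => p.1) hij).trans (hA j hj).1))
      have e2 := hx ((hA' i hi).2.symm.trans ((congrArg (fun p => p.2.1) hij).trans (hA j hj).2))
      omega
    · exact hx ((hA' i hi).2.symm.trans ((congrArg (fun p => p.2.1) hij).trans (hA' j hj).2))
  refine ⟨thin k (Set.range x) E, isLfdMod_thin _ _, indec_thin ⟨x 0, 0, rfl⟩ hE ?_, ?_⟩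
  · intro f hf
    have hc : ∀ i, f (x i) = f (x 0) := by
      intro i
      induction i with
      | zero => rfl
      | succ i ih =>
        have := hf _ _ (A i).2.2 ⟨i, rfl⟩
        by_cases h : o i
        · rw [← (hA i h).2, ← this, congrArg f (hA i h).1, ih]
        · rw [← (hA' i h).1, this, congrArg f (hA' i h).2, ih]
    rintro _ ⟨i, rfl⟩ _ ⟨j, rfl⟩
    rw [hc, hc j]
  · rintro ⟨L, N, f, g, w, hf, hg, hex, hL, hN, hfin⟩
    have hM := (isLfdMod_thin (k := k) (Set.range x) E).1
    have hEne : ∀ {y z : Q} {α : y ⟶ z}, (thin k (Set.range x) E).map (arrHom k Q α) ≠ 0 →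
        E y z α := fun {y z α} h => by_contra fun h' => h (thin_map_of_notMem α h')
    obtain ⟨B, hB, hLB⟩ := IsFG.exists_arrow_ne_zero (hM.of_mono f) hL.isFG
    obtain ⟨C, hC, hNC⟩ := IsFCG.exists_arrow_ne_zero (hM.of_epi g) hN.isFCG
    obtain ⟨n, hn⟩ := eventually_atTop.1 (eventually_notMem hx (hB.union hC))
    have hL0 : ∀ᶠ i in atTop, ¬ ¬ Subsingleton (L.obj (vtx k Q (x i))) := by
      refine eventually_not_of_alternating (o := o) (n := n) (fun i hi hP => ?_) h1 h2
      obtain ⟨l, hl⟩ : ∃ l : L.obj (vtx k Q (x i)), l ≠ 0 := by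
        by_contra! h
        exact hP ⟨fun a b => (h a).trans (h b).symm⟩
      obtain ⟨y, α, hα⟩ := hLB (x i) (fun h => hn i hi.le (Or.inl h)) l hl
      have hy : ¬ Subsingleton (L.obj (vtx k Q y)) := fun h => hα (map_eq_zero_of_source _ h)
      obtain ⟨j, hj⟩ := hEne (map_ne_zero_of_mono f hα)
      by_cases h : o j
      · have := hA j h
        rw [hj] at this
        left
        refine ⟨j, hx this.2.symm, h, ?_⟩
        rwa [← this.1]
      · have := hA' j h
        rw [hj] at this
        right
        obtain rfl := hx this.2
        refine ⟨h, ?_⟩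
        rwa [← this.1]
    have hN0 : ∀ᶠ i in atTop, ¬ ¬ Subsingleton (N.obj (vtx k Q (x i))) := by
      refine eventually_not_of_alternating (o := fun i => ¬ o i) (n := n) (fun i hi hP => ?_) h2
        (by simpa using h1)
      obtain ⟨l, hl⟩ : ∃ l : N.obj (vtx k Q (x i)), l ≠ 0 := by
        by_contra! h
        exact hP ⟨fun a b => (h a).trans (h b).symm⟩
      obtain ⟨y, α, hα⟩ := hNC (x i) (fun h => hn i hi.le (Or.inr h)) l hl
      have hy : ¬ Subsingleton (N.obj (vtx k Q y)) := fun h => hα (map_eq_zero_of_target _ h)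
      obtain ⟨j, hj⟩ := hEne (map_ne_zero_of_epi g hα)
      by_cases h : o j
      · have := hA j h
        rw [hj] at this
        right
        obtain rfl := hx this.1
        refine ⟨not_not.2 h, ?_⟩
        rwa [← this.2]
      · have := hA' j h
        rw [hj] at this
        left
        refine ⟨j, hx this.1.symm, h, ?_⟩
        rwa [← this.2]
    obtain ⟨m, hm⟩ := eventually_atTop.1 (hL0.and hN0)
    refine Set.infinite_of_injective_forall_mem (f := fun i => A (m + i))
      (fun i j h => by simpa using hAinj h) (fun i => ?_) hfin
    have hsrc : ∃ j ≥ m, (A (m + i)).1 = x j := by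
      by_cases h : o (m + i)
      · exact ⟨_, by omega, (hA _ h).1⟩
      · exact ⟨_, by omega, (hA' _ h).1⟩
    obtain ⟨j, hj, hAj⟩ := hsrc
    have hm' := hm j hj
    rw [← hAj, not_not, not_not] at hm'
    exact ⟨thin_map_ne_zero _ ⟨m + i, rfl⟩ (hmem _).1 (hmem _).2,
      map_eq_zero_of_source _ hm'.1, map_eq_zero_of_source _ hm'.2⟩

end Rrep

section Rays

open Filter

variable {k} {Q : Type} [Quiver.{0} Q]

/-- The thin representation supported on a forward ray with infinitely many branching vertices,
together with all vertices having an arrow to the ray. -/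
theorem exists_not_inRrep_of_forward (hQ : StronglyLocallyFinite Q) {x : ℕ → Q}
    (hx : Function.Injective x) (a : ∀ i, x i ⟶ x (i + 1))
    (hlin : ∀ n, ∃ i ≥ n, ¬ IsLinear (x i)) :
    ∃ M : PathCat k Q ⥤ ModuleCat.{0} k, IsLfdMod k M ∧ Indec k M ∧ ¬ InRrep k Q M := by
  obtain ⟨hlf, hif⟩ := hQ
  let Z : Set Q := {z | z ∉ Set.range x ∧ ∃ i, Nonempty (z ⟶ x i)}
  have hZ : ∀ z : Z, ∃ i, Nonempty (z.1 ⟶ x i) := fun z => z.2.2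
  choose ι hι using hZ
  let T : ∀ z : Z, z.1 ⟶ x (ι z) := fun z => (hι z).some
  let V : Set Q := Set.range x ∪ Z
  let E : ∀ y z : Q, (y ⟶ z) → Prop := fun y z α =>
    (∃ i, (⟨x i, x (i + 1), a i⟩ : Σ (y z : Q), y ⟶ z) = ⟨y, z, α⟩) ∨
      ∃ w, (⟨w.1, x (ι w), T w⟩ : Σ (y z : Q), y ⟶ z) = ⟨y, z, α⟩
  have hEa : ∀ i, E _ _ (a i) := fun i => Or.inl ⟨i, rfl⟩
  have hET : ∀ z, E _ _ (T z) := fun z => Or.inr ⟨z, rfl⟩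
  have hE : ∀ (y z : Q) (α : y ⟶ z), E y z α → y ∈ V ∧ z ∈ Set.range x := by
    rintro y z α (⟨i, hi⟩ | ⟨w, hw⟩)
    · cases hi
      exact ⟨Or.inl ⟨_, rfl⟩, _, rfl⟩
    · cases hw
      exact ⟨Or.inr w.2, _, rfl⟩
  refine ⟨thin k V E, isLfdMod_thin _ _, indec_thin ⟨x 0, Or.inl ⟨0, rfl⟩⟩
    (fun y z α h => ⟨(hE y z α h).1, Or.inl (hE y z α h).2⟩) ?_, ?_⟩
  · intro f hf
    have hc : ∀ i, f (x i) = f (x 0) := by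
      intro i
      induction i with
      | zero => rfl
      | succ i ih => rw [← hf _ _ _ (hEa i), ih]
    have hV : ∀ y ∈ V, f y = f (x 0) := by
      rintro y (⟨i, rfl⟩ | hy)
      · exact hc i
      · rw [hf _ _ _ (hET ⟨y, hy⟩), hc]
    intro y hy z hz
    rw [hV y hy, hV z hz]
  rintro ⟨L, N, f, g, w, hf, hg, hex, hL, hN, hfin⟩
  have hM := (isLfdMod_thin (k := k) V E).1
  obtain ⟨C, hC, hNC⟩ := IsFCG.eq_zero_of_isEmpty (hM.of_epi g) hN.isFCG
  obtain ⟨n, hn⟩ := eventually_atTop.1 (hif.eventually_isEmpty_path_to a hC)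
  have hN0 : ∀ i ≥ n, Subsingleton (N.obj (vtx k Q (x i))) := fun i hi =>
    ⟨fun p q => (hNC _ (hn i hi) p).trans (hNC _ (hn i hi) q).symm⟩
  obtain ⟨B, hB, hLB⟩ := hL.injective_map_arrHom
  obtain ⟨D, hD, hLD⟩ := IsFG.exists_arrow_ne_zero (hM.of_mono f) hL.isFG
  have hextra : ∀ i ≥ n, ∀ (y : Q) (α : x i ⟶ y), ¬ E _ _ α → y ∈ B := by
    intro i hi y α hα
    by_contra hy
    have hxi : x i ∈ V := Or.inl ⟨i, rfl⟩
    obtain ⟨l, hl⟩ := app_exact hex (vtx k Q (x i)) ((thinEquiv V E hxi).symm 1)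
      (have := hN0 i hi; Subsingleton.elim _ _)
    have h0 : (L.map (arrHom k Q α)).hom l = 0 := by
      have : L.map (arrHom k Q α) = 0 := by
        by_contra h
        exact map_ne_zero_of_mono f h (thin_map_of_notMem α hα)
      rw [this]
      rfl
    have hl0 := (injective_iff_map_eq_zero _).1 (hLB y hy _ α) l h0
    rw [hl0, map_zero] at hl
    have := congrArg (thinEquiv V E hxi) hl
    simp at this
  have hZfin : Z.Finite := by
    have h1 := hlf.finite_sources ((Set.finite_lt_nat n).image x)
    have h2 := hfin.image fun p => p.1
    refine ((h1.union h2).union hD).subset fun z hz => ?_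
    by_cases hi : ι ⟨z, hz⟩ < n
    · exact Or.inl (Or.inl ⟨_, ⟨_, hi, rfl⟩, hι ⟨z, hz⟩⟩)
    by_cases hzD : z ∈ D
    · exact Or.inr hzD
    refine Or.inl (Or.inr ⟨⟨z, _, T ⟨z, hz⟩⟩, ⟨?_, ?_, ?_⟩, rfl⟩)
    · exact thin_map_ne_zero _ (hET ⟨z, hz⟩) (Or.inr hz) (Or.inl ⟨_, rfl⟩)
    · refine map_eq_zero_of_source _ ?_
      by_contra hs
      obtain ⟨l, hl⟩ : ∃ l : L.obj (vtx k Q z), l ≠ 0 := by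
        by_contra! h
        exact hs ⟨fun a b => (h a).trans (h b).symm⟩
      obtain ⟨y, α, hα⟩ := hLD z hzD l hl
      refine hz.1 (hE _ _ α ?_).2
      by_contra hEα
      exact map_ne_zero_of_mono f hα (thin_map_of_notMem α hEα)
    · exact map_eq_zero_of_target _ (hN0 _ (not_lt.1 hi))
  obtain ⟨m, hm⟩ := eventually_atTop.1 (((eventually_notMem hx (hlf.finite_targets hZfin)).and
    (eventually_notMem hx (hlf.finite_targets ((Set.finite_lt_nat n).image x)))).and
    ((eventually_notMem hx hB).and (eventually_notMem hx (hlf.finite_sources hB))))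
  obtain ⟨i, hi, hxi⟩ := hlin (m + n + 1)
  obtain ⟨j, rfl⟩ : ∃ j, i = j + 1 := ⟨i - 1, by omega⟩
  obtain ⟨⟨h1, h2⟩, h3, h4⟩ := hm (j + 1) (by omega)
  refine hxi ⟨⟨⟨⟨⟨x j, a j⟩⟩, ?_⟩⟩, ⟨⟨⟨⟨x (j + 1 + 1), a (j + 1)⟩⟩, ?_⟩⟩⟩
  · rintro ⟨z, α⟩
    by_cases hz : z ∈ Set.range x
    · obtain ⟨l, rfl⟩ := hz
      by_cases hl : l < n
      · exact absurd ⟨_, ⟨l, hl, rfl⟩, ⟨α⟩⟩ h2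
      have hEα : E _ _ α := by
        by_contra h
        exact h3 (hextra l (not_lt.1 hl) _ α h)
      rcases hEα with ⟨l', hl'⟩ | ⟨w, hw⟩
      · have e : l' = j := by
          have := hx (congrArg (fun p => p.2.1) hl')
          omega
        subst e
        have e : l' = l := hx (congrArg (fun p => p.1) hl')
        subst e
        have := eq_of_heq (Sigma.mk.inj hl').2
        exact congrArg (fun β => (⟨x l', β⟩ : Σ z, z ⟶ x (l' + 1)))
          (eq_of_heq (Sigma.mk.inj this).2).symm
      · exact absurd ⟨l, (congrArg (fun p => p.1) hw).symm⟩ w.2.1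
    · exact absurd ⟨z, ⟨hz, _, ⟨α⟩⟩, ⟨α⟩⟩ h1
  · rintro ⟨z, α⟩
    have hEα : E _ _ α := by
      by_contra h
      exact h4 ⟨z, hextra _ (by omega) _ α h, ⟨α⟩⟩
    rcases hEα with ⟨l', hl'⟩ | ⟨w, hw⟩
    · have e : l' = j + 1 := hx (congrArg (fun p => p.1) hl')
      subst e
      have := eq_of_heq (Sigma.mk.inj hl').2
      exact this.symm
    · exact absurd ⟨_, (congrArg (fun p => p.1) hw).symm⟩ w.2.1

/-- The thin representation supported on a backward ray with infinitely many branching vertices,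
together with all vertices having an arrow from the ray. -/
theorem exists_not_inRrep_of_backward (hQ : StronglyLocallyFinite Q) {x : ℕ → Q}
    (hx : Function.Injective x) (a : ∀ i, x (i + 1) ⟶ x i)
    (hlin : ∀ n, ∃ i ≥ n, ¬ IsLinear (x i)) :
    ∃ M : PathCat k Q ⥤ ModuleCat.{0} k, IsLfdMod k M ∧ Indec k M ∧ ¬ InRrep k Q M := by
  obtain ⟨hlf, hif⟩ := hQ
  let Z : Set Q := {z | z ∉ Set.range x ∧ ∃ i, Nonempty (x i ⟶ z)}
  have hZ : ∀ z : Z, ∃ i, Nonempty (x i ⟶ z.1) := fun z => z.2.2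
  choose ι hι using hZ
  let T : ∀ z : Z, x (ι z) ⟶ z.1 := fun z => (hι z).some
  let V : Set Q := Set.range x ∪ Z
  let E : ∀ y z : Q, (y ⟶ z) → Prop := fun y z α =>
    (∃ i, (⟨x (i + 1), x i, a i⟩ : Σ (y z : Q), y ⟶ z) = ⟨y, z, α⟩) ∨
      ∃ w, (⟨x (ι w), w.1, T w⟩ : Σ (y z : Q), y ⟶ z) = ⟨y, z, α⟩
  have hEa : ∀ i, E _ _ (a i) := fun i => Or.inl ⟨i, rfl⟩
  have hET : ∀ z, E _ _ (T z) := fun z => Or.inr ⟨z, rfl⟩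
  have hE : ∀ (y z : Q) (α : y ⟶ z), E y z α → y ∈ Set.range x ∧ z ∈ V := by
    rintro y z α (⟨i, hi⟩ | ⟨w, hw⟩)
    · cases hi
      exact ⟨⟨_, rfl⟩, Or.inl ⟨_, rfl⟩⟩
    · cases hw
      exact ⟨⟨_, rfl⟩, Or.inr w.2⟩
  refine ⟨thin k V E, isLfdMod_thin _ _, indec_thin ⟨x 0, Or.inl ⟨0, rfl⟩⟩
    (fun y z α h => ⟨Or.inl (hE y z α h).1, (hE y z α h).2⟩) ?_, ?_⟩
  · intro f hf
    have hc : ∀ i, f (x i) = f (x 0) := by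
      intro i
      induction i with
      | zero => rfl
      | succ i ih => rw [hf _ _ _ (hEa i), ih]
    have hV : ∀ y ∈ V, f y = f (x 0) := by
      rintro y (⟨i, rfl⟩ | hy)
      · exact hc i
      · rw [← hf _ _ _ (hET ⟨y, hy⟩), hc]
    intro y hy z hz
    rw [hV y hy, hV z hz]
  rintro ⟨L, N, f, g, w, hf, hg, hex, hL, hN, hfin⟩
  have hM := (isLfdMod_thin (k := k) V E).1
  obtain ⟨C, hC, hLC⟩ := IsFG.eq_zero_of_isEmpty (hM.of_mono f) hL.isFG
  obtain ⟨n, hn⟩ := eventually_atTop.1 (hif.eventually_isEmpty_path_from a hC)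
  have hL0 : ∀ i ≥ n, Subsingleton (L.obj (vtx k Q (x i))) := fun i hi =>
    ⟨fun p q => (hLC _ (hn i hi) p).trans (hLC _ (hn i hi) q).symm⟩
  obtain ⟨B, hB, hNB⟩ := hN.surjective_map_arrHom
  obtain ⟨D, hD, hND⟩ := IsFCG.exists_arrow_ne_zero (hM.of_epi g) hN.isFCG
  have hextra : ∀ i ≥ n, ∀ (y : Q) (α : y ⟶ x i), ¬ E _ _ α → y ∈ B := by
    intro i hi y α hα
    by_contra hy
    have hxi : x i ∈ V := Or.inl ⟨i, rfl⟩
    obtain ⟨p, hp⟩ := hNB y hy _ α ((g.app _).hom ((thinEquiv V E hxi).symm 1))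
    have h0 : N.map (arrHom k Q α) = 0 := by
      by_contra h
      exact map_ne_zero_of_epi g h (thin_map_of_notMem α hα)
    have hp0 : (g.app _).hom ((thinEquiv V E hxi).symm (1 : k)) = 0 := by
      rw [← hp, h0]
      rfl
    obtain ⟨l, hl⟩ := app_exact hex (vtx k Q (x i)) _ hp0
    have := hL0 i hi
    rw [Subsingleton.elim l 0, map_zero] at hl
    have := congrArg (thinEquiv V E hxi) hl
    simp at this
  have hZfin : Z.Finite := by
    have h1 := hlf.finite_targets ((Set.finite_lt_nat n).image x)
    have h2 := hfin.image fun p => p.2.1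
    refine ((h1.union h2).union hD).subset fun z hz => ?_
    by_cases hi : ι ⟨z, hz⟩ < n
    · exact Or.inl (Or.inl ⟨_, ⟨_, hi, rfl⟩, hι ⟨z, hz⟩⟩)
    by_cases hzD : z ∈ D
    · exact Or.inr hzD
    refine Or.inl (Or.inr ⟨⟨_, z, T ⟨z, hz⟩⟩, ⟨?_, ?_, ?_⟩, rfl⟩)
    · exact thin_map_ne_zero _ (hET ⟨z, hz⟩) (Or.inl ⟨_, rfl⟩) (Or.inr hz)
    · exact map_eq_zero_of_source _ (hL0 _ (not_lt.1 hi))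
    · refine map_eq_zero_of_target _ ?_
      by_contra hs
      obtain ⟨l, hl⟩ : ∃ l : N.obj (vtx k Q z), l ≠ 0 := by
        by_contra! h
        exact hs ⟨fun a b => (h a).trans (h b).symm⟩
      obtain ⟨y, α, hα⟩ := hND z hzD l hl
      refine hz.1 (hE _ _ α ?_).1
      by_contra hEα
      exact map_ne_zero_of_epi g hα (thin_map_of_notMem α hEα)
  obtain ⟨m, hm⟩ := eventually_atTop.1 (((eventually_notMem hx (hlf.finite_sources hZfin)).and
    (eventually_notMem hx (hlf.finite_sources ((Set.finite_lt_nat n).image x)))).and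
    ((eventually_notMem hx hB).and (eventually_notMem hx (hlf.finite_targets hB))))
  obtain ⟨i, hi, hxi⟩ := hlin (m + n + 1)
  obtain ⟨j, rfl⟩ : ∃ j, i = j + 1 := ⟨i - 1, by omega⟩
  obtain ⟨⟨h1, h2⟩, h3, h4⟩ := hm (j + 1) (by omega)
  refine hxi ⟨⟨⟨⟨⟨x (j + 1 + 1), a (j + 1)⟩⟩, ?_⟩⟩, ⟨⟨⟨⟨x j, a j⟩⟩, ?_⟩⟩⟩
  · rintro ⟨z, α⟩
    have hEα : E _ _ α := by
      by_contra h
      exact h4 ⟨z, hextra _ (by omega) _ α h, ⟨α⟩⟩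
    rcases hEα with ⟨l', hl'⟩ | ⟨w, hw⟩
    · have e : l' = j + 1 := hx (congrArg (fun p => p.2.1) hl')
      subst e
      have e : x (j + 1 + 1) = z := congrArg (fun p => p.1) hl'
      subst e
      have := eq_of_heq (Sigma.mk.inj hl').2
      exact congrArg (fun β => (⟨x (j + 1 + 1), β⟩ : Σ z, z ⟶ x (j + 1)))
        (eq_of_heq (Sigma.mk.inj this).2).symm
    · exact absurd ⟨_, (congrArg (fun p => p.2.1) hw).symm⟩ w.2.1
  · rintro ⟨z, α⟩
    by_cases hz : z ∈ Set.range x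
    · obtain ⟨l, rfl⟩ := hz
      by_cases hl : l < n
      · exact absurd ⟨_, ⟨l, hl, rfl⟩, ⟨α⟩⟩ h2
      have hEα : E _ _ α := by
        by_contra h
        exact h3 (hextra l (not_lt.1 hl) _ α h)
      rcases hEα with ⟨l', hl'⟩ | ⟨w, hw⟩
      · have e : l' = j := by
          have := hx (congrArg (fun p => p.1) hl')
          omega
        subst e
        have := eq_of_heq (Sigma.mk.inj hl').2
        exact this.symm
      · exact absurd ⟨l, (congrArg (fun p => p.2.1) hw).symm⟩ w.2.1
    · exact absurd ⟨z, ⟨hz, _, ⟨α⟩⟩, ⟨α⟩⟩ h1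

end Rays

section Geodesic

variable {Q : Type} [Quiver.{0} Q]

/-- The underlying simple graph of a quiver. -/
def quiverGraph (Q : Type) [Quiver.{0} Q] : SimpleGraph Q :=
  SimpleGraph.fromRel fun x y => Nonempty (x ⟶ y)

theorem quiverGraph_adj {x y : Q} :
    (quiverGraph Q).Adj x y ↔ x ≠ y ∧ (Nonempty (x ⟶ y) ∨ Nonempty (y ⟶ x)) :=
  SimpleGraph.fromRel_adj _ _ _

theorem QuiverConnected.induction (h : QuiverConnected Q) {P : Q → Prop} {x₀ : Q} (h0 : P x₀)
    (h1 : ∀ x y : Q, (x ⟶ y) → (P x ↔ P y)) (x : Q) : P x := by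
  obtain ⟨p⟩ := h.2 x₀ x
  suffices ∀ (y : Quiver.Symmetrify Q) (p : Quiver.Path (Quiver.Symmetrify.of.obj x₀) y),
    P (show Q from y) from this _ p
  intro y p
  induction p with
  | nil => exact h0
  | cons p α ih =>
    rcases α with α | α
    · exact (h1 _ _ α).1 ih
    · exact (h1 _ _ α).2 ih

theorem QuiverConnected.connected (h : QuiverConnected Q) : (quiverGraph Q).Connected := by
  have := h.1
  refine ⟨fun x y => h.induction (P := fun y => (quiverGraph Q).Reachable x y) (.refl x) ?_ y⟩
  intro y z α
  by_cases hyz : y = z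
  · rw [hyz]
  · have hadj : (quiverGraph Q).Adj y z := quiverGraph_adj.2 ⟨hyz, Or.inl ⟨α⟩⟩
    exact ⟨fun h => h.trans hadj.reachable, fun h => h.trans hadj.symm.reachable⟩

theorem SimpleGraph.Connected.exists_adj_dist {V : Type} {G : SimpleGraph V} (hG : G.Connected)
    {x b : V} (h : x ≠ b) : ∃ y, G.Adj x y ∧ G.dist x b = G.dist y b + 1 := by
  obtain ⟨p, hp⟩ := hG.exists_walk_length_eq_dist x b
  cases p with
  | nil => exact absurd rfl h
  | @cons _ y _ hxy p =>
    refine ⟨y, hxy, ?_⟩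
    rw [SimpleGraph.Walk.length_cons] at hp
    have h1 := SimpleGraph.dist_le p
    have h2 := hG.dist_triangle (u := x) (v := y) (w := b)
    rw [SimpleGraph.dist_eq_one_iff_adj.2 hxy] at h2
    omega

/-- The vertices `b` such that `x` lies on a geodesic from `x₀` to `b`. -/
def geodesicCone (x₀ x : Q) : Set Q :=
  {b | (quiverGraph Q).dist x₀ b = (quiverGraph Q).dist x₀ x + (quiverGraph Q).dist x b}

theorem exists_adj_mem_geodesicCone (hc : (quiverGraph Q).Connected) {x₀ x b : Q} (hx : x ≠ b)
    (hb : b ∈ geodesicCone x₀ x) : ∃ y, (quiverGraph Q).Adj x y ∧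
      (quiverGraph Q).dist x₀ y = (quiverGraph Q).dist x₀ x + 1 ∧ b ∈ geodesicCone x₀ y ∧
      (quiverGraph Q).dist x b = (quiverGraph Q).dist y b + 1 := by
  obtain ⟨y, hxy, hy⟩ := SimpleGraph.Connected.exists_adj_dist hc hx
  have h1 := hc.dist_triangle (u := x₀) (v := y) (w := b)
  have h2 := hc.dist_triangle (u := x₀) (v := x) (w := y)
  rw [SimpleGraph.dist_eq_one_iff_adj.2 hxy] at h2
  simp only [geodesicCone, Set.mem_ofPred_eq] at hb ⊢
  refine ⟨y, hxy, ?_, ?_, hy⟩ <;> omega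

/-- A geodesic ray meeting infinitely many vertices which are not linear. -/
theorem exists_geodesic_ray (hlf : LocallyFinite Q) (hconn : QuiverConnected Q)
    (hinf : {x : Q | ¬ IsLinear x}.Infinite) : ∃ x : ℕ → Q, Function.Injective x ∧
      (∀ i, Nonempty (x i ⟶ x (i + 1)) ∨ Nonempty (x (i + 1) ⟶ x i)) ∧
      ∀ n, ∃ i ≥ n, ¬ IsLinear (x i) := by
  have hc := hconn.connected
  obtain ⟨x₀⟩ := hconn.1
  let D : Q → Prop := fun x => (geodesicCone x₀ x ∩ {x : Q | ¬ IsLinear x}).Infinite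
  have hstep : ∀ x : {x // D x}, ∃ y : {x // D x}, (quiverGraph Q).Adj x.1 y.1 ∧
      (quiverGraph Q).dist x₀ y.1 = (quiverGraph Q).dist x₀ x.1 + 1 := by
    rintro ⟨x, hx⟩
    by_contra! hno
    apply hx
    have hnb : {y | (quiverGraph Q).Adj x y ∧
        (quiverGraph Q).dist x₀ y = (quiverGraph Q).dist x₀ x + 1}.Finite := by
      refine ((hlf.finite_sources (Set.finite_singleton x)).union
        (hlf.finite_targets (Set.finite_singleton x))).subset ?_
      rintro y ⟨hy, -⟩
      rcases (quiverGraph_adj.1 hy).2 with h | h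
      · exact Or.inr ⟨x, rfl, h⟩
      · exact Or.inl ⟨x, rfl, h⟩
    refine ((Set.finite_singleton x).union (hnb.biUnion fun y hy => ?_ :
      (⋃ y ∈ _, (geodesicCone x₀ y ∩ {x : Q | ¬ IsLinear x})).Finite)).subset ?_
    · by_contra h
      exact hno ⟨y, h⟩ hy.1 hy.2
    · rintro b ⟨hb, hbl⟩
      by_cases hxb : x = b
      · exact Or.inl hxb.symm
      · obtain ⟨y, h1, h2, h3, -⟩ := exists_adj_mem_geodesicCone hc hxb hb
        exact Or.inr (Set.mem_biUnion (x := y) ⟨h1, h2⟩ ⟨h3, hbl⟩)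
  choose next hnext using hstep
  have hD0 : D x₀ := by
    refine hinf.mono fun b hb => ⟨?_, hb⟩
    simp [geodesicCone]
  let s : ℕ → {x // D x} := fun i => next^[i] ⟨x₀, hD0⟩
  have hs : ∀ i, s (i + 1) = next (s i) := fun i => Function.iterate_succ_apply' _ _ _
  have hadj : ∀ i, (quiverGraph Q).Adj (s i).1 (s (i + 1)).1 := fun i => by
    rw [hs]
    exact (hnext _).1
  have hdist : ∀ i, (quiverGraph Q).dist x₀ (s i).1 = i := by
    intro i
    induction i with
    | zero => exact SimpleGraph.dist_self
    | succ i ih => rw [hs, (hnext _).2, ih]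
  have hinj : Function.Injective fun i => (s i).1 := fun i j h => by
    rw [← hdist i, ← hdist j]
    exact congrArg _ h
  refine ⟨fun i => (s i).1, hinj, fun i => (quiverGraph_adj.1 (hadj i)).2, fun n => ?_⟩
  by_contra! hlin
  have key : ∀ d i : ℕ, ∀ b, n ≤ i → 1 ≤ i → (quiverGraph Q).dist (s i).1 b = d →
      b ∈ geodesicCone x₀ (s i).1 → IsLinear b := by
    intro d
    induction d with
    | zero =>
      intro i b hi _ hd _
      rw [hc.dist_eq_zero_iff] at hd
      exact hd ▸ hlin i hi
    | succ d ih =>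
      intro i b hi hi1 hd hb
      have hne : (s i).1 ≠ b := by
        rintro rfl
        simp at hd
      obtain ⟨y, h1, h2, h3, h4⟩ := exists_adj_mem_geodesicCone hc hne hb
      suffices y = (s (i + 1)).1 by
        subst this
        exact ih (i + 1) b (by omega) (by omega) (by omega) h3
      obtain ⟨j, rfl⟩ : ∃ j, i = j + 1 := ⟨i - 1, by omega⟩
      obtain ⟨⟨⟨p⟩, hp⟩, ⟨⟨q⟩, hq⟩⟩ := hlin (j + 1) hi
      have hpq : ∀ z, (quiverGraph Q).Adj (s (j + 1)).1 z → z = p.1 ∨ z = q.1 := by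
        intro z hz
        rcases (quiverGraph_adj.1 hz).2 with ⟨⟨α⟩⟩ | ⟨⟨α⟩⟩
        · exact Or.inr (congrArg Sigma.fst (hq ⟨z, α⟩))
        · exact Or.inl (congrArg Sigma.fst (hp ⟨z, α⟩))
      have e1 := hpq _ (hadj j).symm
      have e2 := hpq _ (hadj (j + 1))
      have e3 := hpq _ h1
      have n1 : (s j).1 ≠ (s (j + 1 + 1)).1 := fun h => by
        have := hinj h
        omega
      have n2 : (s j).1 ≠ y := fun h => by
        rw [← h, hdist, hdist] at h2
        omega
      grind
  refine (s (n + 1)).2 (Set.Finite.subset Set.finite_empty ?_)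
  rintro b ⟨hb, hbl⟩
  exact hbl (key _ (n + 1) b (by omega) (by omega) rfl hb)

/-- Infinitely many vertices which are not linear give an indecomposable representation outside
`rrep(Q)`. -/
theorem exists_not_inRrep_of_infinite (hQ : StronglyLocallyFinite Q) (hconn : QuiverConnected Q)
    (hinf : {x : Q | ¬ IsLinear x}.Infinite) :
    ∃ M : PathCat k Q ⥤ ModuleCat.{0} k, IsLfdMod k M ∧ Indec k M ∧ ¬ InRrep k Q M := by
  classical
  obtain ⟨x, hx, hadj, hlin⟩ := exists_geodesic_ray hQ.1 hconn hinf
  have hshift : ∀ m n, ∃ i ≥ n, ¬ IsLinear (x (m + i)) := fun m n => by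
    obtain ⟨i, hi, h⟩ := hlin (m + n)
    refine ⟨i - m, by omega, ?_⟩
    rwa [show m + (i - m) = i by omega]
  have hinj : ∀ m, Function.Injective fun i => x (m + i) := fun m i j h => by
    have := hx h
    omega
  by_cases h1 : ∀ m, ∃ i ≥ m, Nonempty (x i ⟶ x (i + 1))
  · by_cases h2 : ∀ m, ∃ i ≥ m, ¬ Nonempty (x i ⟶ x (i + 1))
    · refine exists_not_inRrep_of_alternating hx (fun i => if h : Nonempty (x i ⟶ x (i + 1)) then
        ⟨x i, x (i + 1), h.some⟩ else ⟨x (i + 1), x i, ((hadj i).resolve_left h).some⟩)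
        (fun i => Nonempty (x i ⟶ x (i + 1))) (fun i h => ?_) (fun i h => ?_) h1 h2
      · constructor <;> rw [dif_pos h]
      · constructor <;> rw [dif_neg h]
    · push Not at h2
      obtain ⟨m, hm⟩ := h2
      exact exists_not_inRrep_of_forward hQ (hinj m)
        (fun i => (hm (m + i) (by omega)).some) (hshift m)
  · push Not at h1
    obtain ⟨m, hm⟩ := h1
    exact exists_not_inRrep_of_backward hQ (hinj m)
      (fun i => ((hadj (m + i)).resolve_left (by simpa using hm (m + i) (by omega))).some)
      (hshift m)

end Geodesic

section Rays

variable {X : Type} {R : X → X → Prop} {B : Set X} {σ : X → X}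

/-- The elements from which `B` can be reached along `R`. -/
def Reaches (R : X → X → Prop) (B : Set X) (x : X) : Prop :=
  ∃ b ∈ B, Relation.ReflTransGen R x b

/-- The `R`-successors of elements of `B` from which `B` cannot be reached. -/
def raySources (R : X → X → Prop) (B : Set X) : Set X :=
  {x | (∃ b ∈ B, R b x) ∧ ¬ Reaches R B x}

theorem Reaches.of_mem {x : X} (h : x ∈ B) : Reaches R B x := ⟨x, h, .refl⟩

theorem Reaches.head {x y : X} (h : R x y) : Reaches R B y → Reaches R B x :=
  fun ⟨b, hb, p⟩ => ⟨b, hb, .head h p⟩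

theorem Reaches.tail {x y : X} (hx : x ∉ B) (hs : ∀ z, R x z → z = y) :
    Reaches R B x → Reaches R B y := fun ⟨b, hb, p⟩ => by
  obtain rfl | ⟨z, h, p⟩ := Relation.ReflTransGen.cases_head p
  · exact absurd hb hx
  · exact ⟨b, hb, hs z h ▸ p⟩

theorem not_reaches_iterate (hσ : ∀ x ∉ B, ∀ y, R x y ↔ y = σ x) {s : X}
    (hs : ¬ Reaches R B s) (i : ℕ) : ¬ Reaches R B (σ^[i] s) := by
  induction i with
  | zero => exact hs
  | succ i ih =>
    rw [Function.iterate_succ_apply']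
    exact fun h => ih (h.head ((hσ _ (fun h => ih (.of_mem h)) _).2 rfl))

theorem notMem_iterate (hσ : ∀ x ∉ B, ∀ y, R x y ↔ y = σ x) {s : X}
    (hs : ¬ Reaches R B s) (i : ℕ) : σ^[i] s ∉ B :=
  fun h => not_reaches_iterate hσ hs i (.of_mem h)

theorem iterate_injective (hσ : ∀ x ∉ B, ∀ y, R x y ↔ y = σ x)
    (hp : ∀ x ∉ B, ∀ y z, R y x → R z x → y = z) {s t : X}
    (hs : s ∈ raySources R B) (ht : t ∈ raySources R B) (i j : ℕ)
    (h : σ^[i] s = σ^[j] t) : s = t ∧ i = j := by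
  have key : ∀ {s t : X}, s ∈ raySources R B → t ∈ raySources R B → ∀ j,
      s ≠ σ^[j + 1] t := fun {s t} hs ht j h => by
    obtain ⟨⟨b, hb, hbs⟩, hs⟩ := hs
    have h1 := (hσ _ (notMem_iterate hσ ht.2 j) _).2 rfl
    rw [← Function.iterate_succ_apply' σ, ← h] at h1
    have := hp s (fun h => hs (.of_mem h)) _ _ hbs h1
    exact notMem_iterate hσ ht.2 j (this ▸ hb)
  induction i generalizing j with
  | zero =>
    cases j with
    | zero => exact ⟨h, rfl⟩
    | succ j => exact absurd h (key hs ht j)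
  | succ i ih =>
    cases j with
    | zero => exact absurd h.symm (key ht hs i)
    | succ j =>
      obtain ⟨h1, h2⟩ := ih j (hp _ (notMem_iterate hσ hs.2 (i + 1)) _ _
        (by rw [Function.iterate_succ_apply']
            exact (hσ _ (notMem_iterate hσ hs.2 i) _).2 rfl)
        (by rw [h, Function.iterate_succ_apply']
            exact (hσ _ (notMem_iterate hσ ht.2 j) _).2 rfl))
      exact ⟨h1, by rw [h2]⟩

theorem exists_iterate_eq (hσ : ∀ x ∉ B, ∀ y, R x y ↔ y = σ x) {b x : X} (hb : b ∈ B)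
    (p : Relation.ReflTransGen R b x) (hx : ¬ Reaches R B x) :
    ∃ s ∈ raySources R B, ∃ i, x = σ^[i] s := by
  induction p with
  | refl => exact absurd (.of_mem hb) hx
  | @tail y z p h ih =>
    by_cases hy : Reaches R B y
    · by_cases hyB : y ∈ B
      · exact ⟨z, ⟨⟨y, hyB, h⟩, hx⟩, 0, rfl⟩
      · have e := (hσ y hyB z).1 h
        exact absurd (hy.tail hyB fun w hw => ((hσ y hyB w).1 hw).trans e.symm) hx
    · obtain ⟨s, hs, i, rfl⟩ := ih hy
      exact ⟨s, hs, i + 1, by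
        rw [Function.iterate_succ_apply', (hσ _ (notMem_iterate hσ hs.2 i) z).1 h]⟩

theorem eq_iterate_succ (hσ : ∀ x ∉ B, ∀ y, R x y ↔ y = σ x) {s x : X}
    (hs : s ∈ raySources R B) {i : ℕ} (h : R (σ^[i] s) x) : x = σ^[i + 1] s := by
  rw [Function.iterate_succ_apply', (hσ _ (notMem_iterate hσ hs.2 i) x).1 h]

theorem eq_iterate_of_succ (hσ : ∀ x ∉ B, ∀ y, R x y ↔ y = σ x)
    (hp : ∀ x ∉ B, ∀ y z, R y x → R z x → y = z) {s x : X}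
    (hs : s ∈ raySources R B) {i : ℕ} (h : R x (σ^[i + 1] s)) : x = σ^[i] s := by
  refine hp _ (notMem_iterate hσ hs.2 (i + 1)) _ _ h ?_
  rw [Function.iterate_succ_apply']
  exact (hσ _ (notMem_iterate hσ hs.2 i) _).2 rfl

/-- Away from its source, a ray does not lead back to the neighbourhood of `B`. -/
theorem not_reflTransGen_iterate_succ (hσ : ∀ x ∉ B, ∀ y, R x y ↔ y = σ x)
    (hp : ∀ x ∉ B, ∀ y z, R y x → R z x → y = z) {s c : X}
    (hs : s ∈ raySources R B) (i : ℕ) (hc : c ∈ B ∨ ∃ b ∈ B, R b c ∨ R c b) :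
    ¬ Relation.ReflTransGen R (σ^[i + 1] s) c := fun p => by
  have hcr : ¬ Reaches R B c := fun ⟨b, hb, q⟩ =>
    not_reaches_iterate hσ hs.2 (i + 1) ⟨b, hb, p.trans q⟩
  rcases hc with hc | ⟨b, hb, h | h⟩
  · exact hcr (.of_mem hc)
  · have p' : Relation.TransGen R (σ^[i] s) c := by
      refine Relation.TransGen.head' ?_ p
      rw [Function.iterate_succ_apply']
      exact (hσ _ (notMem_iterate hσ hs.2 i) _).2 rfl
    obtain ⟨d, q, hd⟩ := Relation.TransGen.tail'_iff.1 p'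
    have := hp c (fun h => hcr (.of_mem h)) _ _ hd h
    exact not_reaches_iterate hσ hs.2 i ⟨b, hb, this ▸ q⟩
  · exact hcr ⟨b, hb, .single h⟩

end Rays

section Star

variable {Q : Type} [Quiver.{0} Q]

theorem reflTransGen_iff_path {x y : Q} :
    Relation.ReflTransGen (fun x y : Q => Nonempty (x ⟶ y)) x y ↔
      Nonempty (Quiver.Path x y) := by
  constructor
  · intro h
    induction h with
    | refl => exact ⟨.nil⟩
    | tail _ h ih => exact ⟨ih.some.cons h.some⟩
  · rintro ⟨p⟩
    induction p with
    | nil => exact .refl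
    | cons p α ih => exact ih.tail ⟨α⟩

theorem inPath_target {x y : Q} (p : Quiver.Path x y) : InPath p y := by
  cases p with
  | nil => exact rfl
  | cons p α => exact .inl rfl

theorem inPath_comp {x y : Q} (p : Quiver.Path x y) {z : Q} (q : Quiver.Path y z) :
    InPath (p.comp q) y := by
  induction q with
  | nil => exact inPath_target p
  | cons q α ih => exact .inr ih

theorem finite_inPath {x y : Q} (p : Quiver.Path x y) : {z | InPath p z}.Finite := by
  induction p with
  | nil => exact Set.finite_singleton x
  | @cons c d p α ih => exact ih.insert d

theorem InPath.nonempty_path {x y z : Q} {p : Quiver.Path x y} (h : InPath p z) :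
    Nonempty (Quiver.Path x z) ∧ Nonempty (Quiver.Path z y) := by
  induction p with
  | nil => obtain rfl := h; exact ⟨⟨.nil⟩, ⟨.nil⟩⟩
  | @cons c d p α ih =>
    rcases h with rfl | h
    · exact ⟨⟨p.cons α⟩, ⟨.nil⟩⟩
    · exact ⟨(ih h).1, ⟨(ih h).2.some.cons α⟩⟩

theorem IntervalFinite.finite_between (hQ : IntervalFinite Q) (x y : Q) :
    {z : Q | Nonempty (Quiver.Path x z) ∧ Nonempty (Quiver.Path z y)}.Finite := by
  have := hQ x y
  refine (Set.finite_iUnion fun p : Quiver.Path x y => finite_inPath p).subset ?_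
  rintro z ⟨⟨p⟩, ⟨q⟩⟩
  exact Set.mem_iUnion.2 ⟨p.comp q, inPath_comp p q⟩

theorem card_hom_eq_one {x y : Q} (h : Nonempty (Unique (Σ z, x ⟶ z)))
    (h' : Nonempty (x ⟶ y)) : Nat.card (x ⟶ y) = 1 := by
  obtain ⟨u⟩ := h
  rw [Nat.card_eq_one_iff_unique]
  refine ⟨⟨fun a b => ?_⟩, h'⟩
  have : (⟨y, a⟩ : Σ z, x ⟶ z) = ⟨y, b⟩ := Subsingleton.elim _ _
  simpa using this

theorem card_hom_eq_one' {x y : Q} (h : Nonempty (Unique (Σ z, z ⟶ y)))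
    (h' : Nonempty (x ⟶ y)) : Nat.card (x ⟶ y) = 1 := by
  obtain ⟨u⟩ := h
  rw [Nat.card_eq_one_iff_unique]
  refine ⟨⟨fun a b => ?_⟩, h'⟩
  have : (⟨x, a⟩ : Σ z, z ⟶ y) = ⟨x, b⟩ := Subsingleton.elim _ _
  simpa using this

theorem isStarQuiver_of_finite (hQ : StronglyLocallyFinite Q) (hconn : QuiverConnected Q)
    (hfin : {x : Q | ¬ IsLinear x}.Finite) : IsStarQuiver Q := by
  classical
  obtain ⟨⟨x₀⟩, -⟩ := id hconn
  obtain ⟨B, hB, hx₀, hlin⟩ : ∃ B : Set Q, B.Finite ∧ x₀ ∈ B ∧ ∀ x ∉ B, IsLinear x :=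
    ⟨_, hfin.insert x₀, .inl rfl, fun x hx => by_contra fun h => hx (.inr h)⟩
  let R : Q → Q → Prop := fun x y => Nonempty (x ⟶ y)
  let R' : Q → Q → Prop := fun x y => R y x
  have hR' : ∀ {x y}, Relation.ReflTransGen R' x y ↔ Relation.ReflTransGen R y x :=
    Relation.reflTransGen_swap
  let σ : Q → Q := fun x => if h : IsLinear x then h.2.some.default.1 else x
  let τ : Q → Q := fun x => if h : IsLinear x then h.1.some.default.1 else x
  have hσ : ∀ x ∉ B, ∀ y, R x y ↔ y = σ x := fun x hx y => by
    have h := hlin x hx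
    have e : σ x = h.2.some.default.1 := dif_pos h
    rw [e]
    refine ⟨fun ⟨α⟩ => congrArg (fun p => p.1) (h.2.some.uniq ⟨y, α⟩), ?_⟩
    rintro rfl
    exact ⟨h.2.some.default.2⟩
  have hτ : ∀ x ∉ B, ∀ y, R' x y ↔ y = τ x := fun x hx y => by
    have h := hlin x hx
    have e : τ x = h.1.some.default.1 := dif_pos h
    rw [e]
    refine ⟨fun ⟨α⟩ => congrArg (fun p => p.1) (h.1.some.uniq ⟨y, α⟩), ?_⟩
    rintro rfl
    exact ⟨h.1.some.default.2⟩
  have hp : ∀ x ∉ B, ∀ y z, R y x → R z x → y = z := fun x hx y z h h' =>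
    ((hτ x hx y).1 h).trans ((hτ x hx z).1 h').symm
  have hp' : ∀ x ∉ B, ∀ y z, R' y x → R' z x → y = z := fun x hx y z h h' =>
    ((hσ x hx y).1 h).trans ((hσ x hx z).1 h').symm
  have hcover : ∀ x, Reaches R B x ∨ Reaches R' B x := by
    refine fun x => hconn.induction (P := fun x => Reaches R B x ∨ Reaches R' B x)
      (x₀ := x₀) (.inl (.of_mem hx₀)) (fun x y α => ⟨?_, ?_⟩) x
    · rintro (h | h)
      · by_cases hx : x ∈ B
        · exact .inr (Reaches.head (R := R') ⟨α⟩ (.of_mem hx))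
        · exact .inl (h.tail hx fun z hz => ((hσ x hx z).1 hz).trans ((hσ x hx y).1 ⟨α⟩).symm)
      · exact .inr (h.head ⟨α⟩)
    · rintro (h | h)
      · exact .inl (h.head ⟨α⟩)
      · by_cases hy : y ∈ B
        · exact .inl (Reaches.head (R := R) ⟨α⟩ (.of_mem hy))
        · exact .inr (h.tail hy fun z hz => ((hτ y hy z).1 hz).trans ((hτ y hy x).1 ⟨α⟩).symm)
  let C : Set Q := {c | c ∈ B ∨ ∃ b ∈ B, R b c ∨ R c b}
  have hBC : B ⊆ C := fun b hb => .inl hb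
  have hC : C.Finite := by
    refine (hB.union ((hQ.1.finite_targets hB).union (hQ.1.finite_sources hB))).subset ?_
    rintro c (h | ⟨b, hb, h | h⟩)
    · exact .inl h
    · exact .inr (.inl ⟨b, hb, h⟩)
    · exact .inr (.inr ⟨b, hb, h⟩)
  let Γ : Set Q := {x | ∃ c ∈ C, ∃ c' ∈ C, Relation.ReflTransGen R c x ∧
    Relation.ReflTransGen R x c'}
  have hCΓ : C ⊆ Γ := fun c hc => ⟨c, hc, c, hc, .refl, .refl⟩
  have hΓ : Γ.Finite := by
    refine (hC.biUnion fun c _ => hC.biUnion fun c' _ => hQ.2.finite_between c c').subset ?_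
    rintro x ⟨c, hc, c', hc', p, q⟩
    exact Set.mem_biUnion hc (Set.mem_biUnion hc'
      ⟨reflTransGen_iff_path.1 p, reflTransGen_iff_path.1 q⟩)
  let S₁ := raySources R B
  let S₂ := raySources R' B
  have hdown : ∀ s ∈ S₂, Reaches R B s := fun s hs =>
    (hcover s).resolve_right hs.2
  have hdisj : ∀ s ∈ S₂, s ∉ S₁ := fun s hs hs' => hs'.2 (hdown s hs)
  let v : Q → ℕ → Q := fun s i => if s ∈ S₁ then σ^[i + 1] s else τ^[i + 1] s
  have hv₁ : ∀ s ∈ S₁, ∀ i, v s i = σ^[i + 1] s := fun s hs i => if_pos hs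
  have hv₂ : ∀ s ∈ S₂, ∀ i, v s i = τ^[i + 1] s := fun s hs i => if_neg (hdisj s hs)
  have hcross : ∀ s ∈ S₁, ∀ t ∈ S₂, ∀ i j, σ^[i] s ≠ τ^[j] t := fun s hs t ht i j h => by
    rcases hcover (σ^[i] s) with h' | h'
    · exact not_reaches_iterate hσ hs.2 i h'
    · exact not_reaches_iterate hτ ht.2 j (h ▸ h')
  have hout : ∀ x, x ∉ Γ → (∃ s ∈ S₁, ∃ i, x = σ^[i + 1] s) ∨
      (∃ s ∈ S₂, ∃ i, x = τ^[i + 1] s) := fun x hx => by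
    by_cases h : Reaches R B x
    · have h' : ¬ Reaches R' B x := fun ⟨b, hb, p⟩ => by
        obtain ⟨b', hb', p'⟩ := h
        exact hx ⟨b, hBC hb, b', hBC hb', hR'.1 p, p'⟩
      obtain ⟨b, hb, p⟩ := h
      obtain ⟨s, hs, i, rfl⟩ := exists_iterate_eq hτ hb (hR'.2 p) h'
      cases i with
      | zero =>
        obtain ⟨⟨b, hb, h⟩, -⟩ := hs
        exact absurd (hCΓ (.inr ⟨b, hb, .inr h⟩)) hx
      | succ i => exact .inr ⟨s, hs, i, rfl⟩
    · obtain ⟨b, hb, p⟩ := (hcover x).resolve_left h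
      obtain ⟨s, hs, i, rfl⟩ := exists_iterate_eq hσ hb (hR'.1 p) h
      cases i with
      | zero =>
        obtain ⟨⟨b, hb, h⟩, -⟩ := hs
        exact absurd (hCΓ (.inr ⟨b, hb, .inl h⟩)) hx
      | succ i => exact .inl ⟨s, hs, i, rfl⟩
  refine ⟨Γ, S₁, S₂, v, hΓ, ?_, ?_, Set.disjoint_right.2 hdisj, ?_, ?_, ?_, ?_, ?_, ?_, ?_⟩
  · rintro s ⟨⟨b, hb, h⟩, -⟩
    exact hCΓ (.inr ⟨b, hb, .inl h⟩)
  · rintro s ⟨⟨b, hb, h⟩, -⟩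
    exact hCΓ (.inr ⟨b, hb, .inr h⟩)
  · rintro x y ⟨c, hc, -, -, p, -⟩ ⟨-, -, c', hc', -, q⟩ r z hz
    obtain ⟨r₁, r₂⟩ := hz.nonempty_path
    exact ⟨c, hc, c', hc', p.trans (reflTransGen_iff_path.2 r₁),
      (reflTransGen_iff_path.2 r₂).trans q⟩
  · rintro s (hs | hs) i ⟨c, hc, c', hc', p, q⟩
    · rw [hv₁ s hs] at q
      exact not_reflTransGen_iterate_succ hσ hp hs i hc' q
    · rw [hv₂ s hs] at p
      exact not_reflTransGen_iterate_succ hτ hp' hs i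
        (hc.imp_right fun ⟨b, hb, h⟩ => ⟨b, hb, h.symm⟩) (hR'.2 p)
  · rintro s (hs | hs) t (ht | ht) i j h
    · rw [hv₁ s hs, hv₁ t ht] at h
      simpa using iterate_injective hσ hp hs ht _ _ h
    · rw [hv₁ s hs, hv₂ t ht] at h
      exact absurd h (hcross s hs t ht _ _)
    · rw [hv₂ s hs, hv₁ t ht] at h
      exact absurd h.symm (hcross t ht s hs _ _)
    · rw [hv₂ s hs, hv₂ t ht] at h
      simpa using iterate_injective hτ hp' hs ht _ _ h
  · intro x hx
    rcases hout x hx with ⟨s, hs, i, h⟩ | ⟨s, hs, i, h⟩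
    · exact ⟨s, .inl hs, i, h.trans (hv₁ s hs i).symm⟩
    · exact ⟨s, .inr hs, i, h.trans (hv₂ s hs i).symm⟩
  · intro s hs
    have key : ∀ i, Nat.card (σ^[i] s ⟶ σ^[i + 1] s) = 1 := fun i => by
      have h := notMem_iterate hσ hs.2 i
      refine card_hom_eq_one (hlin _ h).2 ?_
      rw [Function.iterate_succ_apply']
      exact (hσ _ h _).2 rfl
    exact ⟨by rw [hv₁ s hs]; exact key 0, fun i => by
      rw [hv₁ s hs, hv₁ s hs]; exact key (i + 1)⟩
  · intro s hs
    have key : ∀ i, Nat.card (τ^[i + 1] s ⟶ τ^[i] s) = 1 := fun i => by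
      have h := notMem_iterate hτ hs.2 i
      refine card_hom_eq_one' (hlin _ h).1 ?_
      rw [Function.iterate_succ_apply']
      exact (hτ _ h _).2 rfl
    exact ⟨by rw [hv₂ s hs]; exact key 0, fun i => by
      rw [hv₂ s hs, hv₂ s hs]; exact key (i + 1)⟩
  · intro x y α hxy
    have hα : R x y := ⟨α⟩
    have hα' : R' y x := ⟨α⟩
    have fin₁ : ∀ s ∈ S₁, ∀ i, x = σ^[i] s → y = σ^[i + 1] s →
        ∃ s ∈ S₁, (x = s ∧ y = v s 0) ∨ ∃ i : ℕ, x = v s i ∧ y = v s (i + 1) :=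
      fun s hs i hx hy => by
        refine ⟨s, hs, ?_⟩
        cases i with
        | zero => exact .inl ⟨hx, by rw [hv₁ s hs]; exact hy⟩
        | succ i => exact .inr ⟨i, by rw [hv₁ s hs]; exact hx, by rw [hv₁ s hs]; exact hy⟩
    have fin₂ : ∀ s ∈ S₂, ∀ i, y = τ^[i] s → x = τ^[i + 1] s →
        ∃ s ∈ S₂, (x = v s 0 ∧ y = s) ∨ ∃ i : ℕ, x = v s (i + 1) ∧ y = v s i :=
      fun s hs i hy hx => by
        refine ⟨s, hs, ?_⟩
        cases i with
        | zero => exact .inl ⟨by rw [hv₂ s hs]; exact hx, hy⟩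
        | succ i => exact .inr ⟨i, by rw [hv₂ s hs]; exact hx, by rw [hv₂ s hs]; exact hy⟩
    by_cases hx : x ∈ Γ
    · rcases hout y (fun hy => hxy ⟨hx, hy⟩) with ⟨s, hs, i, h⟩ | ⟨s, hs, i, h⟩
      · exact .inl (fin₁ s hs i (eq_iterate_of_succ hσ hp hs (h ▸ hα)) h)
      · exact .inr (fin₂ s hs (i + 1) h (eq_iterate_succ hτ hs (h ▸ hα')))
    · rcases hout x hx with ⟨s, hs, i, h⟩ | ⟨s, hs, i, h⟩
      · exact .inl (fin₁ s hs (i + 1) h (eq_iterate_succ hσ hs (h ▸ hα)))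
      · exact .inr (fin₂ s hs i (eq_iterate_of_succ hτ hp' hs (h ▸ hα')) h)

end Star

section Sequences

variable {k} {V : ℕ → Type} [∀ j, AddCommGroup (V j)] [∀ j, Module k (V j)]

/-- The composition `V j → V l` of maps of a sequence, extended by zero when `l < j`. -/
def seqPush (f : ∀ j, V j →ₗ[k] V (j + 1)) (j : ℕ) : ∀ l, V j →ₗ[k] V l
  | 0 => if h : j = 0 then h ▸ LinearMap.id else 0
  | l + 1 => if h : j = l + 1 then h ▸ LinearMap.id else f l ∘ₗ seqPush f j l

variable (f : ∀ j, V j →ₗ[k] V (j + 1))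

theorem seqPush_self (j : ℕ) : seqPush f j j = LinearMap.id := by
  cases j <;> simp [seqPush]

theorem seqPush_succ {j l : ℕ} (h : j ≠ l + 1) (v : V j) :
    seqPush f j (l + 1) v = f l (seqPush f j l v) := by
  simp [seqPush, h]

theorem seqPush_of_lt {j l : ℕ} (h : l < j) (v : V j) : seqPush f j l v = 0 := by
  induction l with
  | zero => simp [seqPush, h.ne']
  | succ l ih => rw [seqPush_succ f h.ne', ih (by omega), map_zero]

theorem seqPush_seqPush {i j l : ℕ} (hij : i ≤ j) (hjl : j ≤ l) (v : V i) :
    seqPush f j l (seqPush f i j v) = seqPush f i l v := by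
  induction l, hjl using Nat.le_induction with
  | base => rw [seqPush_self]; rfl
  | succ l h ih => rw [seqPush_succ f (by omega), seqPush_succ f (by omega), ih]

/-- In a sequence of vector spaces, the images of the first term have compatible
complements. -/
theorem exists_stable_isCompl : ∃ C : ∀ l, Submodule k (V l),
    (∀ l, ∀ x ∈ C l, f l x ∈ C (l + 1)) ∧ ∀ l, IsCompl (LinearMap.range (seqPush f 0 l)) (C l) := by
  let S : Set (∀ l, Submodule k (V l)) := {C | (∀ l, ∀ x ∈ C l, f l x ∈ C (l + 1)) ∧
    ∀ l, Disjoint (LinearMap.range (seqPush f 0 l)) (C l)}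
  obtain ⟨C, hC⟩ : ∃ C, Maximal (· ∈ S) C := by
    refine zorn_le₀ S fun c hc hchain => ?_
    have hdir : ∀ l, Directed (· ≤ ·) fun C : c => (C : ∀ l, Submodule k (V l)) l := fun l a b => by
      obtain ⟨d, hd, h1, h2⟩ := hchain.directedOn _ a.2 _ b.2
      exact ⟨⟨d, hd⟩, h1 l, h2 l⟩
    refine ⟨sSup c, ⟨fun l x hx => ?_, fun l => ?_⟩, fun C hC => le_sSup hC⟩
    · rw [sSup_apply] at hx ⊢
      rcases isEmpty_or_nonempty c with h | h
      · rw [iSup_of_empty, Submodule.mem_bot] at hx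
        rw [hx, map_zero]
        exact zero_mem _
      · obtain ⟨a, ha⟩ := (Submodule.mem_iSup_of_directed _ (hdir l)).1 hx
        exact (le_iSup (fun C : c => (C : ∀ l, Submodule k (V l)) (l + 1)) a)
          ((hc a.2).1 l x ha)
    · rw [sSup_apply, (hdir l).disjoint_iSup_right]
      exact fun a => (hc a.2).2 l
  refine ⟨C, hC.1.1, fun j => ⟨hC.1.2 j, ?_⟩⟩
  rw [codisjoint_iff_le_sup]
  intro v hv
  by_contra hvC
  obtain ⟨v, hvC, hv⟩ : ∃ v : V j, v ∉ LinearMap.range (seqPush f 0 j) ⊔ C j ∧ ∀ l ≥ j,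
      seqPush f j l v ∉ LinearMap.range (seqPush f 0 l) ⊔ C l ∨ seqPush f j l v ∈ C l := by
    by_cases h : ∃ l ≥ j, seqPush f j l v ∈ LinearMap.range (seqPush f 0 l) ⊔ C l
    · classical
      obtain ⟨hl, hw⟩ := Nat.find_spec h
      have hmin := fun i => Nat.find_min h (m := i)
      set l := Nat.find h
      obtain ⟨_, ⟨u, rfl⟩, c, hc, huc⟩ := Submodule.mem_sup.1 hw
      have key : ∀ i, j ≤ i → seqPush f j i (v - seqPush f 0 j u) =
          seqPush f j i v - seqPush f 0 i u := fun i hi => by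
        rw [map_sub, seqPush_seqPush f (Nat.zero_le _) hi]
      have hmem : ∀ i, j ≤ i → seqPush f j i (v - seqPush f 0 j u) ∈
          LinearMap.range (seqPush f 0 i) ⊔ C i → seqPush f j i v ∈
          LinearMap.range (seqPush f 0 i) ⊔ C i := fun i hi hm => by
        rw [key i hi] at hm
        simpa using add_mem hm (Submodule.mem_sup_left ⟨u, rfl⟩)
      have hC' : ∀ i, l ≤ i → seqPush f j i (v - seqPush f 0 j u) ∈ C i := fun i hi => by
        induction i, hi using Nat.le_induction with
        | base => rw [key l hl, ← huc, add_sub_cancel_left]; exact hc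
        | succ i hi ih => rw [seqPush_succ f (by omega)]; exact hC.1.1 i _ ih
      refine ⟨v - seqPush f 0 j u, fun h' => hvC ?_, fun i hi => ?_⟩
      · simpa [seqPush_self] using hmem j le_rfl (by simpa [seqPush_self] using h')
      · rcases lt_or_ge i l with h' | h'
        · exact .inl fun hm => hmin i h' ⟨hi, hmem i hi hm⟩
        · exact .inr (hC' i h')
    · push Not at h
      exact ⟨v, hvC, fun l hl => .inl (h l hl)⟩
  have hv' : ∀ l, seqPush f j l v ∉ LinearMap.range (seqPush f 0 l) ⊔ C l ∨
      seqPush f j l v ∈ C l := fun l => by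
    rcases lt_or_ge l j with h | h
    · exact .inr (by rw [seqPush_of_lt f h]; exact zero_mem _)
    · exact hv l h
  have hle : (fun l => C l ⊔ Submodule.span k {seqPush f j l v}) ≤ C := by
    refine hC.2 ⟨fun l x hx => ?_, fun l => ?_⟩ fun l => le_sup_left
    · obtain ⟨c, hc, w, hw, rfl⟩ := Submodule.mem_sup.1 hx
      obtain ⟨r, rfl⟩ := Submodule.mem_span_singleton.1 hw
      rw [map_add, map_smul]
      refine add_mem (Submodule.mem_sup_left (hC.1.1 l c hc)) (Submodule.smul_mem _ _ ?_)
      by_cases hj : j = l + 1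
      · rw [seqPush_of_lt f (by omega), map_zero]
        exact zero_mem _
      · rw [← seqPush_succ f hj]
        exact Submodule.mem_sup_right (Submodule.mem_span_singleton_self _)
    · rcases hv' l with h | h
      · rw [Submodule.disjoint_def]
        intro x hxU hx
        obtain ⟨c, hc, w, hw, rfl⟩ := Submodule.mem_sup.1 hx
        obtain ⟨r, rfl⟩ := Submodule.mem_span_singleton.1 hw
        by_cases hr : r = 0
        · rw [hr, zero_smul, add_zero] at hxU ⊢
          exact Submodule.disjoint_def.1 (hC.1.2 l) c hxU hc
        · refine absurd ?_ h
          rw [← Submodule.smul_mem_iff _ hr]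
          simpa using sub_mem (Submodule.mem_sup_left hxU) (Submodule.mem_sup_right hc)
      · beta_reduce
        rw [sup_eq_left.2 ((Submodule.span_singleton_le_iff_mem _ _).2 h)]
        exact hC.1.2 l
  refine hvC (Submodule.mem_sup_right (hle j (Submodule.mem_sup_right ?_)))
  rw [seqPush_self]
  exact Submodule.mem_span_singleton_self _

/-- A sequence of vector spaces has a compatible family of projections onto the images of
its first term. -/
theorem exists_proj_onto_range (g : ∀ l, V 0 →ₗ[k] V l) (hg0 : ∀ v, g 0 v = v)
    (hg : ∀ l v, g (l + 1) v = f l (g l v)) : ∃ e : ∀ l, V l →ₗ[k] V l,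
    (∀ v, e 0 v = v) ∧ (∀ l v, e (l + 1) (f l v) = f l (e l v)) ∧
      (∀ l v, e l (g l v) = g l v) ∧ ∀ l v, ∃ u, e l v = g l u := by
  obtain ⟨C, hC, hcompl⟩ := exists_stable_isCompl f
  have hgp : ∀ l, seqPush f 0 l = g l := fun l => by
    induction l with
    | zero => rw [seqPush_self]; ext v; exact (hg0 v).symm
    | succ l ih => ext v; rw [seqPush_succ f (by omega), ih, hg]
  have hcompl : ∀ l, IsCompl (LinearMap.range (g l)) (C l) := fun l => hgp l ▸ hcompl l
  have h1 : ∀ l u, Submodule.projection _ _ (hcompl l) (g l u) = g l u := fun l u =>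
    Submodule.projection_apply_left (hcompl l) ⟨g l u, u, rfl⟩
  refine ⟨fun l => Submodule.projection _ _ (hcompl l), fun v => ?_, fun l v => ?_, h1, fun l v => ?_⟩
  · have := h1 0 v
    rwa [hg0] at this
  · obtain ⟨_, ⟨u, rfl⟩, c, hc, rfl⟩ := Submodule.mem_sup.1
      ((hcompl l).sup_eq_top ▸ Submodule.mem_top : v ∈ _)
    simp only [map_add]
    rw [h1, ← hg, h1, (Submodule.projection_apply_eq_zero_iff (hcompl l)).2 hc,
      (Submodule.projection_apply_eq_zero_iff (hcompl (l + 1))).2 (hC l c hc), map_zero]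
  · obtain ⟨u, hu⟩ := Submodule.projection_apply_mem (hcompl l) v
    exact ⟨u, hu.symm⟩

/-- An inverse sequence of finite-dimensional vector spaces has a compatible family of
idempotents whose kernels are the kernels of the maps to its first term. -/
theorem exists_proj_along_ker [∀ j, FiniteDimensional k (V j)] (f : ∀ j, V (j + 1) →ₗ[k] V j)
    (g : ∀ l, V l →ₗ[k] V 0) (hg0 : ∀ v, g 0 v = v)
    (hg : ∀ l v, g (l + 1) v = g l (f l v)) : ∃ e : ∀ l, V l →ₗ[k] V l,
    (∀ v, e 0 v = v) ∧ (∀ l v, f l (e (l + 1) v) = e l (f l v)) ∧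
      (∀ l v, g l (e l v) = g l v) ∧ ∀ l v, g l v = 0 → e l v = 0 := by
  obtain ⟨e, h0, h1, h2, h3⟩ := exists_proj_onto_range (V := fun l => Module.Dual k (V l))
    (fun l => (f l).dualMap) (fun l => (g l).dualMap)
    (fun φ => LinearMap.ext fun v => by simp [hg0])
    (fun l φ => LinearMap.ext fun v => by simp [hg])
  let E : ∀ l, V l →ₗ[k] V l := fun l =>
    (Module.evalEquiv k (V l)).symm.toLinearMap ∘ₗ (e l).dualMap ∘ₗ
      (Module.evalEquiv k (V l)).toLinearMap
  have hE : ∀ l (φ : Module.Dual k (V l)) v, φ (E l v) = e l φ v := fun l φ v => by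
    have : Module.evalEquiv k (V l) (E l v) φ = (e l).dualMap (Module.evalEquiv k (V l) v) φ := by
      simp [E]
    simpa using this
  have hext : ∀ {l} {v w : V l}, (∀ φ : Module.Dual k (V l), φ v = φ w) → v = w := fun h =>
    (Module.evalEquiv k _).injective (LinearMap.ext h)
  refine ⟨E, fun v => hext fun φ => ?_, fun l v => hext fun φ => ?_, fun l v => hext fun φ => ?_,
    fun l v hv => hext fun φ => ?_⟩
  · rw [hE, h0]
  · have := congr($(h1 l φ) v)
    rw [← LinearMap.dualMap_apply, hE, hE, this]
    rfl
  · have := congr($(h2 l φ) v)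
    rw [← LinearMap.dualMap_apply, hE, this]
    rfl
  · obtain ⟨u, hu⟩ := h3 l φ
    rw [hE, hu, LinearMap.dualMap_apply, hv, map_zero, map_zero]

end Sequences

section RayMaps

variable {k} {Q : Type} [Quiver.{0} Q] {M : PathCat k Q ⥤ ModuleCat.{0} k} {x : ℕ → Q}

theorem exists_rayFamily (hx : Function.Injective x)
    (e : ∀ i, M.obj (vtx k Q (x i)) ⟶ M.obj (vtx k Q (x i))) (he0 : e 0 = 𝟙 _) :
    ∃ φ : ∀ z : Q, M.obj (vtx k Q z) ⟶ M.obj (vtx k Q z), (∀ i, φ (x i) = e i) ∧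
      ∀ z, (∀ i, z ≠ x (i + 1)) → φ z = 𝟙 _ := by
  classical
  let φ : ∀ z : Q, M.obj (vtx k Q z) ⟶ M.obj (vtx k Q z) := fun z =>
    if h : ∃ i, x i = z then h.choose_spec ▸ e h.choose else 𝟙 _
  have h1 : ∀ i, φ (x i) = e i := fun i => by
    have h : ∃ j, x j = x i := ⟨i, rfl⟩
    have key : ∀ j (hj : x j = x i), (hj ▸ e j : M.obj (vtx k Q (x i)) ⟶ _) = e i := fun j hj => by
      obtain rfl := hx hj
      rfl
    exact (dif_pos h).trans (key _ h.choose_spec)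
  refine ⟨φ, h1, fun z hz => ?_⟩
  by_cases h : ∃ i, x i = z
  · obtain ⟨i, rfl⟩ := h
    cases i with
    | zero => rw [h1, he0]
    | succ i => exact absurd rfl (hz i)
  · exact dif_neg h

/-- A compatible family of idempotents along a ray, extended by identities, is trivial on
an indecomposable representation. -/
theorem Indec.ray_eq_id (h : Indec k M) (hM : IsLfdMod k M) (hx : Function.Injective x)
    (e : ∀ i, M.obj (vtx k Q (x i)) →ₗ[k] M.obj (vtx k Q (x i))) (he0 : ∀ v, e 0 v = v)
    (he : ∀ i v, e i (e i v) = e i v)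
    (hnat : ∀ (y z : Q) (β : y ⟶ z), (∀ φ : ∀ z : Q, M.obj (vtx k Q z) ⟶ M.obj (vtx k Q z),
      (∀ i, φ (x i) = ModuleCat.ofHom (e i)) →
        M.map (arrHom k Q β) ≫ φ z = φ y ≫ M.map (arrHom k Q β)) ∨
      ((∀ i, y ≠ x (i + 1)) ∧ ∀ i, z ≠ x (i + 1)))
    {v₀ : M.obj (vtx k Q (x 0))} (hv₀ : v₀ ≠ 0) (i : ℕ) (v : M.obj (vtx k Q (x i))) :
    e i v = v := by
  obtain ⟨φ, h1, h2⟩ := exists_rayFamily hx (fun i => ModuleCat.ofHom (e i))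
    (ModuleCat.hom_ext (LinearMap.ext he0))
  let ε : M ⟶ M := repHom hM.1 hM.1 φ fun {y z} β => by
    rcases hnat y z β with h | ⟨hy, hz⟩
    · exact h φ h1
    · rw [h2 y hy, h2 z hz, Category.id_comp, Category.comp_id]
  have hεx : ∀ i v, (ε.app (vtx k Q (x i))).hom v = e i v := fun i v =>
    congr($(h1 i).hom v)
  have hid : ε ≫ ε = ε := rep_hom_ext fun z m => by
    by_cases hz : ∀ i, z ≠ x (i + 1)
    · have e1 : ∀ m, (ε.app (vtx k Q z)).hom m = m := fun m => congr($(h2 z hz).hom m)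
      rw [NatTrans.comp_app, ModuleCat.hom_comp, LinearMap.comp_apply, e1]
    · push Not at hz
      obtain ⟨i, rfl⟩ := hz
      rw [NatTrans.comp_app, ModuleCat.hom_comp, LinearMap.comp_apply, hεx, hεx, he]
  rcases h.eq_zero_or_eq_id hM ε hid with h0 | h0
  · refine absurd ?_ hv₀
    rw [← he0 v₀, ← hεx, h0]
    rfl
  · rw [← hεx, h0]
    rfl

theorem exists_bijective_of_surjective {V : ℕ → Type} [∀ j, AddCommGroup (V j)]
    [∀ j, Module k (V j)] [∀ j, FiniteDimensional k (V j)] (f : ∀ j, V j →ₗ[k] V (j + 1))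
    (n : ℕ) (hf : ∀ i ≥ n, Function.Surjective (f i)) :
    ∃ n, ∀ i ≥ n, Function.Bijective (f i) := by
  have hanti : Antitone fun i => Module.finrank k (V (n + i)) := antitone_nat_of_succ_le fun i =>
    LinearMap.finrank_le_finrank_of_surjective (hf (n + i) (by omega))
  obtain ⟨m, hm⟩ := WellFoundedLT.antitone_chain_condition hanti
  refine ⟨n + m, fun i hi => ?_⟩
  obtain ⟨j, rfl⟩ := Nat.exists_eq_add_of_le (show n ≤ i by omega)
  have h1 := hm j (by omega)
  have h2 := hm (j + 1) (by omega)
  have hs := hf (n + j) (by omega)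
  exact ⟨(LinearMap.injective_iff_surjective_of_finrank_eq_finrank (h1.symm.trans h2)).2 hs, hs⟩

theorem exists_bijective_of_injective {V : ℕ → Type} [∀ j, AddCommGroup (V j)]
    [∀ j, Module k (V j)] [∀ j, FiniteDimensional k (V j)] (f : ∀ j, V (j + 1) →ₗ[k] V j)
    (n : ℕ) (hf : ∀ i ≥ n, Function.Injective (f i)) :
    ∃ n, ∀ i ≥ n, Function.Bijective (f i) := by
  obtain ⟨n, hn⟩ := exists_bijective_of_surjective (fun i => (f i).dualMap) n fun i hi =>
    LinearMap.dualMap_surjective_of_injective (hf i hi)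
  exact ⟨n, fun i hi => (LinearMap.dualMap_bijective_iff).1 (hn i hi)⟩

/-- Along an outgoing ray, an indecomposable representation is eventually constant. -/
theorem Indec.exists_bijective_forward (h : Indec k M) (hM : IsLfdMod k M)
    (hx : Function.Injective x) (α : ∀ i, x i ⟶ x (i + 1))
    (hin : ∀ i y (β : y ⟶ x (i + 1)), (⟨y, β⟩ : Σ y, y ⟶ x (i + 1)) = ⟨x i, α i⟩)
    (hout : ∀ i z (β : x (i + 1) ⟶ z), (⟨z, β⟩ : Σ z, x (i + 1) ⟶ z) = ⟨_, α (i + 1)⟩) :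
    ∃ n, ∀ i ≥ n, Function.Bijective (M.map (arrHom k Q (α i))).hom := by
  have := fun i => hM.2 (vtx k Q (x i))
  by_cases h0 : ∃ j, ∃ v : M.obj (vtx k Q (x j)), v ≠ 0
  · obtain ⟨j, v₀, hv₀⟩ := h0
    refine exists_bijective_of_surjective (V := fun i => M.obj (vtx k Q (x i)))
      (fun i => (M.map (arrHom k Q (α i))).hom) j ?_
    let f : ∀ i, M.obj (vtx k Q (x (j + i))) →ₗ[k] M.obj (vtx k Q (x (j + (i + 1)))) :=
      fun i => (M.map (arrHom k Q (α (j + i)))).hom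
    let g : ∀ i, M.obj (vtx k Q (x (j + 0))) →ₗ[k] M.obj (vtx k Q (x (j + i))) :=
      fun i => Nat.rec LinearMap.id (fun i g => f i ∘ₗ g) i
    obtain ⟨e, he0, he1, he2, he3⟩ := exists_proj_onto_range
      (V := fun i => M.obj (vtx k Q (x (j + i)))) f g (fun _ => rfl) (fun _ _ => rfl)
    have hinj : Function.Injective fun i => x (j + i) := fun a b hab => by
      have := hx hab
      omega
    have key := h.ray_eq_id hM hinj e he0
      (fun i v => by obtain ⟨u, hu⟩ := he3 i v; rw [hu, he2])
      (fun y z β => ?_) hv₀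
    · intro i hi v
      obtain ⟨l, rfl⟩ := Nat.exists_eq_add_of_le hi
      obtain ⟨u, hu⟩ := he3 (l + 1) v
      exact ⟨g l u, ((key (l + 1) v).symm.trans hu).symm⟩
    · by_cases hz : ∃ i, z = x (j + (i + 1))
      · obtain ⟨i, rfl⟩ := hz
        obtain ⟨rfl, hβ⟩ := Sigma.mk.inj_iff.1 (hin (j + i) y β)
        obtain rfl := eq_of_heq hβ
        left
        intro φ hφ
        have e1 := hφ i
        have e2 := hφ (i + 1)
        refine ModuleCat.hom_ext (LinearMap.ext fun v => ?_)
        exact (congr($(e2).hom _)).trans ((he1 i v).trans (congrArg _ (congr($(e1).hom v)).symm))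
      · refine .inr ⟨?_, fun i hi => hz ⟨i, hi⟩⟩
        rintro i rfl
        obtain ⟨rfl, -⟩ := Sigma.mk.inj_iff.1 (hout (j + i) z β)
        exact hz ⟨i + 1, rfl⟩
  · push Not at h0
    exact ⟨0, fun i _ => ⟨fun a b _ => (h0 i a).trans (h0 i b).symm,
      fun b => ⟨0, (map_zero _).trans (h0 (i + 1) b).symm⟩⟩⟩

/-- Along an incoming ray, an indecomposable representation is eventually constant. -/
theorem Indec.exists_bijective_backward (h : Indec k M) (hM : IsLfdMod k M)
    (hx : Function.Injective x) (α : ∀ i, x (i + 1) ⟶ x i)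
    (hin : ∀ i z (β : x (i + 1) ⟶ z), (⟨z, β⟩ : Σ z, x (i + 1) ⟶ z) = ⟨x i, α i⟩)
    (hout : ∀ i y (β : y ⟶ x (i + 1)), (⟨y, β⟩ : Σ y, y ⟶ x (i + 1)) = ⟨_, α (i + 1)⟩) :
    ∃ n, ∀ i ≥ n, Function.Bijective (M.map (arrHom k Q (α i))).hom := by
  have := fun i => hM.2 (vtx k Q (x i))
  by_cases h0 : ∃ j, ∃ v : M.obj (vtx k Q (x j)), v ≠ 0
  · obtain ⟨j, v₀, hv₀⟩ := h0
    refine exists_bijective_of_injective (V := fun i => M.obj (vtx k Q (x i)))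
      (fun i => (M.map (arrHom k Q (α i))).hom) j ?_
    let f : ∀ i, M.obj (vtx k Q (x (j + (i + 1)))) →ₗ[k] M.obj (vtx k Q (x (j + i))) :=
      fun i => (M.map (arrHom k Q (α (j + i)))).hom
    let g : ∀ i, M.obj (vtx k Q (x (j + i))) →ₗ[k] M.obj (vtx k Q (x (j + 0))) :=
      fun i => Nat.rec LinearMap.id (fun i g => g ∘ₗ f i) i
    obtain ⟨e, he0, he1, he2, he3⟩ := exists_proj_along_ker
      (V := fun i => M.obj (vtx k Q (x (j + i)))) f g (fun _ => rfl) (fun _ _ => rfl)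
    have hinj : Function.Injective fun i => x (j + i) := fun a b hab => by
      have := hx hab
      omega
    have key := h.ray_eq_id hM hinj e he0
      (fun i v => by
        rw [← sub_eq_zero, ← map_sub]
        exact he3 i _ (by rw [map_sub, he2, sub_self]))
      (fun y z β => ?_) hv₀
    · intro i hi
      obtain ⟨l, rfl⟩ := Nat.exists_eq_add_of_le hi
      refine (injective_iff_map_eq_zero (f l)).2 fun v hv => ?_
      rw [← key (l + 1) v]
      exact he3 (l + 1) v ((congrArg (g l) hv).trans (map_zero _))
    · by_cases hy : ∃ i, y = x (j + (i + 1))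
      · obtain ⟨i, rfl⟩ := hy
        obtain ⟨rfl, hβ⟩ := Sigma.mk.inj_iff.1 (hin (j + i) z β)
        obtain rfl := eq_of_heq hβ
        left
        intro φ hφ
        have e1 := hφ i
        have e2 := hφ (i + 1)
        refine ModuleCat.hom_ext (LinearMap.ext fun v => ?_)
        exact (congr($(e1).hom _)).trans ((he1 i v).symm.trans (congrArg _ (congr($(e2).hom v)).symm))
      · refine .inr ⟨fun i hi => hy ⟨i, hi⟩, ?_⟩
        rintro i rfl
        obtain ⟨rfl, -⟩ := Sigma.mk.inj_iff.1 (hout (j + i) y β)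
        exact hy ⟨i + 1, rfl⟩
  · push Not at h0
    exact ⟨0, fun i _ => ⟨fun a b _ => (h0 _ a).trans (h0 _ b).symm,
      fun b => ⟨0, (map_zero _).trans (h0 _ b).symm⟩⟩⟩

end RayMaps

section Criteria

variable {k} {A : Type} [Category.{0} A]

theorem finiteDimensional_biproduct {r : ℕ} {P : Fin r → (A ⥤ ModuleCat.{0} k)} (y : A)
    (hP : ∀ i, FiniteDimensional k ((P i).obj y)) : FiniteDimensional k ((⨁ P).obj y) :=
  Module.Finite.of_injective (LinearMap.pi fun i => ((biproduct.π P i).app y).hom)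
    fun _ _ h => biproduct_ext fun i => congrFun h i

variable [Preadditive A] [CategoryTheory.Linear k A]

theorem exists_generators {M : A ⥤ ModuleCat.{0} k} (hM : IsLfdMod k M) {F : Set A}
    (hF : F.Finite) (h : ∀ y (m : M.obj y), m ≠ 0 →
      ∃ b ∈ F, ∃ (c : b ⟶ y) (m' : M.obj b), (M.map c).hom m' = m) :
    ∃ (r : ℕ) (a : Fin r → A) (g : ∀ i, M.obj (a i)), (∀ i, a i ∈ F) ∧
      ∀ (y : A) (m : M.obj y), ∃ c : ∀ i, a i ⟶ y, m = ∑ i, (M.map (c i)).hom (g i) := by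
  classical
  have := hM.2
  have := hF.fintype
  let J := Σ b : F, Fin (Module.finrank k (M.obj b))
  let e : Fin (Fintype.card J) ≃ J := (Fintype.equivFin J).symm
  refine ⟨Fintype.card J, fun i => (e i).1, fun i => Module.finBasis k _ (e i).2,
    fun i => (e i).1.2, fun y m => ?_⟩
  let φ : (∀ i, ((e i).1 : A) ⟶ y) →ₗ[k] M.obj y :=
    { toFun := fun c => ∑ i, (M.map (c i)).hom (Module.finBasis k _ (e i).2)
      map_add' := fun c d => by simp [hM.1.1, Finset.sum_add_distrib]
      map_smul' := fun r c => by simp [hM.1.2, Finset.smul_sum] }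
  suffices m ∈ LinearMap.range φ by
    obtain ⟨c, rfl⟩ := this
    exact ⟨c, rfl⟩
  by_cases hm : m = 0
  · rw [hm]
    exact Submodule.zero_mem _
  obtain ⟨b, hb, c, m, rfl⟩ := h y m hm
  rw [← (Module.finBasis k (M.obj b)).sum_repr m, map_sum]
  refine Submodule.sum_mem _ fun j _ => ?_
  rw [map_smul]
  refine Submodule.smul_mem _ _ ?_
  obtain ⟨p, hp⟩ := e.surjective ⟨⟨b, hb⟩, j⟩
  have key : ∀ q : J, e p = q → ∀ c : (q.1 : A) ⟶ y,
      (M.map c).hom (Module.finBasis k _ q.2) ∈ LinearMap.range φ := by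
    rintro _ rfl c
    refine ⟨Pi.single p c, ?_⟩
    refine (Finset.sum_eq_single p (fun i _ hi => ?_) fun h => absurd (Finset.mem_univ p) h).trans ?_
    · rw [Pi.single_eq_of_ne hi, hM.1.map_zero]
      rfl
    · rw [Pi.single_eq_same]
  exact key _ hp c

theorem exists_cogenerators {M : A ⥤ ModuleCat.{0} k} (hM : IsLfdMod k M) {F : Set A}
    (hF : F.Finite) (h : ∀ y (m : M.obj y), m ≠ 0 →
      ∃ b ∈ F, ∃ c : y ⟶ b, (M.map c).hom m ≠ 0) :
    ∃ (s : ℕ) (b : Fin s → A) (l : ∀ j, M.obj (b j) →ₗ[k] k), (∀ j, b j ∈ F) ∧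
      ∀ (y : A) (m : M.obj y), (∀ j (d : y ⟶ b j), l j ((M.map d).hom m) = 0) → m = 0 := by
  classical
  have := hM.2
  have := hF.fintype
  let J := Σ b : F, Fin (Module.finrank k (M.obj b))
  let e : Fin (Fintype.card J) ≃ J := (Fintype.equivFin J).symm
  refine ⟨Fintype.card J, fun i => (e i).1, fun i => (Module.finBasis k _).coord (e i).2,
    fun i => (e i).1.2, fun y m hm => ?_⟩
  by_contra h0
  obtain ⟨b, hb, c, hc⟩ := h y m h0
  refine hc ((Module.finBasis k (M.obj b)).ext_elem fun j => ?_)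
  rw [map_zero]
  obtain ⟨p, hp⟩ := e.surjective ⟨⟨b, hb⟩, j⟩
  have key : ∀ q : J, e p = q → ∀ c : y ⟶ (q.1 : A),
      (Module.finBasis k _).coord q.2 ((M.map c).hom m) = 0 := by
    rintro _ rfl c
    exact hm p c
  exact key _ hp c

theorem exists_epi {M : A ⥤ ModuleCat.{0} k} (hM : IsLfdMod k M) {F : Set A}
    (hF : F.Finite) (h : ∀ y (m : M.obj y), m ≠ 0 →
      ∃ b ∈ F, ∃ (c : b ⟶ y) (m' : M.obj b), (M.map c).hom m' = m) :
    ∃ (r : ℕ) (a : Fin r → A) (f : (⨁ fun i => ProjAt k (a i)) ⟶ M), (∀ i, a i ∈ F) ∧ Epi f := by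
  obtain ⟨r, a, g, ha, hg⟩ := exists_generators hM hF h
  refine ⟨r, a, biproduct.desc fun i => projHom hM.1 (g i), ha, ?_⟩
  have : ∀ y, Epi ((biproduct.desc fun i => projHom hM.1 (g i)).app y) := by
    intro y
    rw [ModuleCat.epi_iff_surjective]
    intro m
    obtain ⟨c, rfl⟩ := hg y m
    refine ⟨∑ i, ((biproduct.ι (fun i => ProjAt k (a i)) i).app y).hom (c i), ?_⟩
    refine (map_sum ((biproduct.desc fun i => projHom hM.1 (g i)).app y).hom _ _).trans ?_
    refine Finset.sum_congr rfl fun i _ => ?_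
    have := biproduct.ι_desc (fun i => projHom hM.1 (g i)) i
    exact congr((($this).app y).hom (c i))
  exact NatTrans.epi_of_epi_app _

theorem exists_mono {M : A ⥤ ModuleCat.{0} k} (hM : IsLfdMod k M) {F : Set A}
    (hF : F.Finite) (h : ∀ y (m : M.obj y), m ≠ 0 →
      ∃ b ∈ F, ∃ c : y ⟶ b, (M.map c).hom m ≠ 0) :
    ∃ (s : ℕ) (b : Fin s → A) (f : M ⟶ ⨁ fun j => InjAt k (b j)), (∀ j, b j ∈ F) ∧ Mono f := by
  obtain ⟨s, b, l, hb, hl⟩ := exists_cogenerators hM hF h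
  refine ⟨s, b, biproduct.lift fun j => injHom hM.1 (l j), hb, ?_⟩
  have : ∀ y, Mono ((biproduct.lift fun j => injHom hM.1 (l j)).app y) := by
    intro y
    rw [ModuleCat.mono_iff_injective]
    refine (injective_iff_map_eq_zero ((biproduct.lift fun j => injHom hM.1 (l j)).app y).hom).2
      fun m hm => hl y m fun j d => ?_
    have h1 := biproduct.lift_π (fun j => injHom hM.1 (l j)) j
    have h2 : ((injHom hM.1 (l j)).app y).hom m = 0 := by
      rw [← h1]
      refine (congrArg ((biproduct.π (fun j => InjAt k (b j)) j).app y).hom hm).trans ?_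
      exact map_zero _
    exact congr((injEquiv (b j) y).symm $h2 d)
  exact NatTrans.mono_of_mono_app _

/-- A module supported on `T` and determined by its values on a finite subset `F` of `T`
through which the morphisms out of `F` factor is finitely presented. -/
theorem isFP_of_support {L : A ⥤ ModuleCat.{0} k} (hL : IsLfdMod k L)
    (hA : ∀ a b : A, FiniteDimensional k (a ⟶ b)) {F T : Set A} (hF : F.Finite)
    (hFT : ∀ a ∈ F, ∀ y ∉ T, Subsingleton (a ⟶ y)) (hT : ∀ y ∉ T, Subsingleton (L.obj y))
    (h : ∀ y ∈ T, ∃ b ∈ F, ∃ c : b ⟶ y, Function.Bijective (L.map c).hom ∧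
      ∀ a ∈ F, ∀ d : a ⟶ y, ∃ d' : a ⟶ b, d' ≫ c = d) : IsFP k L := by
  obtain ⟨r, a, f, ha, hf⟩ := exists_epi hL hF fun y m hm => by
    by_cases hy : y ∈ T
    · obtain ⟨b, hb, c, hc, -⟩ := h y hy
      exact ⟨b, hb, c, hc.2 m⟩
    · have := hT y hy
      exact absurd (Subsingleton.elim m 0) hm
  refine ⟨r, a, f, hf, ?_⟩
  have hP : IsLfdMod k (⨁ fun i => ProjAt k (a i)) :=
    ⟨isMod_biproduct fun i => isMod_projAt _, fun y => finiteDimensional_biproduct y fun i => by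
      have := hA (a i) y
      exact Module.Finite.equiv (projEquiv (k := k) (a i) y)⟩
  obtain ⟨s, b, g, -, hg⟩ := exists_epi (hP.of_mono (kernel.ι f)) hF fun y q hq => by
    by_cases hy : y ∈ T
    · obtain ⟨b, hb, c, hc, hd⟩ := h y hy
      refine ⟨b, hb, c, ?_⟩
      choose d' hd' using fun i => hd (a i) (ha i) ((projEquiv (k := k) (a i) y).symm
        (((biproduct.π (fun i => ProjAt k (a i)) i).app y).hom (((kernel.ι f).app y).hom q)))
      let p' := ∑ i, ((biproduct.ι (fun i => ProjAt k (a i)) i).app b).hom (projEquiv _ _ (d' i))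
      have hp' : ((⨁ fun i => ProjAt k (a i)).map c).hom p' = ((kernel.ι f).app y).hom q := by
        refine biproduct_ext fun i => ?_
        rw [app_naturality, biproduct_π_sum, projAt_map, hd', LinearEquiv.apply_symm_apply]
      obtain ⟨q', hq'⟩ := mem_kernel f p' (hc.1 (by
        rw [← app_naturality, hp', map_zero]
        exact app_comp_zero (kernel.condition f) y q))
      refine ⟨q', app_injective_of_mono (kernel.ι f) y ?_⟩
      rw [app_naturality, hq', hp']
    · refine absurd (app_injective_of_mono (kernel.ι f) y (biproduct_ext fun i => ?_)) hq
      have := hFT (a i) (ha i) y hy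
      exact (projEquiv (k := k) (a i) y).symm.injective (Subsingleton.elim (α := (a i ⟶ y)) _ _)
  exact ⟨s, b, g, hg⟩

/-- A module supported on `T` and determined by its values on a finite subset `F` of `T`
through which the morphisms into `F` factor is finitely co-presented. -/
theorem isFCP_of_support {N : A ⥤ ModuleCat.{0} k} (hN : IsLfdMod k N)
    (hA : ∀ a b : A, FiniteDimensional k (a ⟶ b)) {F T : Set A} (hF : F.Finite)
    (hFT : ∀ a ∈ F, ∀ y ∉ T, Subsingleton (y ⟶ a)) (hT : ∀ y ∉ T, Subsingleton (N.obj y))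
    (h : ∀ y ∈ T, ∃ b ∈ F, ∃ c : y ⟶ b, Function.Bijective (N.map c).hom ∧
      ∀ a ∈ F, ∀ d : y ⟶ a, ∃ d' : b ⟶ a, c ≫ d' = d) : IsFCP k N := by
  obtain ⟨r, a, f, ha, hf⟩ := exists_mono hN hF fun y m hm => by
    by_cases hy : y ∈ T
    · obtain ⟨b, hb, c, hc, -⟩ := h y hy
      exact ⟨b, hb, c, fun h0 => hm (hc.1 (h0.trans (map_zero _).symm))⟩
    · have := hT y hy
      exact absurd (Subsingleton.elim m 0) hm
  refine ⟨r, a, f, hf, ?_⟩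
  have hJ : IsLfdMod k (⨁ fun i => InjAt k (a i)) :=
    ⟨isMod_biproduct fun i => isMod_injAt _, fun y => finiteDimensional_biproduct y fun i => by
      have := hA y (a i)
      exact Module.Finite.equiv (injEquiv (k := k) (a i) y)⟩
  obtain ⟨s, b, g, -, hg⟩ := exists_mono (hJ.of_epi (cokernel.π f)) hF fun y q hq => by
    obtain ⟨j, rfl⟩ := app_surjective_of_epi (cokernel.π f) y q
    by_cases hy : y ∈ T
    · obtain ⟨b, hb, c, hc, hd⟩ := h y hy
      refine ⟨b, hb, c, fun h0 => hq ?_⟩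
      rw [← app_naturality] at h0
      obtain ⟨m, hm⟩ := mem_range_of_cokernel f _ h0
      obtain ⟨m, rfl⟩ := hc.2 m
      have hj : j = (f.app y).hom m := by
        refine biproduct_ext fun i => (injEquiv (k := k) (a i) y).symm.injective
          (LinearMap.ext fun d => ?_)
        obtain ⟨d', rfl⟩ := hd (a i) (ha i) d
        rw [← injAt_map, ← injAt_map, ← app_naturality, ← app_naturality, ← hm, app_naturality]
      rw [hj]
      exact app_comp_zero (cokernel.condition f) y m
    · refine absurd ?_ hq
      rw [show j = 0 from biproduct_ext fun i => ?_, map_zero]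
      have := hFT (a i) (ha i) y hy
      refine (injEquiv (k := k) (a i) y).symm.injective (LinearMap.ext fun d => ?_)
      rw [Subsingleton.elim (α := (y ⟶ a i)) d 0, map_zero, map_zero]
  exact ⟨s, b, g, hg⟩

end Criteria

section Truncation

variable {k} {A : Type} [Category.{0} A]

open Classical in
/-- The submodule which is everything on `T` and zero elsewhere. -/
noncomputable def restrictTo (M : A ⥤ ModuleCat.{0} k) (T : Set A) (a : A) :
    Submodule k (M.obj a) :=
  if a ∈ T then ⊤ else ⊥

variable [Preadditive A] [CategoryTheory.Linear k A]

/-- The restriction of a module to a set of objects closed under successors is a submodule. -/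
theorem exists_truncation {M : A ⥤ ModuleCat.{0} k} (hM : IsMod k M) {T : Set A}
    (hT : ∀ a ∈ T, ∀ b ∉ T, Subsingleton (a ⟶ b)) :
    ∃ (L N : A ⥤ ModuleCat.{0} k) (f : L ⟶ M) (g : M ⟶ N) (zero : f ≫ g = 0),
      Mono f ∧ Epi g ∧ (ShortComplex.mk f g zero).Exact ∧
      (∀ b ∈ T, Function.Bijective (f.app b).hom ∧ Subsingleton (N.obj b)) ∧
      (∀ b ∉ T, Function.Bijective (g.app b).hom ∧ Subsingleton (L.obj b)) := by
  have hle : ∀ {a b : A} (c : a ⟶ b),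
      restrictTo M T a ≤ (restrictTo M T b).comap (M.map c).hom := fun {a b} c m hm => by
    rw [Submodule.mem_comap]
    by_cases hb : b ∈ T
    · simp [restrictTo, hb]
    · by_cases ha : a ∈ T
      · have := hT a ha b hb
        rw [Subsingleton.elim c 0, hM.map_zero]
        exact Submodule.zero_mem _
      · rw [restrictTo, if_neg ha, Submodule.mem_bot] at hm
        rw [hm, map_zero]
        exact Submodule.zero_mem _
  let N : A ⥤ ModuleCat.{0} k :=
    { obj := fun a => ModuleCat.of k (M.obj a ⧸ restrictTo M T a)
      map := fun c => ModuleCat.ofHom (Submodule.mapQ _ _ (M.map c).hom (hle c))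
      map_id := fun a => by
        refine ModuleCat.hom_ext (Submodule.linearMap_qext _ (LinearMap.ext fun m => ?_))
        exact congrArg (Submodule.mkQ _) congr($(M.map_id a).hom m)
      map_comp := fun c d => by
        refine ModuleCat.hom_ext (Submodule.linearMap_qext _ (LinearMap.ext fun m => ?_))
        exact congrArg (Submodule.mkQ _) congr($(M.map_comp c d).hom m) }
  let g : M ⟶ N :=
    { app := fun a => ModuleCat.ofHom (Submodule.mkQ (restrictTo M T a))
      naturality := fun a b c => rfl }
  have hg : ∀ a, Function.Surjective (g.app a).hom := fun a => Submodule.mkQ_surjective _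
  have hge : Epi g := by
    have : ∀ a, Epi (g.app a) := fun a => (ModuleCat.epi_iff_surjective _).2 (hg a)
    exact NatTrans.epi_of_epi_app _
  have hg0 : ∀ a (m : M.obj a), (g.app a).hom m = 0 ↔ m ∈ restrictTo M T a := fun a m =>
    Submodule.Quotient.mk_eq_zero _
  refine ⟨kernel g, N, kernel.ι g, g, kernel.condition g, inferInstance, hge,
    ShortComplex.exact_kernel g, fun b hb => ⟨⟨app_injective_of_mono _ b, fun m => ?_⟩, ?_⟩,
    fun b hb => ⟨⟨?_, hg b⟩, ?_⟩⟩
  · refine mem_kernel g m ((hg0 b m).2 ?_)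
    rw [restrictTo, if_pos hb]
    trivial
  · refine subsingleton_of_forall_eq 0 fun n => ?_
    obtain ⟨m, rfl⟩ := hg b n
    refine (hg0 b m).2 ?_
    rw [restrictTo, if_pos hb]
    trivial
  · refine (injective_iff_map_eq_zero _).2 fun m hm => ?_
    have := (hg0 b m).1 hm
    rwa [restrictTo, if_neg hb, Submodule.mem_bot] at this
  · refine subsingleton_of_forall_eq 0 fun l => app_injective_of_mono (kernel.ι g) b ?_
    have := (hg0 b _).1 (app_comp_zero (kernel.condition g) b l)
    rw [restrictTo, if_neg hb, Submodule.mem_bot] at this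
    rw [this, map_zero]

end Truncation

section Rrep

variable {k}

theorem bijective_map_iff {A : Type} [Category.{0} A] {L M : A ⥤ ModuleCat.{0} k} (f : L ⟶ M)
    {a b : A} (c : a ⟶ b) (ha : Function.Bijective (f.app a).hom)
    (hb : Function.Bijective (f.app b).hom) :
    Function.Bijective (L.map c).hom ↔ Function.Bijective (M.map c).hom := by
  have h : (f.app b).hom ∘ (L.map c).hom = (M.map c).hom ∘ (f.app a).hom :=
    funext fun m => app_naturality f c m
  rw [← Function.Bijective.of_comp_iff' hb, h, Function.Bijective.of_comp_iff _ ha]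

variable {Q : Type} [Quiver.{0} Q]

theorem exists_comp_eq_of_path {a b y : Q} (p : Quiver.Path b y)
    (h : ∀ q : Quiver.Path a y, ∃ q' : Quiver.Path a b, q = q'.comp p)
    (d : vtx k Q a ⟶ vtx k Q y) : ∃ d' : vtx k Q a ⟶ vtx k Q b, d' ≫ pathHom k p = d := by
  induction d using hom_induction with
  | zero => exact ⟨0, zero_comp⟩
  | add f g hf hg =>
    obtain ⟨f, rfl⟩ := hf
    obtain ⟨g, rfl⟩ := hg
    exact ⟨f + g, Preadditive.add_comp ..⟩
  | path r q =>
    obtain ⟨q, rfl⟩ := h q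
    exact ⟨r • pathHom k q, by rw [Linear.smul_comp, pathHom_comp]⟩

theorem exists_comp_eq_of_path' {a b y : Q} (p : Quiver.Path y b)
    (h : ∀ q : Quiver.Path y a, ∃ q' : Quiver.Path b a, q = p.comp q')
    (d : vtx k Q y ⟶ vtx k Q a) : ∃ d' : vtx k Q b ⟶ vtx k Q a, pathHom k p ≫ d' = d := by
  induction d using hom_induction with
  | zero => exact ⟨0, comp_zero⟩
  | add f g hf hg =>
    obtain ⟨f, rfl⟩ := hf
    obtain ⟨g, rfl⟩ := hg
    exact ⟨f + g, Preadditive.comp_add ..⟩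
  | path r q =>
    obtain ⟨q, rfl⟩ := h q
    exact ⟨r • pathHom k q, by rw [Linear.comp_smul, pathHom_comp]⟩

theorem inRrep_of_truncation {M : PathCat k Q ⥤ ModuleCat.{0} k} (hM : IsLfdMod k M)
    (hQ : IntervalFinite Q) {T F G : Set Q} (hT : ∀ x ∈ T, ∀ y, (x ⟶ y) → y ∈ T)
    (hF : F.Finite) (hFT : F ⊆ T) (hG : G.Finite) (hGT : Disjoint G T)
    (hFM : ∀ y ∈ T, ∃ b ∈ F, ∃ p : Quiver.Path b y, Function.Bijective (M.map (pathHom k p)).hom ∧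
      ∀ a ∈ F, ∀ q : Quiver.Path a y, ∃ q' : Quiver.Path a b, q = q'.comp p)
    (hGM : ∀ y ∉ T, ∃ b ∈ G, ∃ p : Quiver.Path y b, Function.Bijective (M.map (pathHom k p)).hom ∧
      ∀ a ∈ G, ∀ q : Quiver.Path y a, ∃ q' : Quiver.Path b a, q = p.comp q')
    (hfin : {p : Σ (x : Q) (y : Q), x ⟶ y | p.1 ∉ T ∧ p.2.1 ∈ T}.Finite) : InRrep k Q M := by
  have hpath : ∀ x ∈ T, ∀ y ∉ T, IsEmpty (Quiver.Path x y) := fun x hx y hy => ⟨fun p => by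
    apply hy
    clear hy
    induction p with
    | nil => exact hx
    | cons p α ih => exact hT _ ih _ α⟩
  have hhom : ∀ x ∈ T, ∀ y ∉ T, Subsingleton (vtx k Q x ⟶ vtx k Q y) := fun x hx y hy =>
    subsingleton_hom k (hpath x hx y hy)
  have hfd : ∀ a b : PathCat k Q, FiniteDimensional k (a ⟶ b) := fun a b =>
    finite_hom (Q := Q) k (hQ a b)
  let T' : Set (PathCat k Q) := fun a => (a : Q) ∈ T
  obtain ⟨L, N, f, g, w, hf, hg, hex, h1, h2⟩ := exists_truncation hM.1 (T := T')
    (fun a ha b hb => hhom a ha b hb)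
  have hL : IsLfdMod k L := hM.of_mono f
  have hN : IsLfdMod k N := hM.of_epi g
  refine ⟨L, N, f, g, w, hf, hg, hex, ?_, ?_, hfin.subset ?_⟩
  · refine isFP_of_support hL hfd (F := fun a => (a : Q) ∈ F) (T := T') hF
      (fun a ha y hy => hhom a (hFT ha) y hy) (fun y hy => (h2 y hy).2) fun y hy => ?_
    obtain ⟨y, rfl⟩ := exists_eq_vtx k y
    obtain ⟨b, hb, p, hp, hq⟩ := hFM y hy
    exact ⟨vtx k Q b, hb, pathHom (Q := Q) k p,
      (bijective_map_iff f (pathHom (Q := Q) k p) (h1 _ (hFT hb)).1 (h1 y hy).1).2 hp,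
      by
        intro a ha d
        obtain ⟨a, rfl⟩ := exists_eq_vtx k a
        exact exists_comp_eq_of_path p (hq a ha) d⟩
  · have hGT' : ∀ b ∈ G, b ∉ T := fun b hb => Set.disjoint_left.1 hGT hb
    refine isFCP_of_support hN hfd (F := fun a => (a : Q) ∈ G) (T := T'ᶜ) hG
      (fun a ha y hy => hhom y (not_not.1 hy) a (hGT' a ha))
      (fun y hy => (h1 y (not_not.1 hy)).2) fun y hy => ?_
    obtain ⟨y, rfl⟩ := exists_eq_vtx k y
    obtain ⟨b, hb, p, hp, hq⟩ := hGM y hy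
    exact ⟨vtx k Q b, hb, pathHom (Q := Q) k p,
      (bijective_map_iff g (pathHom (Q := Q) k p) (h2 y hy).1 (h2 _ (hGT' b hb)).1).1 hp,
      by
        intro a ha d
        obtain ⟨a, rfl⟩ := exists_eq_vtx k a
        exact exists_comp_eq_of_path' p (hq a ha) d⟩
  · rintro ⟨x, y, α⟩ ⟨hM0, hL0, hN0⟩
    dsimp only at hM0 hL0 hN0
    by_contra hxy
    apply hM0
    refine ModuleCat.hom_ext (LinearMap.ext fun m => ?_)
    by_cases hx : x ∈ T
    · obtain ⟨l, rfl⟩ := (h1 (vtx k Q x) hx).1.2 m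
      rw [← app_naturality, hL0]
      exact map_zero _
    · have hy : y ∉ T := fun hy => hxy ⟨hx, hy⟩
      apply (h2 (vtx k Q y) hy).1.1
      rw [app_naturality, hN0]
      exact (map_zero (g.app (vtx k Q y)).hom).symm

end Rrep

section Star

variable {k} {Q : Type} [Quiver.{0} Q] {M : PathCat k Q ⥤ ModuleCat.{0} k}

theorem bijective_map_nil (x : Q) :
    Function.Bijective (M.map (pathHom k (Quiver.Path.nil : Quiver.Path x x))).hom := by
  rw [pathHom_nil, M.map_id]
  exact Function.bijective_id

theorem exists_forward_path {x : ℕ → Q} (α : ∀ i, x i ⟶ x (i + 1))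
    (hin : ∀ i y (β : y ⟶ x (i + 1)), (⟨y, β⟩ : Σ y, y ⟶ x (i + 1)) = ⟨x i, α i⟩) {n : ℕ}
    (hbij : ∀ i ≥ n, Function.Bijective (M.map (arrHom k Q (α i))).hom) (j : ℕ) :
    ∃ p : Quiver.Path (x n) (x (n + j)), Function.Bijective (M.map (pathHom k p)).hom ∧
      ∀ a, (∀ l, a ≠ x (n + l + 1)) → ∀ q : Quiver.Path a (x (n + j)),
        ∃ q' : Quiver.Path a (x n), q = q'.comp p := by
  induction j with
  | zero => exact ⟨Quiver.Path.nil, bijective_map_nil _, fun a _ q => ⟨q, rfl⟩⟩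
  | succ j ih =>
    obtain ⟨p, hp, hq⟩ := ih
    refine ⟨p.cons (α (n + j)), ?_, fun a ha q => ?_⟩
    · rw [pathHom_cons, M.map_comp]
      exact (hbij _ (Nat.le_add_right n j)).comp hp
    · have key : ∀ y, ∀ q : Quiver.Path a y, ∀ h : y = x (n + j + 1),
          ∃ q' : Quiver.Path a (x n), h ▸ q = q'.comp (p.cons (α (n + j))) := by
        intro y q h
        cases q with
        | nil => exact absurd h (ha j)
        | cons q β =>
          subst h
          cases hin _ _ β
          obtain ⟨q', rfl⟩ := hq a ha q
          exact ⟨q', rfl⟩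
      exact key _ q rfl

theorem exists_backward_path {x : ℕ → Q} (α : ∀ i, x (i + 1) ⟶ x i)
    (hout : ∀ i y (β : x (i + 1) ⟶ y), (⟨y, β⟩ : Σ y, x (i + 1) ⟶ y) = ⟨x i, α i⟩) {n : ℕ}
    (hbij : ∀ i ≥ n, Function.Bijective (M.map (arrHom k Q (α i))).hom) (j : ℕ) :
    ∃ p : Quiver.Path (x (n + j)) (x n), Function.Bijective (M.map (pathHom k p)).hom ∧
      ∀ a, (∀ l, a ≠ x (n + l + 1)) → ∀ q : Quiver.Path (x (n + j)) a,
        ∃ q' : Quiver.Path (x n) a, q = p.comp q' := by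
  induction j with
  | zero =>
    exact ⟨Quiver.Path.nil, bijective_map_nil _, fun a _ q => ⟨q, (Quiver.Path.nil_comp q).symm⟩⟩
  | succ j ih =>
    obtain ⟨p, hp, hq⟩ := ih
    refine ⟨(α (n + j)).toPath.comp p, ?_, fun a ha q => ?_⟩
    · rw [pathHom_comp, pathHom_toPath, M.map_comp]
      exact hp.comp (hbij _ (Nat.le_add_right n j))
    · have hl : q.length ≠ 0 := fun h => ha j (q.eq_of_length_zero h).symm
      obtain ⟨m, hm⟩ := Nat.exists_eq_succ_of_ne_zero hl
      obtain ⟨w, β, q, -, rfl⟩ := q.eq_toPath_comp_of_length_eq_succ hm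
      cases hout _ _ β
      obtain ⟨q', rfl⟩ := hq a ha q
      exact ⟨q', (Quiver.Path.comp_assoc _ _ _).symm⟩

/-- The ray `v s 0, v s 1, …` together with its attaching vertex `s`. -/
def ray (v : Q → ℕ → Q) (s : Q) : ℕ → Q
  | 0 => s
  | i + 1 => v s i

theorem sigma_eq_of_card_eq_one {x y w : Q} (h : Nat.card (x ⟶ y) = 1) (α : x ⟶ y) (β : w ⟶ y)
    (hw : w = x) : (⟨w, β⟩ : Σ w, w ⟶ y) = ⟨x, α⟩ := by
  subst hw
  have := (Nat.card_eq_one_iff_unique.1 h).1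
  rw [Subsingleton.elim α β]

theorem sigma_eq_of_card_eq_one' {x y w : Q} (h : Nat.card (x ⟶ y) = 1) (α : x ⟶ y) (β : x ⟶ w)
    (hw : w = y) : (⟨w, β⟩ : Σ w, x ⟶ w) = ⟨y, α⟩ := by
  subst hw
  have := (Nat.card_eq_one_iff_unique.1 h).1
  rw [Subsingleton.elim α β]

theorem inRrep_of_indec_of_isStarQuiver (hQ : StronglyLocallyFinite Q) (hstar : IsStarQuiver Q)
    (hM : IsLfdMod k M) (h : Indec k M) : InRrep k Q M := by
  obtain ⟨Γ, S₁, S₂, v, hΓ, hS₁, hS₂, hdisj, -, hv, hinj, hcov, hu₁, hu₂, harr⟩ := hstar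
  have hSΓ : S₁ ∪ S₂ ⊆ Γ := Set.union_subset hS₁ hS₂
  have hr : ∀ s ∈ S₁ ∪ S₂, ∀ t ∈ S₁ ∪ S₂, ∀ i j, 0 < i → 0 < j → ray v s i = ray v t j →
      s = t ∧ i = j := by
    rintro s hs t ht (_ | i) (_ | j) hi hj hij
    · exact absurd hi (lt_irrefl _)
    · exact absurd hi (lt_irrefl _)
    · exact absurd hj (lt_irrefl _)
    · obtain ⟨h1, h2⟩ := hinj s hs t ht i j hij
      exact ⟨h1, congrArg _ h2⟩
  have hrinj : ∀ s ∈ S₁ ∪ S₂, Function.Injective (ray v s) := by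
    rintro s hs (_ | i) (_ | j) hij
    · rfl
    · have hij : s = v s j := hij
      exact absurd (hSΓ hs) (hij ▸ hv s hs j)
    · have hij : v s i = s := hij
      exact absurd (hSΓ hs) (hij ▸ hv s hs i)
    · exact (hr s hs s hs _ _ i.succ_pos j.succ_pos hij).2
  have hne : ∀ s ∈ S₁, ∀ t ∈ S₂, s ≠ t := fun s hs t ht hst =>
    Set.disjoint_left.1 hdisj hs (hst ▸ ht)
  have hc₁ : ∀ s ∈ S₁, ∀ i, Nat.card (ray v s i ⟶ ray v s (i + 1)) = 1 := by
    rintro s hs (_ | i)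
    exacts [(hu₁ s hs).1, (hu₁ s hs).2 i]
  have hc₂ : ∀ s ∈ S₂, ∀ i, Nat.card (ray v s (i + 1) ⟶ ray v s i) = 1 := by
    rintro s hs (_ | i)
    exacts [(hu₂ s hs).1, (hu₂ s hs).2 i]
  have hin₁ : ∀ s ∈ S₁, ∀ i y, (y ⟶ ray v s (i + 1)) → y = ray v s i := by
    intro s hs i y β
    rcases harr _ _ β fun hh => hv s (.inl hs) i hh.2 with
      ⟨t, ht, ⟨rfl, h2⟩ | ⟨j, rfl, h2⟩⟩ | ⟨t, ht, ⟨-, h2⟩ | ⟨j, -, h2⟩⟩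
    · obtain ⟨rfl, rfl⟩ := hinj s (.inl hs) _ (.inl ht) _ _ h2
      rfl
    · obtain ⟨rfl, rfl⟩ := hinj s (.inl hs) _ (.inl ht) _ _ h2
      rfl
    · exact absurd (hS₂ ht) (h2 ▸ hv s (.inl hs) i)
    · exact absurd (hinj s (.inl hs) _ (.inr ht) _ _ h2).1 (hne s hs t ht)
  have hout₁ : ∀ s ∈ S₁, ∀ i z, (ray v s (i + 1) ⟶ z) → z = ray v s (i + 1 + 1) := by
    intro s hs i y β
    rcases harr _ _ β fun hh => hv s (.inl hs) i hh.1 with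
      ⟨t, ht, ⟨h2, rfl⟩ | ⟨j, h2, rfl⟩⟩ | ⟨t, ht, ⟨h2, -⟩ | ⟨j, h2, -⟩⟩
    · exact absurd (hS₁ ht) (h2 ▸ hv s (.inl hs) i)
    · obtain ⟨rfl, rfl⟩ := hinj s (.inl hs) _ (.inl ht) _ _ h2
      rfl
    · exact absurd (hinj s (.inl hs) _ (.inr ht) _ _ h2).1 (hne s hs t ht)
    · exact absurd (hinj s (.inl hs) _ (.inr ht) _ _ h2).1 (hne s hs t ht)
  have hout₂ : ∀ s ∈ S₂, ∀ i y, (ray v s (i + 1) ⟶ y) → y = ray v s i := by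
    intro s hs i y β
    rcases harr _ _ β fun hh => hv s (.inr hs) i hh.1 with
      ⟨t, ht, ⟨h2, -⟩ | ⟨j, h2, -⟩⟩ | ⟨t, ht, ⟨h2, rfl⟩ | ⟨j, h2, rfl⟩⟩
    · exact absurd (hS₁ ht) (h2 ▸ hv s (.inr hs) i)
    · exact absurd (hinj s (.inr hs) _ (.inl ht) _ _ h2).1 (hne t ht s hs).symm
    · obtain ⟨rfl, rfl⟩ := hinj s (.inr hs) _ (.inr ht) _ _ h2
      rfl
    · obtain ⟨rfl, rfl⟩ := hinj s (.inr hs) _ (.inr ht) _ _ h2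
      rfl
  have hin₂ : ∀ s ∈ S₂, ∀ i z, (z ⟶ ray v s (i + 1)) → z = ray v s (i + 1 + 1) := by
    intro s hs i y β
    rcases harr _ _ β fun hh => hv s (.inr hs) i hh.2 with
      ⟨t, ht, ⟨-, h2⟩ | ⟨j, -, h2⟩⟩ | ⟨t, ht, ⟨rfl, h2⟩ | ⟨j, rfl, h2⟩⟩
    · exact absurd (hinj s (.inr hs) _ (.inl ht) _ _ h2).1 (hne t ht s hs).symm
    · exact absurd (hinj s (.inr hs) _ (.inl ht) _ _ h2).1 (hne t ht s hs).symm
    · exact absurd (hS₂ ht) (h2 ▸ hv s (.inr hs) i)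
    · obtain ⟨rfl, rfl⟩ := hinj s (.inr hs) _ (.inr ht) _ _ h2
      rfl
  have hα₁ : ∀ s ∈ S₁, ∀ i, Nonempty (ray v s i ⟶ ray v s (i + 1)) := fun s hs i =>
    (Nat.card_eq_one_iff_unique.1 (hc₁ s hs i)).2
  have hα₂ : ∀ s ∈ S₂, ∀ i, Nonempty (ray v s (i + 1) ⟶ ray v s i) := fun s hs i =>
    (Nat.card_eq_one_iff_unique.1 (hc₂ s hs i)).2
  have α₁ : ∀ s ∈ S₁, ∀ i, ray v s i ⟶ ray v s (i + 1) := fun s hs i => (hα₁ s hs i).some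
  have α₂ : ∀ s ∈ S₂, ∀ i, ray v s (i + 1) ⟶ ray v s i := fun s hs i => (hα₂ s hs i).some
  have hin₁' : ∀ s (hs : s ∈ S₁), ∀ i y (β : y ⟶ ray v s (i + 1)),
      (⟨y, β⟩ : Σ y, y ⟶ ray v s (i + 1)) = ⟨ray v s i, α₁ s hs i⟩ := fun s hs i y β =>
    sigma_eq_of_card_eq_one (hc₁ s hs i) _ β (hin₁ s hs i y β)
  have hout₂' : ∀ s (hs : s ∈ S₂), ∀ i y (β : ray v s (i + 1) ⟶ y),
      (⟨y, β⟩ : Σ y, ray v s (i + 1) ⟶ y) = ⟨ray v s i, α₂ s hs i⟩ := fun s hs i y β =>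
    sigma_eq_of_card_eq_one' (hc₂ s hs i) _ β (hout₂ s hs i y β)
  have hb₁ : ∀ᶠ n in Filter.atTop, ∀ s (hs : s ∈ S₁), ∀ i ≥ n,
      Function.Bijective (M.map (arrHom k Q (α₁ s hs i))).hom := by
    have := (hΓ.subset hS₁).to_subtype
    suffices ∀ᶠ n in Filter.atTop, ∀ s : S₁, ∀ i ≥ n,
        Function.Bijective (M.map (arrHom k Q (α₁ s.1 s.2 i))).hom from
      this.mono fun n hn s hs => hn ⟨s, hs⟩
    refine Filter.eventually_all.2 fun ⟨s, hs⟩ => ?_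
    obtain ⟨n, hn⟩ := h.exists_bijective_forward hM (hrinj s (.inl hs)) (α₁ s hs) (hin₁' s hs)
      fun i z β => sigma_eq_of_card_eq_one' (hc₁ s hs (i + 1)) _ β (hout₁ s hs i z β)
    exact Filter.eventually_atTop.2 ⟨n, fun m hm i hi => hn i (hm.trans hi)⟩
  have hb₂ : ∀ᶠ n in Filter.atTop, ∀ s (hs : s ∈ S₂), ∀ i ≥ n,
      Function.Bijective (M.map (arrHom k Q (α₂ s hs i))).hom := by
    have := (hΓ.subset hS₂).to_subtype
    suffices ∀ᶠ n in Filter.atTop, ∀ s : S₂, ∀ i ≥ n,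
        Function.Bijective (M.map (arrHom k Q (α₂ s.1 s.2 i))).hom from
      this.mono fun n hn s hs => hn ⟨s, hs⟩
    refine Filter.eventually_all.2 fun ⟨s, hs⟩ => ?_
    obtain ⟨n, hn⟩ := h.exists_bijective_backward hM (hrinj s (.inr hs)) (α₂ s hs) (hout₂' s hs)
      fun i z β => sigma_eq_of_card_eq_one (hc₂ s hs (i + 1)) _ β (hin₂ s hs i z β)
    exact Filter.eventually_atTop.2 ⟨n, fun m hm i hi => hn i (hm.trans hi)⟩
  obtain ⟨n, hn₁, hn₂, hn⟩ := (hb₁.and (hb₂.and (Filter.eventually_gt_atTop 0))).exists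
  have hF : ((fun s => ray v s n) '' S₁).Finite := (hΓ.subset hS₁).image _
  refine inRrep_of_truncation hM hQ.2 (T := {x | ∃ s ∈ S₁, ∃ i, x = ray v s (n + i)})
    (F := (fun s => ray v s n) '' S₁)
    (G := {y | (¬ ∃ s ∈ S₁, ∃ i, y = ray v s (n + i)) ∧ ∀ s ∈ S₂, ∀ i, y ≠ ray v s (n + i + 1)})
    ?_ hF ?_ ?_ ?_ ?_ ?_ ?_
  · rintro _ ⟨s, hs, i, rfl⟩ y β
    obtain ⟨m, hm⟩ := Nat.exists_eq_succ_of_ne_zero (show n + i ≠ 0 by lia)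
    refine ⟨s, hs, i + 1, ?_⟩
    rw [hm] at β
    rw [hout₁ s hs m y β, ← add_assoc, hm]
  · rintro _ ⟨s, hs, rfl⟩
    exact ⟨s, hs, 0, rfl⟩
  · refine (hΓ.union (((hΓ.subset hSΓ).prod (Set.finite_Iic n)).image
      fun p => ray v p.1 p.2)).subset fun y ⟨hy₁, hy₂⟩ => ?_
    by_cases hy : y ∈ Γ
    · exact .inl hy
    obtain ⟨s, hs, i, rfl⟩ := hcov y hy
    refine .inr ⟨(s, i + 1), ⟨hs, ?_⟩, rfl⟩
    by_contra hi
    obtain ⟨j, rfl⟩ := Nat.exists_eq_add_of_le (show n ≤ i by simpa [Nat.lt_succ_iff] using hi)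
    rcases hs with hs | hs
    · exact hy₁ ⟨s, hs, j + 1, rfl⟩
    · exact hy₂ s hs j rfl
  · exact Set.disjoint_left.2 fun y hy => hy.1
  · rintro _ ⟨s, hs, j, rfl⟩
    obtain ⟨p, hp, hq⟩ := exists_forward_path (α₁ s hs) (hin₁' s hs) (hn₁ s hs) j
    refine ⟨_, ⟨s, hs, rfl⟩, p, hp, ?_⟩
    rintro _ ⟨t, ht, rfl⟩
    refine hq _ fun l hl => ?_
    have := (hr t (.inl ht) s (.inl hs) _ _ hn (Nat.succ_pos _) hl).2
    lia
  · intro y hyT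
    by_cases hy : ∀ s ∈ S₂, ∀ i, y ≠ ray v s (n + i + 1)
    · exact ⟨y, ⟨hyT, hy⟩, Quiver.Path.nil, bijective_map_nil y,
        fun a _ q => ⟨q, (Quiver.Path.nil_comp q).symm⟩⟩
    · push Not at hy
      obtain ⟨s, hs, j, rfl⟩ := hy
      obtain ⟨p, hp, hq⟩ := exists_backward_path (α₂ s hs) (hout₂' s hs) (hn₂ s hs) (j + 1)
      refine ⟨_, ⟨?_, fun t ht l hl => ?_⟩, p, hp, fun a ha => hq a (ha.2 s hs)⟩
      · rintro ⟨t, ht, i, hi⟩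
        exact hne t ht s hs (hr s (.inr hs) t (.inl ht) _ _ hn (by lia) hi).1.symm
      · have := (hr s (.inr hs) t (.inr ht) _ _ hn (Nat.succ_pos _) hl).2
        lia
  · refine (hF.biUnion fun y _ => have := (hQ.1 y).2; Set.finite_range (ι := Σ z, z ⟶ y)
      fun p => (⟨p.1, y, p.2⟩ : Σ (x : Q) (y : Q), x ⟶ y)).subset ?_
    rintro ⟨x, _, β⟩ ⟨hx, s, hs, i, rfl⟩
    have hi : i = 0 := by
      by_contra h0
      obtain ⟨j, rfl⟩ := Nat.exists_eq_succ_of_ne_zero h0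
      exact hx ⟨s, hs, j, hin₁ s hs (n + j) x β⟩
    subst hi
    exact Set.mem_biUnion ⟨s, hs, rfl⟩ ⟨⟨x, β⟩, rfl⟩

end Star

variable (k : Type) [Field k] [IsAlgClosed k]
variable (Q : Type) [Quiver.{0} Q]

/-- For a connected strongly locally finite quiver `Q`, there is an indecomposable
representation in `rep(Q)` not lying in `rrep(Q)` if and only if `Q` is not a star
quiver. -/
theorem statement_19 (hQ : StronglyLocallyFinite Q) (hconn : QuiverConnected Q) :
    (∃ M : PathCat k Q ⥤ ModuleCat.{0} k, IsLfdMod k M ∧ Indec k M ∧ ¬ InRrep k Q M) ↔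
      ¬ IsStarQuiver Q := by
  refine ⟨fun ⟨M, hM, h, hr⟩ hs => hr (inRrep_of_indec_of_isStarQuiver hQ hs hM h), fun h => ?_⟩
  exact exists_not_inRrep_of_infinite k hQ hconn fun hfin => h (isStarQuiver_of_finite hQ hconn hfin)

end Paper
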